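/- arXiv:1908.03801 — 2 statements merged into one kernel-verified Lean document; each statement's English description precedes it below -/
import Mathlib

section
/- Let F = F_r be the free group on a basis x_1, …, x_r with r ≥ 1, and let d ≥ 1 be an integer. If a word w ∈ F induces the same measure as x_1^d on every finite group, then there is an automorphism of F mapping x_1^d to w (i.e., w ~_{Aut F} x_1^d). In particular, the word x^d is universally profinitely rigid. -/
/-- Two elements of a group `Γ` induce the same measure on every finite group:
for every finite group `G` and every `g : G`, the number of homomorphisms
`φ : Γ →* G` with `φ w₁ = g` equals the number of homomorphisms with `φ w₂ = g`. -/
def SameMeasureOnFiniteGroups {Γ : Type} [Group Γ] (w₁ w₂ : Γ) : Prop :=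
  ∀ (G : Type) [Group G] [Finite G] (g : G),
    Nat.card {φ : Γ →* G // φ w₁ = g} = Nat.card {φ : Γ →* G // φ w₂ = g}

/-- The group of pairs `(t, g)` of a family `t` of elements of a ring `R` and a unit `g` of `R`,
with multiplication `(t, g) * (s, h) = (t h + s, g h)`. -/
@[ext]
structure RightAffine (ι R : Type*) [Ring R] where
  /-- the translation parts -/
  trans : ι → R
  /-- the linear part -/
  lin : Rˣ

namespace RightAffine

variable {ι R : Type*} [Ring R]

instance : Mul (RightAffine ι R) :=
  ⟨fun x y => ⟨fun j => x.trans j * y.lin + y.trans j, x.lin * y.lin⟩⟩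

instance : One (RightAffine ι R) := ⟨⟨0, 1⟩⟩

instance : Inv (RightAffine ι R) :=
  ⟨fun x => ⟨fun j => -(x.trans j * (x.lin⁻¹ : Rˣ)), x.lin⁻¹⟩⟩

@[simp] lemma mul_trans (x y : RightAffine ι R) (j : ι) :
    (x * y).trans j = x.trans j * y.lin + y.trans j := rfl

@[simp] lemma mul_lin (x y : RightAffine ι R) : (x * y).lin = x.lin * y.lin := rfl

@[simp] lemma one_trans (j : ι) : (1 : RightAffine ι R).trans j = 0 := rfl

@[simp] lemma one_lin : (1 : RightAffine ι R).lin = 1 := rfl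

@[simp] lemma inv_trans (x : RightAffine ι R) (j : ι) :
    x⁻¹.trans j = -(x.trans j * (x.lin⁻¹ : Rˣ)) := rfl

@[simp] lemma inv_lin (x : RightAffine ι R) : x⁻¹.lin = x.lin⁻¹ := rfl

instance : Group (RightAffine ι R) :=
  Group.ofLeftAxioms
    (fun x y z => by
      ext j
      · simp [add_mul, mul_assoc, add_assoc]
      · simp [mul_assoc])
    (fun x => by ext j <;> simp)
    (fun x => by ext j <;> simp)

instance [Finite ι] [Finite R] : Finite (RightAffine ι R) :=
  Finite.of_injective (fun x => (x.trans, x.lin)) fun x y h => by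
    simp only [Prod.mk.injEq] at h
    exact RightAffine.ext h.1 h.2

/-- The projection to the linear part. -/
def linHom : RightAffine ι R →* Rˣ where
  toFun := lin
  map_one' := rfl
  map_mul' _ _ := rfl

/-- The projection keeping one translation coordinate. -/
def evalHom (j : ι) : RightAffine ι R →* RightAffine Unit R where
  toFun x := ⟨fun _ => x.trans j, x.lin⟩
  map_one' := rfl
  map_mul' _ _ := rfl

end RightAffine

section Crossed

variable {α R : Type*} [Ring R]

/-- The right derivation `c` of the free group with values in `R`, relative to the homomorphism
`lift q`, which takes the values `t` on the generators: `c (g * h) = c g * lift q h + c h`. -/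
def crossed (q : α → Rˣ) (t : α → R) (g : FreeGroup α) : R :=
  (FreeGroup.lift (fun i => (⟨fun _ => t i, q i⟩ : RightAffine Unit R)) g).trans ()

lemma lift_rightAffine_lin {ι : Type*} (q : α → Rˣ) (t : α → ι → R) (g : FreeGroup α) :
    (FreeGroup.lift (fun i => (⟨t i, q i⟩ : RightAffine ι R)) g).lin = FreeGroup.lift q g := by
  have : RightAffine.linHom.comp (FreeGroup.lift (fun i => (⟨t i, q i⟩ : RightAffine ι R))) =
      FreeGroup.lift q := FreeGroup.ext_hom _ _ fun i => by simp [RightAffine.linHom]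
  exact DFunLike.congr_fun this g

lemma lift_rightAffine_trans {ι : Type*} (q : α → Rˣ) (t : α → ι → R) (g : FreeGroup α) (j : ι) :
    (FreeGroup.lift (fun i => (⟨t i, q i⟩ : RightAffine ι R)) g).trans j =
      crossed q (fun i => t i j) g := by
  have : (RightAffine.evalHom j).comp
        (FreeGroup.lift (fun i => (⟨t i, q i⟩ : RightAffine ι R))) =
      FreeGroup.lift (fun i => (⟨fun _ => t i j, q i⟩ : RightAffine Unit R)) :=
    FreeGroup.ext_hom _ _ fun i => by simp [RightAffine.evalHom]
  exact congrArg (fun x => RightAffine.trans x ()) (DFunLike.congr_fun this g)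

@[simp] lemma crossed_of (q : α → Rˣ) (t : α → R) (i : α) :
    crossed q t (FreeGroup.of i) = t i := by simp [crossed]

@[simp] lemma crossed_one (q : α → Rˣ) (t : α → R) : crossed q t 1 = 0 := by simp [crossed]

lemma crossed_mul (q : α → Rˣ) (t : α → R) (g h : FreeGroup α) :
    crossed q t (g * h) = crossed q t g * (FreeGroup.lift q h : Rˣ) + crossed q t h := by
  simp [crossed, lift_rightAffine_lin]

lemma crossed_inv (q : α → Rˣ) (t : α → R) (g : FreeGroup α) :
    crossed q t g⁻¹ = -(crossed q t g * (FreeGroup.lift q g⁻¹ : Rˣ)) := by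
  simp [crossed, lift_rightAffine_lin]

lemma crossed_inv_mul (q : α → Rˣ) (t : α → R) (g h : FreeGroup α) :
    crossed q t (g⁻¹ * h) =
      -(crossed q t g * (FreeGroup.lift q (g⁻¹ * h) : Rˣ)) + crossed q t h := by
  rw [crossed_mul, crossed_inv, neg_mul, mul_assoc, ← Units.val_mul, ← map_mul]

/-- A right derivation is determined by its values on the generators. -/
lemma eq_crossed (q : α → Rˣ) (c : FreeGroup α → R)
    (hc : ∀ g h, c (g * h) = c g * (FreeGroup.lift q h : Rˣ) + c h) (g : FreeGroup α) :
    c g = crossed q (fun i => c (FreeGroup.of i)) g := by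
  let ψ : FreeGroup α →* RightAffine Unit R :=
    MonoidHom.mk' (fun g => ⟨fun _ => c g, FreeGroup.lift q g⟩) fun g h => by
      ext <;> simp [hc]
  have : ψ = FreeGroup.lift (fun i => ⟨fun _ => c (FreeGroup.of i), q i⟩) :=
    FreeGroup.ext_hom _ _ fun i => by simp [ψ]
  exact congrArg (fun x => RightAffine.trans x ()) (DFunLike.congr_fun this g)

/-- The fundamental formula of Fox calculus. -/
lemma crossed_eq_sum [Fintype α] [DecidableEq α] (q : α → Rˣ) (t : α → R) (g : FreeGroup α) :
    crossed q t g = ∑ i, t i * crossed q (Pi.single i 1) g := by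
  symm
  simpa [Pi.single_apply] using eq_crossed q (fun g => ∑ i, t i * crossed q (Pi.single i 1) g)
    (fun g h => by simp [crossed_mul, mul_add, mul_assoc, Finset.sum_add_distrib,
      Finset.sum_mul]) g

lemma map_crossed {S : Type*} [Ring S] (σ : R →+* S) (q : α → Rˣ) (t : α → R)
    (g : FreeGroup α) :
    σ (crossed q t g) =
      crossed (fun i => Units.map (σ : R →* S) (q i)) (fun i => σ (t i)) g := by
  have hq : ∀ h, (FreeGroup.lift fun i => Units.map (σ : R →* S) (q i)) h =
      Units.map (σ : R →* S) (FreeGroup.lift q h) := fun h => by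
    have : FreeGroup.lift (fun i => Units.map (σ : R →* S) (q i)) =
      (Units.map (σ : R →* S)).comp (FreeGroup.lift q) := FreeGroup.ext_hom _ _ fun i => by simp
    exact DFunLike.congr_fun this h
  simpa using eq_crossed (fun i => Units.map (σ : R →* S) (q i)) (fun g => σ (crossed q t g))
    (fun g h => by simp [crossed_mul, hq]) g

lemma crossed_of_pow (q : α → Rˣ) (t : α → R) (i : α) (d : ℕ) :
    crossed q t (FreeGroup.of i ^ d) = t i * ∑ j ∈ Finset.range d, (q i : R) ^ j := by
  induction d with
  | zero => simp
  | succ d ih =>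
    rw [pow_succ', crossed_mul, ih, Finset.sum_range_succ]
    simp [mul_add, add_comm]

end Crossed

section Measure

/-- Two finite families of functions with the same mixed moments have the same values. -/
lemma exists_eq_of_moments {ρ κ : Type*} (A B : Finset κ) (a b : κ → ρ → ℤ)
    (h : ∀ l : List ρ, ∑ q ∈ A, (l.map (a q)).prod = ∑ q ∈ B, (l.map (b q)).prod)
    {q₀ : κ} (hq₀ : q₀ ∈ A) : ∃ q ∈ B, b q = a q₀ := by
  classical
  have key : ∀ p : MvPolynomial ρ ℤ,
      ∑ q ∈ A, MvPolynomial.eval (a q) p = ∑ q ∈ B, MvPolynomial.eval (b q) p := by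
    intro p
    induction p using MvPolynomial.induction_on' with
    | monomial u c =>
      have := h u.toMultiset.toList
      have e : ∀ f : ρ → ℤ, MvPolynomial.eval f (MvPolynomial.monomial u c) =
          c * (u.toMultiset.toList.map f).prod := fun f => by
        rw [MvPolynomial.eval_monomial, ← Multiset.prod_coe, ← Multiset.map_coe,
          Multiset.coe_toList, Finsupp.toMultiset_map, Finsupp.prod_toMultiset,
          Finsupp.prod_mapDomain_index (by simp) (by simp [pow_add])]
      simp only [e, ← Finset.mul_sum, this]
    | add p q hp hq => simp only [map_add, Finset.sum_add_distrib, hp, hq]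
  by_contra! hne
  let P : Finset (ρ → ℤ) := (A.image a ∪ B.image b).erase (a q₀)
  have hP : ∀ f ∈ P, ∃ p : MvPolynomial ρ ℤ,
      MvPolynomial.eval f p = 0 ∧ MvPolynomial.eval (a q₀) p ≠ 0 := fun f hf => by
    obtain ⟨j, hj⟩ := Function.ne_iff.mp (Finset.ne_of_mem_erase hf)
    exact ⟨MvPolynomial.X j - MvPolynomial.C (f j), by simp, by simpa [sub_eq_zero] using hj.symm⟩
  choose! p hp0 hp using hP
  have eval_prod : ∀ f, MvPolynomial.eval f (∏ f' ∈ P, p f' ^ 2) =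
      ∏ f' ∈ P, MvPolynomial.eval f (p f') ^ 2 := fun f => by simp [map_prod]
  have hzero : ∀ f ∈ P, MvPolynomial.eval f (∏ f' ∈ P, p f' ^ 2) = 0 := fun f hf => by
    rw [eval_prod]
    exact Finset.prod_eq_zero hf (by simp [hp0 f hf])
  have hB : ∑ q ∈ B, MvPolynomial.eval (b q) (∏ f ∈ P, p f ^ 2) = 0 :=
    Finset.sum_eq_zero fun q hq => hzero _ (Finset.mem_erase.mpr
      ⟨hne q hq, Finset.mem_union_right _ (Finset.mem_image_of_mem _ hq)⟩)
  have hA : 0 < ∑ q ∈ A, MvPolynomial.eval (a q) (∏ f ∈ P, p f ^ 2) := by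
    refine Finset.sum_pos' (fun q _ => ?_) ⟨q₀, hq₀, ?_⟩
    · rw [eval_prod]
      exact Finset.prod_nonneg fun _ _ => sq_nonneg _
    · rw [eval_prod]
      exact Finset.prod_pos fun f hf => sq_pos_of_ne_zero (hp f hf)
  exact hA.ne' ((key _).trans hB)

/-- The homomorphisms to `RightAffine ι R` sending `w` to a given element, sorted by their
linear parts. -/
lemma card_hom_rightAffine {α ι R : Type} [Fintype α] [Fintype ι] [Ring R] [Fintype R]
    [DecidableEq R] [DecidableEq α] (w : FreeGroup α) (s : ι → R) (q₀ : Rˣ) :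
    Nat.card {φ : FreeGroup α →* RightAffine ι R // φ w = ⟨s, q₀⟩} =
      ∑ q : α → Rˣ with FreeGroup.lift q w = q₀,
        ∏ j, Nat.card {t : α → R // crossed q t w = s j} := by
  let e : {φ : FreeGroup α →* RightAffine ι R // φ w = ⟨s, q₀⟩} ≃
      Σ q : {q : α → Rˣ // FreeGroup.lift q w = q₀},
        ∀ j, {t : α → R // crossed q.1 t w = s j} :=
    { toFun := fun φ => ⟨⟨fun i => (φ.1 (FreeGroup.of i)).lin, by
          rw [← lift_rightAffine_lin _ (fun i => (φ.1 (FreeGroup.of i)).trans)]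
          have : FreeGroup.lift (fun i => φ.1 (FreeGroup.of i)) = φ.1 :=
            FreeGroup.ext_hom _ _ fun i => by simp
          change (FreeGroup.lift (fun i => φ.1 (FreeGroup.of i)) w).lin = q₀
          rw [this, φ.2]⟩,
        fun j => ⟨fun i => (φ.1 (FreeGroup.of i)).trans j, by
          rw [← lift_rightAffine_trans _ (fun i => (φ.1 (FreeGroup.of i)).trans)]
          have : FreeGroup.lift (fun i => φ.1 (FreeGroup.of i)) = φ.1 :=
            FreeGroup.ext_hom _ _ fun i => by simp
          change (FreeGroup.lift (fun i => φ.1 (FreeGroup.of i)) w).trans j = s j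
          rw [this, φ.2]⟩⟩
      invFun := fun x => ⟨FreeGroup.lift (fun i => ⟨fun j => (x.2 j).1 i, x.1.1 i⟩), by
        ext j
        · rw [lift_rightAffine_trans]
          exact (x.2 j).2
        · rw [lift_rightAffine_lin, x.1.2]⟩
      left_inv := fun φ => Subtype.ext (FreeGroup.ext_hom _ _ fun i => by simp)
      right_inv := fun x => by
        obtain ⟨⟨q, hq⟩, t⟩ := x
        refine Sigma.ext (Subtype.ext (by simp)) (Function.hfunext rfl fun j j' hj => ?_)
        cases hj
        exact (Subtype.heq_iff_coe_eq (by simp)).mpr (funext fun i => by simp) }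
  rw [Nat.card_congr e, Nat.card_sigma]
  simp only [Nat.card_pi]
  exact (Finset.sum_subtype _ (by simp) (fun q : α → Rˣ =>
    ∏ j, Nat.card {t : α → R // crossed q t w = s j})).symm

/-- If `w` and `w'` induce the same measure, every homomorphism to the units of a finite ring
is matched by another one in such a way that the right derivations take the same values
at `w` as at `w'`. -/
lemma SameMeasureOnFiniteGroups.exists_crossed_iff {α R : Type} [Finite α] [Ring R] [Finite R]
    {w w' : FreeGroup α} (h : SameMeasureOnFiniteGroups w w') (q : α → Rˣ) :
    ∃ q' : α → Rˣ, ∀ s : R, (∃ t, crossed q t w = s) ↔ ∃ t, crossed q' t w' = s := by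
  classical
  have := Fintype.ofFinite α
  have := Fintype.ofFinite R
  obtain ⟨q', -, hq'⟩ := exists_eq_of_moments
    (Finset.univ.filter fun p : α → Rˣ => FreeGroup.lift p w = FreeGroup.lift q w)
    (Finset.univ.filter fun p : α → Rˣ => FreeGroup.lift p w' = FreeGroup.lift q w)
    (fun p s => (Nat.card {t : α → R // crossed p t w = s} : ℤ))
    (fun p s => (Nat.card {t : α → R // crossed p t w' = s} : ℤ))
    (fun l => by
      have := h (RightAffine (Fin l.length) R) ⟨l.get, FreeGroup.lift q w⟩
      rw [card_hom_rightAffine, card_hom_rightAffine] at this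
      have e : ∀ f : R → ℤ, (l.map f).prod = ∏ j, f (l.get j) := fun f => by
        rw [← List.prod_ofFn]
        congr 1
        exact (List.ofFn_getElem_eq_map l f).symm
      simp only [e]
      exact_mod_cast this)
    (q₀ := q) (by simp)
  refine ⟨q', fun s => ?_⟩
  have hs := congrFun hq' s
  simp only [Nat.cast_inj] at hs
  have pos : ∀ (p : α → Rˣ) (u : FreeGroup α), (∃ t, crossed p t u = s) ↔
      0 < Nat.card {t : α → R // crossed p t u = s} := fun p u => by
    rw [Finite.card_pos_iff, nonempty_subtype]
  rw [pos, pos, hs]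

end Measure

section GroupAlgebra

/-- A partially defined injective endomorphism of a finite-dimensional subspace extends to an
automorphism of it. -/
lemma exists_linearEquiv_of_partial {k N : Type*} [Field k] [AddCommGroup N] [Module k N]
    (V : Submodule k N) [FiniteDimensional k V] (T : N ≃ₗ[k] N) :
    ∃ S : V ≃ₗ[k] V, ∀ v v' : V, T v = v' → S v = v' := by
  let g : V →ₗ[k] N := T.toLinearMap ∘ₗ V.subtype
  let f : V.comap g →ₗ[k] V := (g ∘ₗ (V.comap g).subtype).codRestrict V fun v => v.2
  have hf : Function.Injective f := fun v v' h => by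
    have := congrArg (Subtype.val : V → N) h
    exact Subtype.ext (Subtype.ext (T.injective this))
  obtain ⟨S, hS⟩ := Submodule.exists_linearEquiv_restrict_eq (LinearEquiv.ofInjective f hf)
  refine ⟨S, fun v v' h => ?_⟩
  have hv : v ∈ V.comap g := by
    change T v ∈ V
    rw [h]
    exact v'.2
  have := hS ⟨v, hv⟩
  rw [← this]
  exact Subtype.ext h

variable (k : Type*) [Field k] {α : Type*}

/-- The elements of the free group as units of the group algebra. -/
noncomputable def groupUnits : FreeGroup α →* (MonoidAlgebra k (FreeGroup α))ˣ :=
  (MonoidAlgebra.of k (FreeGroup α)).toHomUnits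

/-- The generators of the free group as units of the group algebra. -/
noncomputable def genUnits (i : α) : (MonoidAlgebra k (FreeGroup α))ˣ :=
  groupUnits k (FreeGroup.of i)

lemma lift_genUnits (g : FreeGroup α) :
    ((FreeGroup.lift (genUnits k) g : (MonoidAlgebra k (FreeGroup α))ˣ) :
      MonoidAlgebra k (FreeGroup α)) = MonoidAlgebra.of k (FreeGroup α) g := by
  have : FreeGroup.lift (genUnits k) = groupUnits (α := α) k :=
    FreeGroup.ext_hom _ _ fun i => by simp [genUnits]
  rw [this]
  rfl

/-- The augmentation of the group algebra. -/
noncomputable def augmentation : MonoidAlgebra k (FreeGroup α) →ₐ[k] k :=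
  MonoidAlgebra.lift k k (FreeGroup α) 1

variable {k}

@[simp] lemma augmentation_of (g : FreeGroup α) :
    augmentation k (MonoidAlgebra.of k (FreeGroup α) g) = 1 := by
  simp [augmentation]

/-- The combinations of the elements `D i` with coefficients in the augmentation ideal. -/
noncomputable def augmentedSpan [Fintype α] (D : α → MonoidAlgebra k (FreeGroup α)) :
    Submodule (MonoidAlgebra k (FreeGroup α)) (MonoidAlgebra k (FreeGroup α)) where
  carrier := {x | ∃ a : α → MonoidAlgebra k (FreeGroup α),
    (∀ i, augmentation k (a i) = 0) ∧ ∑ i, a i * D i = x}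
  zero_mem' := ⟨0, by simp⟩
  add_mem' := by
    rintro _ _ ⟨a, ha, rfl⟩ ⟨b, hb, rfl⟩
    exact ⟨a + b, by simp [ha, hb], by simp [add_mul, Finset.sum_add_distrib]⟩
  smul_mem' := by
    rintro c _ ⟨a, ha, rfl⟩
    exact ⟨fun i => c * a i, by simp [ha], by simp [Finset.mul_sum, mul_assoc]⟩

/-- If the Fox derivatives of `w` are left linearly independent over the group algebra, there is
a finite-dimensional representation of the free group with a vector which the Fox derivatives
send to linearly independent vectors fixed by the group. -/
lemma exists_representation_of_independent {α k : Type} [Field k] [Fintype α] [DecidableEq α]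
    (w : FreeGroup α)
    (h : ∀ a, crossed (genUnits k) a w = 0 → a = 0) :
    ∃ (V : Type) (_ : AddCommGroup V) (_ : Module k V) (_ : FiniteDimensional k V)
      (Q : α → (Module.End k V)ˣ) (v₀ : V),
      (∀ i j, (Q j : Module.End k V) (crossed Q (Pi.single i 1) w v₀) =
        crossed Q (Pi.single i 1) w v₀) ∧
      ∀ c : α → k, ∑ i, c i • crossed Q (Pi.single i 1) w v₀ = 0 → c = 0 := by
  let A := MonoidAlgebra k (FreeGroup α)
  let D : α → A := fun i => crossed (genUnits k) (Pi.single i 1) w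
  let L := augmentedSpan D
  let π : A →ₗ[A] A ⧸ L := L.mkQ
  let X : Set (A ⧸ L) :=
    (fun l => π (MonoidAlgebra.of k _ (FreeGroup.mk l))) '' {l | l <:+ w.toWord}
  have hX : X.Finite := by
    refine Set.Finite.image _ ((w.toWord.tails.toFinset.finite_toSet).subset fun l hl => ?_)
    simpa using hl
  let V : Submodule k (A ⧸ L) := Submodule.span k X
  have : FiniteDimensional k V := FiniteDimensional.span_of_finite k hX
  have hV : ∀ l, l <:+ w.toWord → π (MonoidAlgebra.of k _ (FreeGroup.mk l)) ∈ V :=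
    fun l hl => Submodule.subset_span ⟨l, hl, rfl⟩
  let T : α → (A ⧸ L) ≃ₗ[k] (A ⧸ L) := fun i =>
    LinearMap.GeneralLinearGroup.generalLinearEquiv k _
      (Units.map ((Algebra.lsmul k k (A ⧸ L) : A →ₐ[k] Module.End k (A ⧸ L)) :
        A →* Module.End k (A ⧸ L)) (genUnits k i))
  have hT : ∀ i x, T i x = (genUnits k i : A) • x := fun i x => rfl
  choose S hS using fun i => exists_linearEquiv_of_partial V (T i)
  let Q : α → (Module.End k V)ˣ := fun i =>
    (LinearMap.GeneralLinearGroup.generalLinearEquiv k V).symm (S i)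
  have hQ : ∀ i (v v' : V), (genUnits k i : A) • (v : A ⧸ L) = v' →
      (Q i : Module.End k V) v = v' := fun i v v' hv => hS i v v' hv
  have hQ' : ∀ i (v v' : V), ((genUnits k i)⁻¹ : Aˣ) • (v : A ⧸ L) = v' →
      (((Q i)⁻¹ : (Module.End k V)ˣ) : Module.End k V) v = v' := fun i v v' hv => by
    have h1 : (Q i : Module.End k V) v' = v := hQ i v' v (by
      rw [← hv]
      exact smul_inv_smul (genUnits k i) (v : A ⧸ L))
    rw [← h1, ← Module.End.mul_apply, Units.inv_mul, Module.End.one_apply]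
  let v₀ : V := ⟨π 1, by
    simpa only [← FreeGroup.one_eq_mk, map_one] using hV [] List.nil_suffix⟩
  have hlift : ∀ l, l <:+ w.toWord →
      ((((FreeGroup.lift Q (FreeGroup.mk l) : (Module.End k V)ˣ) : Module.End k V) v₀ : V) :
        A ⧸ L) =
        π (MonoidAlgebra.of k _ (FreeGroup.mk l)) := by
    intro l
    induction l with
    | nil =>
      intro _
      rw [← FreeGroup.one_eq_mk, map_one, map_one]
      rfl
    | cons p l ih =>
      intro hl
      have hl' : l <:+ w.toWord := (List.suffix_cons p l).trans hl
      have hm : FreeGroup.mk (p :: l) = FreeGroup.mk [p] * FreeGroup.mk l := by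
        rw [FreeGroup.mul_mk]; rfl
      obtain ⟨i, b⟩ := p
      cases b
      · have hi : (FreeGroup.mk [(i, false)] : FreeGroup α) = (FreeGroup.of i)⁻¹ := rfl
        rw [hm, hi, map_mul, Units.val_mul, Module.End.mul_apply, map_inv,
          FreeGroup.lift_apply_of]
        refine (congrArg Subtype.val (hQ' i _ ⟨_, hV _ hl⟩ ?_)).trans
          (congrArg (fun g => π (MonoidAlgebra.of k _ g)) hm)
        change _ = π (MonoidAlgebra.of k _ (FreeGroup.mk ((i, false) :: l)))
        rw [ih hl', Units.smul_def, ← map_smul, hm, hi,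
          ← FreeGroup.lift_apply_of (f := genUnits k) (x := i), ← map_inv, lift_genUnits,
          smul_eq_mul, ← map_mul]
      · have hi : (FreeGroup.mk [(i, true)] : FreeGroup α) = FreeGroup.of i := rfl
        rw [hm, hi, map_mul, Units.val_mul, Module.End.mul_apply, FreeGroup.lift_apply_of]
        refine (congrArg Subtype.val (hQ i _ ⟨_, hV _ hl⟩ ?_)).trans
          (congrArg (fun g => π (MonoidAlgebra.of k _ g)) hm)
        change _ = π (MonoidAlgebra.of k _ (FreeGroup.mk ((i, true) :: l)))
        rw [ih hl', ← map_smul, hm, hi, ← FreeGroup.lift_apply_of (f := genUnits k) (x := i),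
          lift_genUnits, smul_eq_mul, ← map_mul]
  have hcross : ∀ i l, l <:+ w.toWord →
      (((crossed Q (Pi.single i 1) (FreeGroup.mk l) : Module.End k V) v₀ : V) : A ⧸ L) =
        π (crossed (genUnits k) (Pi.single i 1) (FreeGroup.mk l)) := by
    intro i l
    induction l with
    | nil =>
      intro _
      rw [← FreeGroup.one_eq_mk, crossed_one, crossed_one, map_zero]
      rfl
    | cons p l ih =>
      intro hl
      have hl' : l <:+ w.toWord := (List.suffix_cons p l).trans hl
      have hm : FreeGroup.mk (p :: l) = FreeGroup.mk [p] * FreeGroup.mk l := by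
        rw [FreeGroup.mul_mk]; rfl
      obtain ⟨j, b⟩ := p
      cases b
      · have hi : (FreeGroup.mk [(j, false)] : FreeGroup α) = (FreeGroup.of j)⁻¹ := rfl
        have key := hlift _ hl
        rw [hm, hi, crossed_inv_mul, crossed_inv_mul, LinearMap.add_apply, Submodule.coe_add,
          ih hl', map_add, crossed_of, crossed_of, ← hi, ← hm]
        rcases eq_or_ne j i with rfl | hji
        · simp only [Pi.single_eq_same, one_mul, LinearMap.neg_apply, Submodule.coe_neg, map_neg]
          rw [key, lift_genUnits]
        · simp [Pi.single_eq_of_ne hji]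
      · have hi : (FreeGroup.mk [(j, true)] : FreeGroup α) = FreeGroup.of j := rfl
        have key := hlift _ hl'
        rw [hm, crossed_mul, crossed_mul, LinearMap.add_apply, Submodule.coe_add, ih hl', map_add,
          hi, crossed_of, crossed_of]
        rcases eq_or_ne j i with rfl | hji
        · simp only [Pi.single_eq_same, one_mul]
          rw [key, lift_genUnits]
        · simp [Pi.single_eq_of_ne hji]
  have he : ∀ i, (((crossed Q (Pi.single i 1) w : Module.End k V) v₀ : V) : A ⧸ L) =
      π (D i) := fun i => by
    have := hcross i w.toWord (List.suffix_refl _)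
    rwa [FreeGroup.mk_toWord] at this
  refine ⟨V, inferInstance, inferInstance, inferInstance, Q, v₀, fun i j => ?_, fun c hc => ?_⟩
  · refine hQ j _ _ ?_
    rw [he, ← map_smul, ← sub_eq_zero, ← map_sub]
    refine (Submodule.Quotient.mk_eq_zero L).mpr ⟨Pi.single i (genUnits k j - 1), fun i' => ?_, ?_⟩
    · rcases eq_or_ne i' i with rfl | hne
      · have := lift_genUnits (k := k) (FreeGroup.of j)
        rw [FreeGroup.lift_apply_of] at this
        rw [Pi.single_eq_same, map_sub, this, augmentation_of, map_one, sub_self]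
      · simp [Pi.single_eq_of_ne hne]
    · rw [Finset.sum_eq_single i (fun i' _ hne => by simp [Pi.single_eq_of_ne hne]) (by simp)]
      simp [sub_mul]
  · have h0 : π (∑ i, algebraMap k A (c i) * D i) = 0 := by
      rw [map_sum, ← Submodule.coe_zero (p := V), ← hc, Submodule.coe_sum]
      refine Finset.sum_congr rfl fun i _ => ?_
      rw [Submodule.coe_smul, he, ← smul_eq_mul, map_smul, algebraMap_smul]
    obtain ⟨a, ha, hsum⟩ := (Submodule.Quotient.mk_eq_zero L).mp h0
    have hz := h (fun i => algebraMap k A (c i) - a i) (by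
      rw [crossed_eq_sum]
      simp only [sub_mul, Finset.sum_sub_distrib]
      rw [sub_eq_zero]
      exact hsum.symm)
    funext i
    have := congrArg (augmentation k) (congrFun hz i)
    rw [map_sub, ha, sub_zero, Pi.zero_apply, map_zero] at this
    exact ((augmentation k).commutes (c i)).symm.trans this

/-- If `w` induces the same measure as a power of a generator and the rank is at least two, then
the Fox derivatives of `w` are left linearly dependent over the group algebra. -/
lemma SameMeasureOnFiniteGroups.exists_crossed_eq_zero (k : Type) {α : Type} [Field k] [Finite k]
    [Finite α] [Nontrivial α] {w : FreeGroup α} {x : α} {d : ℕ}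
    (h : SameMeasureOnFiniteGroups w (FreeGroup.of x ^ d)) :
    ∃ a : α → MonoidAlgebra k (FreeGroup α), a ≠ 0 ∧ crossed (genUnits k) a w = 0 := by
  classical
  have := Fintype.ofFinite α
  by_contra! hind
  obtain ⟨V, _, _, _, Q, v₀, hfix, hindep⟩ := exists_representation_of_independent w
    fun a ha => by_contra fun h0 => hind a h0 ha
  let e : α → V := fun i => crossed Q (Pi.single i 1) w v₀
  change ∀ i j, (Q j : Module.End k V) (e i) = e i at hfix
  change ∀ c : α → k, ∑ i, c i • e i = 0 → c = 0 at hindep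
  have : Finite V := Module.finite_of_finite k
  have : Finite (Module.End k V) := Finite.of_injective _ DFunLike.coe_injective
  let Φ : MonoidAlgebra k (FreeGroup α) →ₐ[k] Module.End k V :=
    MonoidAlgebra.lift k _ (FreeGroup α) ((Units.coeHom _).comp (FreeGroup.lift Q))
  have hΦ : ∀ g, Φ (MonoidAlgebra.of k _ g) = (FreeGroup.lift Q g : (Module.End k V)ˣ) :=
    fun g => by simp [Φ]
  have hscalar : ∀ a : Φ.range, ∃ c : k, ∀ i, (a : Module.End k V) (e i) = c • e i := by
    rintro ⟨_, b, rfl⟩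
    refine ⟨augmentation k b, fun i => ?_⟩
    induction b using MonoidAlgebra.induction_on with
    | of g =>
      change Φ (MonoidAlgebra.of k _ g) (e i) = _
      rw [hΦ, augmentation_of, one_smul]
      induction g using FreeGroup.induction_on with
      | C1 => simp
      | of j => simp [hfix]
      | inv_of j hj =>
        simp only [FreeGroup.lift_apply_of] at hj
        rw [map_inv, FreeGroup.lift_apply_of]
        conv_lhs => rw [← hfix i j]
        rw [← Module.End.mul_apply, Units.inv_mul, Module.End.one_apply]
      | mul g h hg hh => rw [map_mul, Units.val_mul, Module.End.mul_apply, hh, hg]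
    | add a b ha hb =>
      simp only [map_add, LinearMap.add_apply, add_smul] at ha hb ⊢
      rw [ha, hb]
    | smul c a ha =>
      change Φ a (e i) = _ at ha
      change Φ (c • a) (e i) = _
      rw [map_smul, map_smul, LinearMap.smul_apply, smul_assoc, ha]
  let q : α → (Φ.range)ˣ := fun j =>
    Units.map (Φ.rangeRestrict : MonoidAlgebra k (FreeGroup α) →* Φ.range) (genUnits k j)
  have hq : ∀ t : α → Φ.range, ((crossed q t w : Φ.range) : Module.End k V) =
      crossed Q (fun i => (t i : Module.End k V)) w := fun t => by
    have := map_crossed (Φ.range.val : Φ.range →+* Module.End k V) q t w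
    refine this.trans (congrArg (fun p => crossed p _ w) (funext fun i => Units.ext ?_))
    exact (hΦ (FreeGroup.of i)).trans (by rw [FreeGroup.lift_apply_of])
  obtain ⟨q', hq'⟩ := h.exists_crossed_iff q
  let n : Φ.range := ∑ j ∈ Finset.range d, (q' x : Φ.range) ^ j
  let z : V := (n : Module.End k V) v₀
  obtain ⟨t, ht⟩ := (hq' n).mpr ⟨1, by simp [crossed_of_pow, n]⟩
  choose c hc using hscalar
  have hz : z = ∑ i, c (t i) • e i := by
    have : z = crossed Q (fun i => (t i : Module.End k V)) w v₀ := by rw [← hq, ht]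
    rw [this, crossed_eq_sum, LinearMap.sum_apply]
    exact Finset.sum_congr rfl fun i _ => by rw [Module.End.mul_apply, ← hc]
  have hez : ∀ i, ∃ b : k, e i = b • z := fun i => by
    obtain ⟨s, hs⟩ := (hq' _).mp ⟨Pi.single i 1, rfl⟩
    refine ⟨c (s x), ?_⟩
    have h1 : e i = (s x : Module.End k V) z := by
      have := congrArg (fun a : Φ.range => (a : Module.End k V) v₀) hs
      simp only [crossed_of_pow, hq] at this
      refine Eq.trans ?_ this.symm
      refine congrArg (fun p => crossed Q p w v₀) (funext fun j => ?_)
      rcases eq_or_ne j i with rfl | hji <;> simp [*]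
    rw [h1, hz, map_sum, Finset.smul_sum]
    exact Finset.sum_congr rfl fun j _ => by rw [map_smul, hc, smul_comm]
  choose b hb using hez
  obtain ⟨i, j, hij⟩ := exists_pair_ne α
  have hdep := hindep (Pi.single i (b j) - Pi.single j (b i)) (by
    simp only [Pi.sub_apply, sub_smul, Finset.sum_sub_distrib, Pi.single_apply, ite_smul, zero_smul,
      Finset.sum_ite_eq', Finset.mem_univ, if_true]
    rw [hb i, hb j, smul_smul, smul_smul, mul_comm, sub_self])
  have hbi : b j = 0 := by simpa [hij] using congrFun hdep i
  have hej : e j = 0 := by rw [hb, hbi, zero_smul]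
  have := congrFun (hindep (Pi.single j 1) (by simp [Pi.single_apply, hej])) j
  simp at this

end GroupAlgebra

section Integration

/-- If `w` induces the same measure as a power of a generator and the rank is at least two, there
is a nonconstant function on the free group which is invariant under left translation by `w` and
almost invariant under every left translation. -/
lemma SameMeasureOnFiniteGroups.exists_almostInvariant {α : Type} [Finite α] [Nontrivial α]
    {w : FreeGroup α} {x : α} {d : ℕ} (h : SameMeasureOnFiniteGroups w (FreeGroup.of x ^ d)) :
    ∃ f : FreeGroup α → ZMod 2, (∀ u, f (w * u) = f u) ∧
      (∀ g, {u | f (g * u) ≠ f u}.Finite) ∧ ∃ g u, f (g * u) ≠ f u := by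
  have := Fact.mk Nat.prime_two
  obtain ⟨a, ha, haw⟩ := h.exists_crossed_eq_zero (ZMod 2)
  have key : ∀ g u, (crossed (genUnits (ZMod 2)) a (g * u)).coeff 1 =
      (crossed (genUnits (ZMod 2)) a g).coeff u⁻¹ +
        (crossed (genUnits (ZMod 2)) a u).coeff 1 := fun g u => by
    rw [crossed_mul, lift_genUnits]
    simp [MonoidAlgebra.of_apply]
  refine ⟨fun u => (crossed (genUnits (ZMod 2)) a u).coeff 1, fun u => by simp [key, haw],
    fun g => ?_, ?_⟩
  · refine ((crossed (genUnits (ZMod 2)) a g).coeff.support.finite_toSet.preimage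
      (inv_injective.injOn)).subset fun u hu => ?_
    simpa [key] using hu
  · obtain ⟨i, hi⟩ := Function.ne_iff.mp ha
    obtain ⟨u, hu⟩ : ∃ u, (a i).coeff u ≠ 0 := by
      by_contra! h0
      exact hi (by ext u; simpa using h0 u)
    exact ⟨FreeGroup.of i, u⁻¹, by simpa [key] using hu⟩

end Integration

section Whitehead

variable {α : Type*}

/-- The inverse of a letter. -/
def invLetter (p : α × Bool) : α × Bool := (p.1, !p.2)

@[simp] lemma invLetter_invLetter (p : α × Bool) : invLetter (invLetter p) = p := by
  simp [invLetter]

lemma mk_invLetter (p : α × Bool) :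
    (FreeGroup.mk [invLetter p] : FreeGroup α) = (FreeGroup.mk [p])⁻¹ := by
  simp [invLetter, FreeGroup.inv_mk, FreeGroup.invRev]

lemma eq_or_eq_invLetter {p q : α × Bool} (h : p.1 = q.1) : p = q ∨ p = invLetter q := by
  obtain ⟨i, b⟩ := p
  obtain ⟨j, c⟩ := q
  obtain rfl : i = j := h
  cases b <;> cases c <;> simp [invLetter]

/-- The list of consecutive letters of the word `L` followed by the letter `y`. -/
def consecutive {β : Type*} : List β → β → List (β × β)
  | [], _ => []
  | x :: l, y => (x, l.headD y) :: consecutive l y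

lemma map_fst_consecutive {β : Type*} (l : List β) (y : β) :
    (consecutive l y).map Prod.fst = l := by
  induction l with
  | nil => rfl
  | cons x l ih => simp [consecutive, ih]

lemma map_snd_consecutive {β : Type*} (x : β) (l : List β) (y : β) :
    (consecutive (x :: l) y).map Prod.snd = l ++ [y] := by
  induction l generalizing x with
  | nil => rfl
  | cons x' l ih => simpa [consecutive] using ih x'

lemma sum_map_ite_eq_countP {β : Type*} (P : β → Prop) [DecidablePred P] (l : List β) :
    (l.map fun x => if P x then 1 else 0).sum = l.countP (fun x => P x) := by
  induction l with
  | nil => rfl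
  | cons x l ih => by_cases hx : P x <;> simp [hx, ih, add_comm]

lemma iff_of_consecutive {β : Type*} (P : β → Prop) (l : List β) (y : β)
    (h : ∀ e ∈ consecutive l y, P e.1 ↔ P e.2) : ∀ x ∈ l, P x ↔ P y := by
  induction l with
  | nil => simp
  | cons x l ih =>
    simp only [consecutive, List.mem_cons, forall_eq_or_imp] at h ⊢
    have := ih h.2
    refine ⟨h.1.trans ?_, this⟩
    cases l with
    | nil => rfl
    | cons x' l => exact this x' (by simp)

lemma mk_singleton (p : α × Bool) :
    (FreeGroup.mk [p] : FreeGroup α) = if p.2 then FreeGroup.of p.1 else (FreeGroup.of p.1)⁻¹ := by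
  obtain ⟨i, b⟩ := p
  cases b <;> rfl

variable [DecidableEq α]

/-- The endomorphism multiplying the generators on both sides by powers of the letter `a`, except
for the generator of that letter. -/
def whiteheadHom (a : α × Bool) (ε : α × Bool → ℤ) : FreeGroup α →* FreeGroup α :=
  FreeGroup.lift fun i => if i = a.1 then FreeGroup.of i else
    FreeGroup.mk [a] ^ (-ε (i, false)) * FreeGroup.of i * FreeGroup.mk [a] ^ ε (i, true)

lemma whiteheadHom_of_ne {a : α × Bool} (ε : α × Bool → ℤ) {i : α} (h : i ≠ a.1) :
    whiteheadHom a ε (FreeGroup.of i) =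
      FreeGroup.mk [a] ^ (-ε (i, false)) * FreeGroup.of i * FreeGroup.mk [a] ^ ε (i, true) := by
  simp [whiteheadHom, h]

lemma whiteheadHom_mk_of_eq {a : α × Bool} (ε : α × Bool → ℤ) {p : α × Bool} (h : p.1 = a.1) :
    whiteheadHom a ε (FreeGroup.mk [p]) = FreeGroup.mk [p] := by
  rw [mk_singleton, ← h.symm]
  split_ifs <;> simp [whiteheadHom]

lemma whiteheadHom_comp_neg (a : α × Bool) (ε : α × Bool → ℤ) :
    (whiteheadHom a ε).comp (whiteheadHom a (-ε)) = MonoidHom.id _ := by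
  refine FreeGroup.ext_hom _ _ fun i => ?_
  rcases eq_or_ne i a.1 with h | h
  · have : ∀ ε', whiteheadHom a ε' (FreeGroup.of i) = FreeGroup.of i := fun ε' => by
      simp [whiteheadHom, h]
    simp [this]
  · rw [MonoidHom.comp_apply, whiteheadHom_of_ne _ h, map_mul, map_mul, map_zpow, map_zpow,
      whiteheadHom_mk_of_eq _ rfl, whiteheadHom_of_ne _ h]
    simp [mul_assoc]

/-- The Whitehead automorphism attached to a letter and a function on the letters. -/
def whiteheadAut (a : α × Bool) (ε : α × Bool → ℤ) : MulAut (FreeGroup α) :=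
  MonoidHom.toMulEquiv (whiteheadHom a ε) (whiteheadHom a (-ε))
    (by simpa using whiteheadHom_comp_neg a (-ε)) (whiteheadHom_comp_neg a ε)

lemma whiteheadHom_mk {a : α × Bool} {ε : α × Bool → ℤ} (h : ε a = ε (invLetter a) + 1)
    (p : α × Bool) :
    whiteheadHom a ε (FreeGroup.mk [p]) = FreeGroup.mk [a] ^ (-ε (invLetter p)) *
      (if p.1 = a.1 then 1 else FreeGroup.mk [p]) * FreeGroup.mk [a] ^ ε p := by
  split_ifs with hp
  · rw [whiteheadHom_mk_of_eq _ hp, mul_one, ← zpow_add]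
    rcases eq_or_eq_invLetter hp with rfl | rfl
    · simp [h]
    · simp [h, mk_invLetter]
  · obtain ⟨i, b⟩ := p
    cases b
    · have : (FreeGroup.mk [(i, false)] : FreeGroup α) = (FreeGroup.of i)⁻¹ := rfl
      rw [this, map_inv, whiteheadHom_of_ne _ hp]
      simp [invLetter, mul_assoc]
    · exact whiteheadHom_of_ne _ hp

lemma norm_mk_zpow_le (a : α × Bool) (n : ℤ) :
    FreeGroup.norm (FreeGroup.mk [a] ^ n : FreeGroup α) ≤ n.natAbs := by
  have key : ∀ n : ℕ, FreeGroup.norm (FreeGroup.mk [a] ^ n : FreeGroup α) ≤ n := fun n => by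
    induction n with
    | zero => simp
    | succ n ih =>
      rw [pow_succ]
      exact (FreeGroup.norm_mul_le _ _).trans (Nat.add_le_add ih FreeGroup.norm_mk_le)
  obtain ⟨m, rfl | rfl⟩ := n.eq_nat_or_neg
  · simpa only [zpow_natCast, Int.natAbs_natCast] using key m
  · simpa only [zpow_neg, FreeGroup.norm_inv_eq, zpow_natCast, Int.natAbs_neg,
      Int.natAbs_natCast] using key m

/-- The contribution of two consecutive letters to the length of the image of a word under a
Whitehead automorphism. -/
def whiteheadCost (a : α × Bool) (ε : α × Bool → ℤ) (e : (α × Bool) × (α × Bool)) : ℕ :=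
  (if e.1.1 = a.1 then 0 else 1) + (ε e.1 - ε (invLetter e.2)).natAbs

lemma norm_whiteheadHom_le {a : α × Bool} {ε : α × Bool → ℤ} (h : ε a = ε (invLetter a) + 1)
    (L : List (α × Bool)) (y : α × Bool) :
    FreeGroup.norm (FreeGroup.mk [a] ^ ε (invLetter (L.headD y)) *
      whiteheadHom a ε (FreeGroup.mk L) * FreeGroup.mk [a] ^ (-ε (invLetter y))) ≤
      ((consecutive L y).map (whiteheadCost a ε)).sum := by
  induction L with
  | nil =>
    rw [← FreeGroup.one_eq_mk]
    simp
  | cons p L ih =>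
    have hm : FreeGroup.mk (p :: L) = FreeGroup.mk [p] * FreeGroup.mk L := by
      rw [FreeGroup.mul_mk]; rfl
    have e : FreeGroup.mk [a] ^ ε (invLetter ((p :: L).headD y)) *
        whiteheadHom a ε (FreeGroup.mk (p :: L)) * FreeGroup.mk [a] ^ (-ε (invLetter y)) =
        ((if p.1 = a.1 then 1 else FreeGroup.mk [p]) *
          FreeGroup.mk [a] ^ (ε p - ε (invLetter (L.headD y)))) *
        (FreeGroup.mk [a] ^ ε (invLetter (L.headD y)) *
          whiteheadHom a ε (FreeGroup.mk L) * FreeGroup.mk [a] ^ (-ε (invLetter y))) := by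
      rw [hm, map_mul, whiteheadHom_mk h, List.headD_cons, zpow_sub]
      simp only [mul_assoc, zpow_neg, mul_inv_cancel_left, inv_mul_cancel_left]
    rw [e]
    simp only [consecutive, List.map_cons, List.sum_cons]
    refine (FreeGroup.norm_mul_le _ _).trans (Nat.add_le_add ?_ ih)
    refine (FreeGroup.norm_mul_le _ _).trans (Nat.add_le_add ?_ (norm_mk_zpow_le _ _))
    split_ifs
    · simp
    · exact FreeGroup.norm_mk_le

/-- A word of minimal length in its orbit is not shortened by Whitehead automorphisms. -/
lemma length_le_whiteheadCost {w : FreeGroup α}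
    (hmin : ∀ θ : MulAut (FreeGroup α), w.norm ≤ (θ w).norm)
    {a : α × Bool} {ε : α × Bool → ℤ} (h : ε a = ε (invLetter a) + 1)
    {y : α × Bool} (hy : w.toWord.headD y = y) :
    w.toWord.length ≤ ((consecutive w.toWord y).map (whiteheadCost a ε)).sum := by
  have := norm_whiteheadHom_le h w.toWord y
  rw [hy, FreeGroup.mk_toWord, zpow_neg] at this
  exact (hmin (MulAut.conj (FreeGroup.mk [a] ^ ε (invLetter y)) * whiteheadAut a ε)).trans this

lemma countP_le_sum_natAbs {w : FreeGroup α}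
    (hmin : ∀ θ : MulAut (FreeGroup α), w.norm ≤ (θ w).norm)
    {a : α × Bool} {ε : α × Bool → ℤ} (h : ε a = ε (invLetter a) + 1)
    {y : α × Bool} (hy : w.toWord.headD y = y) :
    w.toWord.countP (fun p => p.1 = a.1) ≤
      ((consecutive w.toWord y).map fun e => (ε e.1 - ε (invLetter e.2)).natAbs).sum := by
  have h1 : _ ≤ ((consecutive w.toWord y).map fun e => (if e.1.1 = a.1 then 0 else 1) +
    (ε e.1 - ε (invLetter e.2)).natAbs).sum := length_le_whiteheadCost hmin h hy
  rw [List.sum_map_add] at h1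
  have h2 : ((consecutive w.toWord y).map fun e => if e.1.1 = a.1 then 0 else 1).sum =
      w.toWord.countP (fun p => ¬ p.1 = a.1) := by
    rw [← sum_map_ite_eq_countP]
    conv_rhs => rw [← map_fst_consecutive w.toWord y]
    rw [List.map_map]
    congr 2
    funext e
    by_cases he : e.1.1 = a.1 <;> simp [he]
  have h3 := List.length_eq_countP_add_countP (fun p : α × Bool => decide (p.1 = a.1))
    (l := w.toWord)
  simp only [decide_eq_true_eq] at h3
  omega

/-- If a set of letters containing `a` but not its inverse does not separate consecutive letters
of a word of minimal length, then the generator of `a` does not occur in the word. -/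
lemma fst_ne_of_consecutive {w : FreeGroup α}
    (hmin : ∀ θ : MulAut (FreeGroup α), w.norm ≤ (θ w).norm)
    {y : α × Bool} (hy : w.toWord.headD y = y) {Y : Set (α × Bool)} {a : α × Bool} (ha : a ∈ Y)
    (ha' : invLetter a ∉ Y)
    (hY : ∀ e ∈ consecutive w.toWord y, e.1 ∈ Y ↔ invLetter e.2 ∈ Y) :
    ∀ p ∈ w.toWord, p.1 ≠ a.1 := by
  classical
  have h := countP_le_sum_natAbs hmin (a := a) (ε := fun p => if p ∈ Y then 1 else 0)
    (by simp [ha, ha']) hy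
  rw [List.sum_eq_zero, Nat.le_zero, List.countP_eq_zero] at h
  · simpa using h
  · simp only [List.mem_map]
    rintro _ ⟨e, he, rfl⟩
    simp [hY e he]

/-- For a word of minimal length, if a set of letters only separates consecutive letters adjacent
to a letter `z`, then it does not separate any. -/
lemma iff_of_consecutive_of_ne {w : FreeGroup α}
    (hmin : ∀ θ : MulAut (FreeGroup α), w.norm ≤ (θ w).norm)
    {y : α × Bool} (hy : w.toWord.headD y = y) {C : Set (α × Bool)} {z : α × Bool} (hz : z ∉ C)
    (hz' : invLetter z ∉ C)
    (hC : ∀ e ∈ consecutive w.toWord y, e.1 ≠ z → invLetter e.2 ≠ z →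
      (e.1 ∈ C ↔ invLetter e.2 ∈ C)) :
    ∀ e ∈ consecutive w.toWord y, e.1 ∈ C ↔ invLetter e.2 ∈ C := by
  classical
  have hne : invLetter z ≠ z := by simp [invLetter, Prod.ext_iff]
  let ε : α × Bool → ℤ := fun p => if p ∈ insert z C then 1 else 0
  have h := countP_le_sum_natAbs hmin (a := z) (ε := ε) (by simp [ε, hz', hne]) hy
  have hcount : w.toWord.countP (fun p => p.1 = z.1) =
      ((consecutive w.toWord y).map fun e =>
        (if e.1 = z then 1 else 0) + if invLetter e.2 = z then 1 else 0).sum := by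
    have h1 : ((consecutive w.toWord y).map fun e => if e.1 = z then 1 else 0).sum =
        w.toWord.countP (fun p => p = z) := by
      rw [← sum_map_ite_eq_countP]
      conv_rhs => rw [← map_fst_consecutive w.toWord y]
      rw [List.map_map]
      rfl
    have h2 : ((consecutive w.toWord y).map fun e => if invLetter e.2 = z then 1 else 0).sum =
        w.toWord.countP (fun p => invLetter p = z) := by
      have hperm : ((consecutive w.toWord y).map Prod.snd).Perm w.toWord := by
        revert hy
        cases w.toWord with
        | nil => simp [consecutive]
        | cons x l =>
          rintro h
          obtain rfl : x = y := h
          rw [map_snd_consecutive]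
          exact List.perm_append_singleton _ _
      rw [← hperm.countP_eq, ← sum_map_ite_eq_countP, List.map_map]
      rfl
    rw [List.sum_map_add, h1, h2]
    generalize w.toWord = l
    induction l with
    | nil => rfl
    | cons p l ih =>
      simp only [List.countP_cons, ih]
      by_cases hp : p.1 = z.1
      · rcases eq_or_eq_invLetter hp with rfl | rfl
        · simp [hne, add_right_comm]
        · simp [hne, add_assoc, show (invLetter z).1 = z.1 from rfl]
      · have h1 : p ≠ z := fun h => hp (by rw [h])
        have h2 : invLetter p ≠ z := fun h => hp (by rw [← h]; rfl)
        simp [hp, h1, h2]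
  have key : ∀ u v, (u ≠ z → v ≠ z → (u ∈ C ↔ v ∈ C)) →
      (ε u - ε v).natAbs ≤ (if u = z then 1 else 0) + (if v = z then 1 else 0) ∧
      (¬ (u ∈ C ↔ v ∈ C) →
        (ε u - ε v).natAbs < (if u = z then 1 else 0) + (if v = z then 1 else 0)) := by
    intro u v huv
    clear hcount h hC
    by_cases h1 : u = z
    · by_cases h2 : v = z
      · simp [h1, h2, ε]
      · by_cases h4 : v ∈ C <;> simp [h1, h2, h4, hz, ε]
    · by_cases h2 : v = z
      · by_cases h3 : u ∈ C <;> simp [h1, h2, h3, hz, ε]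
      · simp [h1, h2, huv h1 h2, ε]
  rw [hcount] at h
  by_contra! hcon
  obtain ⟨e, he, hee⟩ := hcon
  exact absurd h (not_le.mpr (List.sum_lt_sum _ _ (fun e he => (key _ _ (hC e he)).1)
    ⟨e, he, (key _ _ (hC e he)).2 (by tauto)⟩))

/-- If a nontrivial set of letters does not separate consecutive letters of a word of minimal
length, then some generator does not occur in the word. -/
lemma exists_forall_fst_ne {w : FreeGroup α}
    (hmin : ∀ θ : MulAut (FreeGroup α), w.norm ≤ (θ w).norm)
    {y : α × Bool} (hy : w.toWord.headD y = y) {C : Set (α × Bool)} (hne : C.Nonempty)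
    (hne' : Cᶜ.Nonempty)
    (hC : ∀ e ∈ consecutive w.toWord y, e.1 ∈ C ↔ invLetter e.2 ∈ C) :
    ∃ j, ∀ p ∈ w.toWord, p.1 ≠ j := by
  by_cases hinv : ∀ a ∈ C, invLetter a ∈ C
  · have hinv' : ∀ a, invLetter a ∈ C ↔ a ∈ C :=
      fun a => ⟨fun h => by simpa using hinv _ h, hinv a⟩
    have hall := iff_of_consecutive (· ∈ C) w.toWord y fun e he => (hC e he).trans (hinv' e.2)
    by_cases hyC : y ∈ C
    · obtain ⟨c, hc⟩ := hne'
      refine ⟨c.1, fun p hp hpc => hc ?_⟩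
      rcases eq_or_eq_invLetter hpc.symm with rfl | rfl
      · exact (hall _ hp).mpr hyC
      · exact hinv _ ((hall _ hp).mpr hyC)
    · obtain ⟨c, hc⟩ := hne
      refine ⟨c.1, fun p hp hpc => hyC ((hall _ hp).mp ?_)⟩
      rcases eq_or_eq_invLetter hpc with rfl | rfl
      · exact hc
      · exact hinv _ hc
  · push Not at hinv
    obtain ⟨a, ha, ha'⟩ := hinv
    exact ⟨a.1, fst_ne_of_consecutive hmin hy ha ha' hC⟩

end Whitehead

section Cones

variable {α κ : Type*}

lemma mk_cons (p : α × Bool) (L : List (α × Bool)) :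
    (FreeGroup.mk (p :: L) : FreeGroup α) = FreeGroup.mk [p] * FreeGroup.mk L := by
  rw [FreeGroup.mul_mk]; rfl

lemma isReduced_cons_iff {b : α × Bool} {H : List (α × Bool)} (hH : FreeGroup.IsReduced H) :
    FreeGroup.IsReduced (b :: H) ↔ ∀ h ∈ H.head?, b ≠ invLetter h := by
  cases H with
  | nil => simp
  | cons h H =>
    rw [FreeGroup.isReduced_cons_cons]
    obtain ⟨i, s⟩ := b
    obtain ⟨j, t⟩ := h
    cases s <;> cases t <;> simp [invLetter, hH]

variable [DecidableEq α]

/-- The elements of the free group whose reduced word ends with `H`. -/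
def cone (H : List (α × Bool)) : Set (FreeGroup α) := {g | H <:+ g.toWord}

lemma mem_cone_iff {H : List (α × Bool)} {g : FreeGroup α} :
    g ∈ cone H ↔ ∃ l, FreeGroup.IsReduced (l ++ H) ∧ g = FreeGroup.mk (l ++ H) := by
  constructor
  · rintro ⟨l, hl⟩
    exact ⟨l, hl ▸ FreeGroup.isReduced_toWord, by rw [hl, FreeGroup.mk_toWord]⟩
  · rintro ⟨l, hl, rfl⟩
    exact ⟨l, by rw [FreeGroup.toWord_mk, hl.reduce_eq]⟩

/-- An almost invariant function is constant on deep enough cones. -/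
lemma exists_forall_mem_cone_eq [Finite α] {f : FreeGroup α → κ}
    (hf : ∀ g, {u | f (g * u) ≠ f u}.Finite) :
    ∃ N, ∀ H : List (α × Bool), N ≤ H.length → ∀ g ∈ cone H, f g = f (FreeGroup.mk H) := by
  have hE : (⋃ p : α × Bool, {u | f (FreeGroup.mk [p] * u) ≠ f u}).Finite :=
    Set.finite_iUnion fun p => hf _
  obtain ⟨N, hN⟩ := (hE.image FreeGroup.norm).bddAbove
  refine ⟨N + 1, fun H hH g hg => ?_⟩
  obtain ⟨l, hl, rfl⟩ := mem_cone_iff.mp hg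
  clear hg
  induction l with
  | nil => rfl
  | cons p l ih =>
    have hl' : FreeGroup.IsReduced (l ++ H) := List.IsChain.right_of_append (l₁ := [p]) hl
    rw [← ih hl', List.cons_append, mk_cons]
    by_contra hne
    have := hN (Set.mem_image_of_mem _ (Set.mem_iUnion.mpr ⟨p, hne⟩))
    rw [FreeGroup.norm, FreeGroup.toWord_mk, hl'.reduce_eq, List.length_append] at this
    omega

lemma cone_subset (H : List (α × Bool)) :
    cone H ⊆ {FreeGroup.mk H} ∪
      ⋃ b : α × Bool, {g | FreeGroup.IsReduced (b :: H) ∧ g ∈ cone (b :: H)} := by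
  intro g hg
  obtain ⟨l, hl, rfl⟩ := mem_cone_iff.mp hg
  rcases List.eq_nil_or_concat l with rfl | ⟨l, b, rfl⟩
  · exact Or.inl rfl
  · simp only [List.concat_eq_append, List.append_assoc, List.singleton_append] at hl ⊢
    exact Or.inr (Set.mem_iUnion.mpr
      ⟨b, List.IsChain.right_of_append hl, mem_cone_iff.mpr ⟨l, hl, rfl⟩⟩)

/-- An almost invariant function which is not almost constant separates the cones at some vertex. -/
lemma exists_separating_cone [Finite α] {f : FreeGroup α → κ}
    (hf : ∀ g, {u | f (g * u) ≠ f u}.Finite) (hc : ∀ c, ¬ {g | f g ≠ c}.Finite) :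
    ∃ (H : List (α × Bool)) (val : α × Bool → κ), FreeGroup.IsReduced H ∧
      (∀ b, FreeGroup.IsReduced (b :: H) → {g | g ∈ cone (b :: H) ∧ f g ≠ val b}.Finite) ∧
      ∃ b₁ b₂, FreeGroup.IsReduced (b₁ :: H) ∧ FreeGroup.IsReduced (b₂ :: H) ∧
        val b₁ ≠ val b₂ := by
  obtain ⟨H, hH, hbad, hgood⟩ : ∃ H : List (α × Bool), FreeGroup.IsReduced H ∧
      (∀ c, ¬ {g | g ∈ cone H ∧ f g ≠ c}.Finite) ∧
      ∀ b, FreeGroup.IsReduced (b :: H) → ∃ c, {g | g ∈ cone (b :: H) ∧ f g ≠ c}.Finite := by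
    by_contra! hcon
    have key : ∀ n, ∃ H : List (α × Bool), H.length = n ∧ FreeGroup.IsReduced H ∧
        ∀ c, ¬ {g | g ∈ cone H ∧ f g ≠ c}.Finite := fun n => by
      induction n with
      | zero => exact ⟨[], rfl, FreeGroup.IsReduced.nil, by simpa [cone] using hc⟩
      | succ n ih =>
        obtain ⟨H, rfl, hH, hbad⟩ := ih
        obtain ⟨b, hb, hb'⟩ := hcon H hH hbad
        exact ⟨b :: H, rfl, hb, hb'⟩
    obtain ⟨N, hN⟩ := exists_forall_mem_cone_eq hf
    obtain ⟨H, rfl, -, hbad⟩ := key N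
    refine hbad (f (FreeGroup.mk H)) ?_
    exact Set.finite_empty.subset fun g hg => hg.2 (hN H le_rfl g hg.1)
  have : Nonempty κ := ⟨f 1⟩
  choose! val hval using hgood
  refine ⟨H, val, hH, hval, ?_⟩
  by_contra! hcon
  obtain ⟨c, hc⟩ : ∃ c, ∀ b, FreeGroup.IsReduced (b :: H) → val b = c := by
    by_cases hb : ∃ b, FreeGroup.IsReduced (b :: H)
    · obtain ⟨b, hb⟩ := hb
      exact ⟨val b, fun b' hb' => hcon b' b hb' hb⟩
    · exact ⟨f 1, fun b hb' => absurd ⟨b, hb'⟩ hb⟩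
  refine hbad c (Set.Finite.subset ((Set.finite_singleton (FreeGroup.mk H)).union
    (Set.finite_iUnion fun b : α × Bool =>
      (?_ : {g | FreeGroup.IsReduced (b :: H) ∧ g ∈ cone (b :: H) ∧ f g ≠ c}.Finite))) ?_)
  · by_cases hb : FreeGroup.IsReduced (b :: H)
    · simpa [hb, hc b hb] using hval b hb
    · simp [hb]
  · rintro g ⟨hg, hgc⟩
    rcases cone_subset H hg with h | h
    · exact Or.inl h
    · obtain ⟨b, hb⟩ := Set.mem_iUnion.mp h
      exact Or.inr (Set.mem_iUnion.mpr ⟨b, hb.1, hb.2, hgc⟩)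

lemma eq_val_of_isCyclicallyReduced {f : FreeGroup α → κ} {K₁ K₂ H : List (α × Bool)}
    {p : α × Bool} (hK : FreeGroup.IsCyclicallyReduced (K₁ ++ p :: K₂))
    (hinv : ∀ u, f (FreeGroup.mk (K₁ ++ p :: K₂) * u) = f u)
    (hp : FreeGroup.IsReduced (p :: H)) {c : κ}
    (hc : {g | g ∈ cone (p :: H) ∧ f g ≠ c}.Finite) :
    f (FreeGroup.mk (K₁ ++ [p]) * FreeGroup.mk H) = c := by
  set K := K₁ ++ p :: K₂ with hKdef
  by_contra hne
  have hK1 : (FreeGroup.mk K : FreeGroup α) ≠ 1 := fun h => by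
    have := congrArg FreeGroup.toWord h
    rw [FreeGroup.toWord_mk, hK.isReduced.reduce_eq] at this
    simp [hKdef] at this
  have hinv' : ∀ (m : ℕ) u, f (FreeGroup.mk K ^ m * u) = f u := fun m => by
    induction m with
    | zero => simp
    | succ m ih => intro u; rw [pow_succ, mul_assoc, ih, hinv]
  have hinj : Function.Injective fun m : ℕ =>
      FreeGroup.mk K ^ m * (FreeGroup.mk (K₁ ++ [p]) * FreeGroup.mk H) := fun m n hmn =>
    (injective_pow_iff_not_isOfFinOrder.mpr (not_isOfFinOrder_of_isMulTorsionFree hK1))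
      (mul_right_cancel hmn)
  refine Set.not_infinite.mpr hc
    (Set.infinite_of_injective_forall_mem hinj fun m => ⟨?_, by rwa [hinv']⟩)
  refine mem_cone_iff.mpr ⟨(List.replicate m K).flatten ++ K₁, ?_, ?_⟩
  · have h1 : FreeGroup.IsReduced ((List.replicate m K).flatten ++ K₁ ++ [p]) :=
      List.IsChain.left_of_append (l₂ := K₂) (by
        simpa [List.replicate_succ', hKdef, FreeGroup.IsReduced] using (hK.flatten_replicate (m + 1)).isReduced)
    simpa using h1.append_overlap (L₃ := H) (by simpa using hp) (by simp)
  · simp [FreeGroup.pow_mk, FreeGroup.mul_mk]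

/-- A word of minimal length in its orbit is cyclically reduced. -/
lemma isCyclicallyReduced_toWord {w : FreeGroup α}
    (hmin : ∀ θ : MulAut (FreeGroup α), w.norm ≤ (θ w).norm) :
    FreeGroup.IsCyclicallyReduced w.toWord := by
  have hconj := FreeGroup.reduceCyclically.conj_conjugator_reduceCyclically w.toWord
  have hcyc := FreeGroup.reduceCyclically.isCyclicallyReduced (FreeGroup.isReduced_toWord (x := w))
  set C := FreeGroup.reduceCyclically.conjugator w.toWord
  set R := FreeGroup.reduceCyclically w.toWord
  have hw : MulAut.conj (FreeGroup.mk C)⁻¹ w = FreeGroup.mk R := by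
    conv_lhs => rw [← FreeGroup.mk_toWord (x := w), ← hconj]
    rw [← FreeGroup.mul_mk, ← FreeGroup.mul_mk, ← FreeGroup.inv_mk]
    simp only [MulAut.conj_apply]
    group
  have h1 := (hmin (MulAut.conj (FreeGroup.mk C)⁻¹)).trans (hw ▸ FreeGroup.norm_mk_le)
  have h2 := congrArg List.length hconj
  have h3 : C = [] := by
    rw [← List.length_eq_zero_iff]
    simp only [FreeGroup.norm, List.length_append, FreeGroup.invRev_length] at h1 h2
    omega
  rw [h3] at hconj
  rw [← hconj]
  simpa using hcyc

lemma apply_mul_mk_eq_val {f : FreeGroup α → κ} {w : FreeGroup α}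
    (hmin : ∀ θ : MulAut (FreeGroup α), w.norm ≤ (θ w).norm) (hinv : ∀ u, f (w * u) = f u)
    {H : List (α × Bool)} {val : α × Bool → κ}
    (hval : ∀ b, FreeGroup.IsReduced (b :: H) → {g | g ∈ cone (b :: H) ∧ f g ≠ val b}.Finite)
    {L₁ L₂ : List (α × Bool)} {p : α × Bool} (hL : L₁ ++ p :: L₂ = w.toWord) :
    (FreeGroup.IsReduced (p :: H) → f (FreeGroup.mk (L₁ ++ [p]) * FreeGroup.mk H) = val p) ∧
    (FreeGroup.IsReduced (invLetter p :: H) →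
      f (FreeGroup.mk L₁ * FreeGroup.mk H) = val (invLetter p)) := by
  have hw : FreeGroup.mk (L₁ ++ p :: L₂) = w := by rw [hL, FreeGroup.mk_toWord]
  refine ⟨fun hp => ?_, fun hp => ?_⟩
  · exact eq_val_of_isCyclicallyReduced (hL ▸ isCyclicallyReduced_toWord hmin)
      (by rwa [hw]) hp (hval p hp)
  · have hinv' : ∀ u, f (w⁻¹ * u) = f u := fun u => by
      rw [← hinv (w⁻¹ * u), mul_inv_cancel_left]
    have hL' : FreeGroup.invRev L₂ ++ invLetter p :: FreeGroup.invRev L₁ = w⁻¹.toWord := by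
      rw [FreeGroup.toWord_inv, ← hL]
      simp [FreeGroup.invRev, invLetter]
    have hw' : FreeGroup.mk (FreeGroup.invRev L₂ ++ invLetter p :: FreeGroup.invRev L₁) = w⁻¹ := by
      rw [hL', FreeGroup.mk_toWord]
    have hcyc := isCyclicallyReduced_toWord (w := w⁻¹) (by simpa using hmin)
    rw [← eq_val_of_isCyclicallyReduced (hL' ▸ hcyc) (by rwa [hw']) hp (hval _ hp), ← hinv',
      ← hw', ← mul_assoc, List.append_cons, ← FreeGroup.mul_mk, ← FreeGroup.inv_mk (L := L₁),
      inv_mul_cancel_right]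

lemma val_eq_val_of_consecutive {f : FreeGroup α → κ} {w : FreeGroup α}
    (hmin : ∀ θ : MulAut (FreeGroup α), w.norm ≤ (θ w).norm) (hinv : ∀ u, f (w * u) = f u)
    {H : List (α × Bool)} {val : α × Bool → κ}
    (hval : ∀ b, FreeGroup.IsReduced (b :: H) → {g | g ∈ cone (b :: H) ∧ f g ≠ val b}.Finite)
    {y : α × Bool} (hy : w.toWord.headD y = y) {L₁ L₂ : List (α × Bool)}
    (hL : L₁ ++ L₂ = w.toWord) :
    ∀ e ∈ consecutive L₂ y, FreeGroup.IsReduced (e.1 :: H) →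
      FreeGroup.IsReduced (invLetter e.2 :: H) → val e.1 = val (invLetter e.2) := by
  induction L₂ generalizing L₁ with
  | nil => simp [consecutive]
  | cons x l ih =>
    simp only [consecutive, List.mem_cons, forall_eq_or_imp]
    refine ⟨fun h1 h2 => ?_, ih (L₁ := L₁ ++ [x]) (by simpa using hL)⟩
    rw [← (apply_mul_mk_eq_val hmin hinv hval hL).1 h1]
    cases l with
    | nil =>
      rw [hL, FreeGroup.mk_toWord, hinv, List.headD_nil]
      rw [List.headD_nil] at h2
      obtain ⟨L', hL'⟩ : ∃ L', [] ++ y :: L' = w.toWord := by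
        revert hy
        rw [← hL]
        cases L₁ with
        | nil => simpa using Eq.symm
        | cons z L₁ => simpa using Eq.symm
      rw [← (apply_mul_mk_eq_val hmin hinv hval hL').2 h2, ← FreeGroup.one_eq_mk, one_mul]
    | cons q l =>
      exact (apply_mul_mk_eq_val hmin hinv hval
        (L₁ := L₁ ++ [x]) (L₂ := l) (by simpa using hL)).2 h2

lemma exists_forall_fst_ne_of_almostInvariant [Finite α] {f : FreeGroup α → κ} {w : FreeGroup α}
    (hw : w ≠ 1) (hmin : ∀ θ : MulAut (FreeGroup α), w.norm ≤ (θ w).norm)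
    (hinv : ∀ u, f (w * u) = f u) (hf : ∀ g, {u | f (g * u) ≠ f u}.Finite)
    (hne : ∃ g u, f (g * u) ≠ f u) : ∃ j, ∀ p ∈ w.toWord, p.1 ≠ j := by
  have hc : ∀ c, ¬ {g | f g ≠ c}.Finite := fun c hfin => by
    have hinv' : ∀ (m : ℕ) u, f (w ^ m * u) = f u := fun m => by
      induction m with
      | zero => simp
      | succ m ih => intro u; rw [pow_succ, mul_assoc, ih, hinv]
    have hconst : ∀ u, f u = c := fun u => by
      by_contra hu
      have hinj : Function.Injective fun m : ℕ => w ^ m * u := fun m n hmn =>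
        (injective_pow_iff_not_isOfFinOrder.mpr (not_isOfFinOrder_of_isMulTorsionFree hw))
          (mul_right_cancel hmn)
      exact Set.not_infinite.mpr hfin
        (Set.infinite_of_injective_forall_mem hinj fun m => by simpa [hinv'] using hu)
    obtain ⟨g, u, hgu⟩ := hne
    exact hgu (by rw [hconst, hconst])
  obtain ⟨y, L, hL⟩ := List.exists_cons_of_ne_nil (FreeGroup.toWord_eq_nil_iff.not.mpr hw)
  have hy : w.toWord.headD y = y := by rw [hL]; rfl
  obtain ⟨H, val, hH, hval, b₁, b₂, h₁, h₂, h12⟩ := exists_separating_cone hf hc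
  have hvv := val_eq_val_of_consecutive hmin hinv hval hy (L₁ := []) rfl
  simp only [isReduced_cons_iff hH] at hvv h₁ h₂
  cases H with
  | nil =>
    refine exists_forall_fst_ne hmin hy (C := {b | val b = val b₁}) ⟨b₁, rfl⟩ ⟨b₂, h12.symm⟩
      fun e he => ?_
    simp [hvv e he (by simp) (by simp)]
  | cons h H =>
    simp only [List.head?_cons, Option.mem_def, Option.some.injEq, forall_eq'] at hvv h₁ h₂
    obtain ⟨C, hCne, hCz, hCh, hC⟩ : ∃ C : Set (α × Bool), C.Nonempty ∧ invLetter h ∉ C ∧ h ∉ C ∧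
        ∀ p q, p ≠ invLetter h → q ≠ invLetter h → val p = val q → (p ∈ C ↔ q ∈ C) := by
      by_cases hh : val h = val b₁
      · exact ⟨{b | b ≠ invLetter h ∧ val b ≠ val b₁}, ⟨b₂, h₂, h12.symm⟩, by simp,
          by simp [hh], fun p q hp hq hpq => by simp [hp, hq, hpq]⟩
      · exact ⟨{b | b ≠ invLetter h ∧ val b = val b₁}, ⟨b₁, h₁, rfl⟩, by simp,
          by simp [hh], fun p q hp hq hpq => by simp [hp, hq, hpq]⟩
    refine exists_forall_fst_ne hmin hy hCne ⟨_, hCz⟩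
      (iff_of_consecutive_of_ne hmin hy hCz (by simpa using hCh) fun e he h1 h2 =>
        hC _ _ h1 h2 (hvv e he h1 h2))

/-- If the left translation by `w` preserves a nonconstant almost invariant function, then `w` lies
in a proper free factor. -/
lemma exists_mulAut_forall_fst_ne [Finite α] {f : FreeGroup α → κ} {w : FreeGroup α}
    (hw : w ≠ 1) (hinv : ∀ u, f (w * u) = f u) (hf : ∀ g, {u | f (g * u) ≠ f u}.Finite)
    (hne : ∃ g u, f (g * u) ≠ f u) :
    ∃ (θ : MulAut (FreeGroup α)) (j : α), ∀ p ∈ (θ w).toWord, p.1 ≠ j := by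
  let θ := Function.argmin fun θ : MulAut (FreeGroup α) => (θ w).norm
  have hθ : ∀ θ' : MulAut (FreeGroup α), (θ w).norm ≤ (θ' w).norm :=
    fun θ' => Function.argmin_le (fun θ : MulAut (FreeGroup α) => (θ w).norm) θ'
  refine ⟨θ, exists_forall_fst_ne_of_almostInvariant (f := f ∘ θ.symm) (by simpa using hw)
    (fun θ' => hθ (θ' * θ)) (fun u => by simp [hinv]) (fun g => ?_) ?_⟩
  · refine ((hf (θ.symm g)).image θ).subset fun u hu => ⟨θ.symm u, by simpa using hu, by simp⟩
  · obtain ⟨g, u, hgu⟩ := hne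
    exact ⟨θ g, θ u, by simpa using hgu⟩

end Cones

section Induction

variable {α : Type} {G : Type} [Group G]

instance [Finite α] [Finite G] : Finite (FreeGroup α →* G) :=
  Finite.of_equiv _ FreeGroup.lift

lemma SameMeasureOnFiniteGroups.symm {Γ : Type} [Group Γ] {w v : Γ}
    (h : SameMeasureOnFiniteGroups w v) : SameMeasureOnFiniteGroups v w :=
  fun G _ _ g => (h G g).symm

lemma SameMeasureOnFiniteGroups.mulAut_apply {Γ : Type} [Group Γ] {w v : Γ}
    (h : SameMeasureOnFiniteGroups w v) (θ : MulAut Γ) : SameMeasureOnFiniteGroups (θ w) v := by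
  intro G _ _ g
  rw [← h G g]
  exact Nat.card_congr
    { toFun φ := ⟨φ.1.comp θ.toMonoidHom, φ.2⟩
      invFun φ := ⟨φ.1.comp θ.symm.toMonoidHom, by simpa using φ.2⟩
      left_inv φ := by ext; simp
      right_inv φ := by ext; simp }

lemma SameMeasureOnFiniteGroups.exists_apply_eq [Finite α] [Finite G] {w v : FreeGroup α}
    (h : SameMeasureOnFiniteGroups w v) (φ : FreeGroup α →* G) :
    ∃ ψ : FreeGroup α →* G, ψ w = φ v := by
  have : Nonempty {ψ : FreeGroup α →* G // ψ v = φ v} := ⟨φ, rfl⟩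
  have hpos := Nat.card_pos (α := {ψ : FreeGroup α →* G // ψ v = φ v})
  rw [← h G] at hpos
  obtain ⟨ψ, hψ⟩ := (Nat.card_pos_iff.mp hpos).1
  exact ⟨ψ, hψ⟩

lemma SameMeasureOnFiniteGroups.ne_one [Finite α] {w : FreeGroup α} {x : α} {d : ℕ} (hd : d ≠ 0)
    (h : SameMeasureOnFiniteGroups w (FreeGroup.of x ^ d)) : w ≠ 1 := by
  rintro rfl
  obtain ⟨ψ, hψ⟩ := h.exists_apply_eq
    (FreeGroup.lift fun _ => Multiplicative.ofAdd (1 : ZMod (d + 1)))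
  have h0 : (d : ZMod (d + 1)) = 0 := by
    simpa [eq_comm] using congrArg Multiplicative.toAdd hψ
  rw [ZMod.natCast_eq_zero_iff] at h0
  exact absurd (Nat.le_of_dvd (Nat.pos_of_ne_zero hd) h0) (by omega)

lemma exists_zpow_eq_of_subsingleton [Subsingleton α] (x : α) (w : FreeGroup α) :
    ∃ m : ℤ, FreeGroup.of x ^ m = w := by
  have := FreeGroup.closure_range_of α
  have hx : Set.range (FreeGroup.of : α → FreeGroup α) = {FreeGroup.of x} := by
    ext g
    simpa [Subsingleton.elim _ x, eq_comm] using fun _ => ⟨x⟩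
  rw [hx, ← Subgroup.zpowers_eq_closure] at this
  exact Subgroup.mem_zpowers_iff.mp (this ▸ Subgroup.mem_top w)

lemma SameMeasureOnFiniteGroups.exists_mulAut_of_subsingleton [Subsingleton α]
    {w : FreeGroup α} {x : α} {d : ℕ} (hd : d ≠ 0)
    (h : SameMeasureOnFiniteGroups w (FreeGroup.of x ^ d)) :
    ∃ θ : MulAut (FreeGroup α), θ (FreeGroup.of x ^ d) = w := by
  obtain ⟨m, rfl⟩ := exists_zpow_eq_of_subsingleton x w
  have hm : m ≠ 0 := by
    rintro rfl
    exact h.ne_one hd (zpow_zero _)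
  have hdm : (d : ℤ) ∣ m := by
    have := NeZero.mk hd
    obtain ⟨ψ, hψ⟩ := h.symm.exists_apply_eq
      (FreeGroup.lift fun _ => Multiplicative.ofAdd (1 : ZMod d))
    rw [map_pow] at hψ
    generalize ψ (FreeGroup.of x) = t at hψ
    have h0 : (m : ZMod d) = 0 := by
      simpa [eq_comm] using congrArg Multiplicative.toAdd hψ
    rwa [ZMod.intCast_zmod_eq_zero_iff_dvd] at h0
  have hmd : m ∣ d := by
    have := NeZero.mk (Int.natAbs_ne_zero.mpr hm)
    obtain ⟨ψ, hψ⟩ := h.exists_apply_eq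
      (FreeGroup.lift fun _ => Multiplicative.ofAdd (1 : ZMod m.natAbs))
    rw [map_zpow] at hψ
    generalize ψ (FreeGroup.of x) = t at hψ
    have hm0 : (m : ZMod m.natAbs) = 0 := by
      rw [ZMod.intCast_zmod_eq_zero_iff_dvd]; simp
    have h0 : (d : ZMod m.natAbs) = 0 := by
      simpa [hm0, eq_comm] using congrArg Multiplicative.toAdd hψ
    rw [ZMod.natCast_eq_zero_iff] at h0
    exact Int.natAbs_dvd.mp (Int.natCast_dvd_natCast.mpr h0)
  have key := Int.natAbs_eq_of_dvd_dvd hdm hmd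
  rcases m.eq_nat_or_neg with ⟨k, rfl | rfl⟩
  · obtain rfl : d = k := by simpa using key
    exact ⟨1, by simp⟩
  · obtain rfl : d = k := by simpa using key
    have hinv : (FreeGroup.lift fun i : α => (FreeGroup.of i)⁻¹).comp
        (FreeGroup.lift fun i : α => (FreeGroup.of i)⁻¹) = MonoidHom.id (FreeGroup α) :=
      FreeGroup.ext_hom _ _ fun i => by simp
    exact ⟨MonoidHom.toMulEquiv _ _ hinv hinv, by simp⟩

/-- The inclusion of the free factor generated by all generators but `j`. -/
def inclNe (j : α) : FreeGroup {i // i ≠ j} →* FreeGroup α := FreeGroup.map Subtype.val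

lemma exists_inclNe_eq [DecidableEq α] {j : α} {w : FreeGroup α} (hw : ∀ p ∈ w.toWord, p.1 ≠ j) :
    ∃ v, inclNe j v = w := by
  rw [← FreeGroup.mk_toWord (x := w)]
  generalize w.toWord = L at hw
  induction L with
  | nil => exact ⟨1, by simp [← FreeGroup.one_eq_mk]⟩
  | cons p L ih =>
    simp only [List.mem_cons, forall_eq_or_imp] at hw
    obtain ⟨v, hv⟩ := ih hw.2
    refine ⟨FreeGroup.mk [(⟨p.1, hw.1⟩, p.2)] * v, ?_⟩
    rw [map_mul, hv, mk_cons p]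
    rfl

/-- A homomorphism from a free group amounts to one from a free factor of corank one together with
the image of the remaining generator. -/
def homEquivProd [DecidableEq α] (j : α) :
    (FreeGroup α →* G) ≃ (FreeGroup {i // i ≠ j} →* G) × G where
  toFun φ := (φ.comp (inclNe j), φ (FreeGroup.of j))
  invFun p := FreeGroup.lift fun i => if h : i ≠ j then p.1 (FreeGroup.of ⟨i, h⟩) else p.2
  left_inv φ := FreeGroup.ext_hom _ _ fun i => by
    by_cases h : i = j <;> simp [inclNe, h]
  right_inv p := by
    refine Prod.ext (FreeGroup.ext_hom _ _ fun i => ?_) ?_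
    · simp [inclNe, i.2]
    · simp

lemma card_apply_inclNe_eq (j : α) (w : FreeGroup {i // i ≠ j}) (g : G) :
    Nat.card {φ : FreeGroup α →* G // φ (inclNe j w) = g} =
      Nat.card {φ : FreeGroup {i // i ≠ j} →* G // φ w = g} * Nat.card G := by
  classical
  rw [← Nat.card_prod]
  refine Nat.card_congr (((homEquivProd j).subtypeEquiv
    (q := fun p => p.1 w = g) fun φ => Iff.rfl).trans
    { toFun p := (⟨p.1.1, p.2⟩, p.1.2)
      invFun p := ⟨(p.1.1, p.2), p.1.2⟩
      left_inv _ := rfl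
      right_inv _ := rfl })

lemma SameMeasureOnFiniteGroups.of_inclNe {j : α} {w v : FreeGroup {i // i ≠ j}}
    (h : SameMeasureOnFiniteGroups (inclNe j w) (inclNe j v)) : SameMeasureOnFiniteGroups w v := by
  intro G _ _ g
  have := h G g
  rw [card_apply_inclNe_eq, card_apply_inclNe_eq] at this
  exact Nat.eq_of_mul_eq_mul_right Nat.card_pos this

lemma exists_mulAut_inclNe (j : α) (θ : MulAut (FreeGroup {i // i ≠ j})) :
    ∃ θ' : MulAut (FreeGroup α), ∀ v, θ' (inclNe j v) = inclNe j (θ v) := by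
  classical
  let E (θ : MulAut (FreeGroup {i // i ≠ j})) : FreeGroup α →* FreeGroup α :=
    (homEquivProd j).symm ((inclNe j).comp θ.toMonoidHom, FreeGroup.of j)
  have h1 : ∀ θ v, E θ (inclNe j v) = inclNe j (θ v) := fun θ v =>
    DFunLike.congr_fun (congrArg Prod.fst ((homEquivProd j).apply_symm_apply
      ((inclNe j).comp θ.toMonoidHom, FreeGroup.of j))) v
  have h2 : ∀ θ, E θ (FreeGroup.of j) = FreeGroup.of j := fun θ =>
    congrArg Prod.snd ((homEquivProd j).apply_symm_apply
      ((inclNe j).comp θ.toMonoidHom, FreeGroup.of j))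
  have h3 : ∀ θ θ', θ * θ' = 1 → (E θ).comp (E θ') = MonoidHom.id _ := fun θ θ' h =>
    (homEquivProd j).injective <| Prod.ext
      (MonoidHom.ext fun v => by
        simp [homEquivProd, h1, ← MulAut.mul_apply, h])
      (by simp [homEquivProd, h2])
  exact ⟨MonoidHom.toMulEquiv (E θ) (E θ⁻¹) (h3 _ _ (by simp)) (h3 _ _ (by simp)), h1 θ⟩

lemma SameMeasureOnFiniteGroups.exists_inclNe_eq_mulAut [Finite α] {w : FreeGroup α} {x y : α}
    (hxy : x ≠ y) {d : ℕ} (hd : d ≠ 0) (h : SameMeasureOnFiniteGroups w (FreeGroup.of x ^ d)) :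
    ∃ (θ : MulAut (FreeGroup α)) (v : _), inclNe y v = θ w := by
  classical
  have := nontrivial_of_ne x y hxy
  obtain ⟨f, hinv, hf, hne⟩ := h.exists_almostInvariant
  obtain ⟨θ, j, hj⟩ := exists_mulAut_forall_fst_ne (h.ne_one hd) hinv hf hne
  obtain ⟨v, hv⟩ := exists_inclNe_eq hj
  have hswap : ∀ i : {i // i ≠ j}, Equiv.swap j y i ≠ y := fun i hi => by
    rw [Equiv.swap_apply_eq_iff, Equiv.swap_apply_right] at hi
    exact i.2 hi
  let σ : MulAut (FreeGroup α) := FreeGroup.freeGroupCongr (Equiv.swap j y)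
  refine ⟨σ * θ, FreeGroup.map (fun i => ⟨_, hswap i⟩) v, ?_⟩
  rw [MulAut.mul_apply, ← hv]
  simp only [σ, inclNe, FreeGroup.freeGroupCongr_apply, FreeGroup.map.comp]
  rfl

lemma SameMeasureOnFiniteGroups.exists_mulAut {d : ℕ} (hd : d ≠ 0) [Finite α] {w : FreeGroup α}
    {x : α} (h : SameMeasureOnFiniteGroups w (FreeGroup.of x ^ d)) :
    ∃ θ : MulAut (FreeGroup α), θ (FreeGroup.of x ^ d) = w := by
  classical
  induction hn : Nat.card α generalizing α with
  | zero => exact absurd hn (Nat.card_ne_zero.mpr ⟨⟨x⟩, ‹_›⟩)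
  | succ n ih =>
    rcases subsingleton_or_nontrivial α with hα | hα
    · exact h.exists_mulAut_of_subsingleton hd
    obtain ⟨y, hy⟩ := exists_ne x
    obtain ⟨θ, v, hv⟩ := h.exists_inclNe_eq_mulAut hy.symm hd
    have hx : inclNe y (FreeGroup.of ⟨x, hy.symm⟩ ^ d) = FreeGroup.of x ^ d := by simp [inclNe]
    have h' := h.mulAut_apply θ
    rw [← hv, ← hx] at h'
    obtain ⟨θ₁, h₁⟩ := ih h'.of_inclNe (by
      have := Nat.card_congr (Equiv.optionSubtypeNe y)
      rw [Finite.card_option] at this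
      omega)
    obtain ⟨θ₂, h₂⟩ := exists_mulAut_inclNe y θ₁
    exact ⟨θ⁻¹ * θ₂, by rw [MulAut.mul_apply, ← hx, h₂, h₁, hv, MulAut.inv_apply_self]⟩

end Induction

/-- If a word `w` in the free group `F_r` (`r ≥ 1`) induces the same measure as
`x₁ ^ d` (`d ≥ 1`) on every finite group, then some automorphism of `F_r` maps
`x₁ ^ d` to `w`. -/
theorem power_of_generator_profinitely_rigid
    (r : ℕ) (hr : 1 ≤ r) (d : ℕ) (hd : 1 ≤ d) (w : FreeGroup (Fin r))
    (h : SameMeasureOnFiniteGroups w ((FreeGroup.of (⟨0, hr⟩ : Fin r)) ^ d)) :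
    ∃ θ : MulAut (FreeGroup (Fin r)), θ ((FreeGroup.of (⟨0, hr⟩ : Fin r)) ^ d) = w := by
  exact h.exists_mulAut (by omega)
end

section
/- Let w ∈ F_k be a word which is not contained in any proper free factor of F_k, and let u_1, …, u_k ∈ F = F_r be words that are free (they satisfy no non-trivial relation, i.e., they freely generate a free subgroup of rank k) but such that ⟨u_1, …, u_k⟩ is not a free factor of F. Then for every sufficiently large N, Tr_w(N) < Tr_{w(u_1,…,u_k)}(N), where w(u_1,…,u_k) denotes the image of w under the homomorphism F_k → F sending the i-th generator to u_i. -/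
open scoped Monoid.Coprod

/-- A subgroup `M` of a group `G` is a free factor of `G` if there is a complementary
subgroup `M'` such that the natural map from the free product `M ∗ M'` to `G` is an
isomorphism (i.e. `G` splits as the free product of `M` and `M'`). -/
def IsFreeFactor {G : Type} [Group G] (M : Subgroup G) : Prop :=
  ∃ M' : Subgroup G, Function.Bijective (Monoid.Coprod.lift M.subtype M'.subtype)

/-- The number of fixed points of a permutation of `Fin N`. -/
def numFixedPoints {N : ℕ} (σ : Equiv.Perm (Fin N)) : ℕ :=
  (Finset.univ.filter fun x => σ x = x).card

/-- `trw r N w` is the expected number of fixed points of `φ w`, where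
`φ : FreeGroup (Fin r) →* S_N` is a uniformly random homomorphism (equivalently,
the images of the `r` generators are independent uniform permutations). -/
noncomputable def trw (r N : ℕ) (w : FreeGroup (Fin r)) : ℚ :=
  (∑ f : Fin r → Equiv.Perm (Fin N), (numFixedPoints ((FreeGroup.lift f) w) : ℚ)) /
    (Fintype.card (Fin r → Equiv.Perm (Fin N)))

namespace WordMeasure

open FreeGroup (of)

variable {α : Type} {V G : Type} [MulAction (FreeGroup α) V] [Group G]

/-- The parallel transport of a `G`-labelling of the edges of the Schreier graph of `V`: the
product of the labels met when the word `g` is followed from the vertex `v`. -/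
def holonomy (f : α × V → G) (g : FreeGroup α) (v : V) : G :=
  (FreeGroup.lift (fun a => (⟨fun u => f (a, (of a)⁻¹ • u), of a⟩ :
    (V → G) ⋊[mulAutArrow] FreeGroup α)) g).left (g • v)

theorem holonomy_aux_right (f : α × V → G) (g : FreeGroup α) :
    (FreeGroup.lift (fun a => (⟨fun u => f (a, (of a)⁻¹ • u), of a⟩ :
      (V → G) ⋊[mulAutArrow] FreeGroup α)) g).right = g := by
  have : SemidirectProduct.rightHom.comp (FreeGroup.lift (fun a =>
      (⟨fun u => f (a, (of a)⁻¹ • u), of a⟩ : (V → G) ⋊[mulAutArrow] FreeGroup α))) =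
      MonoidHom.id _ := by
    ext a; simp
  exact DFunLike.congr_fun this g

theorem holonomy_of (f : α × V → G) (a : α) (v : V) : holonomy f (of a) v = f (a, v) := by
  simp [holonomy]

theorem holonomy_mul (f : α × V → G) (g h : FreeGroup α) (v : V) :
    holonomy f (g * h) v = holonomy f g (h • v) * holonomy f h v := by
  simp only [holonomy, map_mul, SemidirectProduct.mul_left, holonomy_aux_right, Pi.mul_apply]
  rw [show ∀ F : V → G, ∀ u, mulAutArrow g F u = F (g⁻¹ • u) from fun _ _ => rfl, mul_smul,
    inv_smul_smul]

theorem holonomy_one (f : α × V → G) (v : V) : holonomy f 1 v = 1 := by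
  have := holonomy_mul f 1 1 v
  simpa using this

theorem holonomy_inv (f : α × V → G) (g : FreeGroup α) (v : V) :
    holonomy f g⁻¹ v = (holonomy f g (g⁻¹ • v))⁻¹ := by
  have := holonomy_mul f g g⁻¹ v
  rw [mul_inv_cancel, holonomy_one] at this
  exact (inv_eq_of_mul_eq_one_right this.symm).symm

/-- A vertex of the Cayley graph can be reached from `1` by a path that stays inside `P`. -/
inductive Reach (P : Set (FreeGroup α)) : FreeGroup α → Prop
  | one : 1 ∈ P → Reach P 1
  | mul (a : α) (p : FreeGroup α) : Reach P p → of a * p ∈ P → Reach P (of a * p)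
  | inv (a : α) (p : FreeGroup α) : Reach P p → (of a)⁻¹ * p ∈ P → Reach P ((of a)⁻¹ * p)

theorem Reach.mem {P : Set (FreeGroup α)} {p : FreeGroup α} (h : Reach P p) : p ∈ P := by
  cases h <;> assumption

theorem Reach.mono {P Q : Set (FreeGroup α)} (hPQ : P ⊆ Q) {p : FreeGroup α} (h : Reach P p) :
    Reach Q p := by
  induction h with
  | one h => exact .one (hPQ h)
  | mul a p _ h ih => exact .mul a p ih (hPQ h)
  | inv a p _ h ih => exact .inv a p ih (hPQ h)

/-- `P` spans a connected subgraph of the Cayley graph that contains `1`. -/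
def IsConn (P : Set (FreeGroup α)) : Prop := 1 ∈ P ∧ ∀ p ∈ P, Reach P p

theorem IsConn.one_mem {P : Set (FreeGroup α)} (hP : IsConn P) : 1 ∈ P := hP.1

/-- Induction along the edges of a connected set. -/
theorem IsConn.induction {P : Set (FreeGroup α)} (hP : IsConn P) {C : FreeGroup α → Prop}
    (one : C 1) (step : ∀ a p, p ∈ P → of a * p ∈ P → (C p ↔ C (of a * p)))
    {p : FreeGroup α} (hp : p ∈ P) : C p := by
  induction hP.2 p hp with
  | one h => exact one
  | mul a p h h' ih => exact (step a p h.mem h').1 (ih h.mem)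
  | inv a p h h' ih =>
    refine (step a _ h' ?_).2 ?_ <;> rw [mul_inv_cancel_left]
    exacts [h.mem, ih h.mem]

theorem IsConn.union {P Q : Set (FreeGroup α)} (hP : IsConn P) (hQ : IsConn Q) :
    IsConn (P ∪ Q) :=
  ⟨Or.inl hP.1, fun p hp => hp.elim (fun h => (hP.2 p h).mono Set.subset_union_left)
    fun h => (hQ.2 p h).mono Set.subset_union_right⟩

theorem IsConn.insert {P : Set (FreeGroup α)} (hP : IsConn P) {q : FreeGroup α}
    (h : ∃ a, ∃ p ∈ P, q = of a * p ∨ q = (of a)⁻¹ * p) : IsConn (insert q P) := by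
  refine ⟨Or.inr hP.1, ?_⟩
  rintro p (rfl | hp)
  · obtain ⟨a, p, hp, rfl | rfl⟩ := h
    · exact .mul a p ((hP.2 p hp).mono (Set.subset_insert _ _)) (Set.mem_insert _ _)
    · exact .inv a p ((hP.2 p hp).mono (Set.subset_insert _ _)) (Set.mem_insert _ _)
  · exact (hP.2 p hp).mono (Set.subset_insert _ _)

theorem exists_isConn_mem (g : FreeGroup α) :
    ∃ P : Set (FreeGroup α), P.Finite ∧ IsConn P ∧ g ∈ P := by
  have hg : g ∈ Subgroup.closure (Set.range (of : α → FreeGroup α)) := by simp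
  induction hg using Subgroup.closure_induction_left with
  | one => exact ⟨{1}, Set.finite_singleton _, ⟨rfl, by rintro p rfl; exact .one rfl⟩, rfl⟩
  | mul_left x hx y hy ih =>
    obtain ⟨a, rfl⟩ := hx
    obtain ⟨P, hf, hP, hm⟩ := ih
    exact ⟨_, hf.insert _, hP.insert ⟨a, y, hm, Or.inl rfl⟩, Set.mem_insert _ _⟩
  | inv_mul_cancel x hx y hy ih =>
    obtain ⟨a, rfl⟩ := hx
    obtain ⟨P, hf, hP, hm⟩ := ih
    exact ⟨_, hf.insert _, hP.insert ⟨a, y, hm, Or.inr rfl⟩, Set.mem_insert _ _⟩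

theorem exists_isConn_superset {S : Set (FreeGroup α)} (hS : S.Finite) :
    ∃ P : Set (FreeGroup α), P.Finite ∧ IsConn P ∧ S ⊆ P := by
  induction S, hS using Set.Finite.induction_on with
  | empty =>
    obtain ⟨P, h1, h2, -⟩ := exists_isConn_mem (1 : FreeGroup α)
    exact ⟨P, h1, h2, Set.empty_subset _⟩
  | @insert g S _ _ ih =>
    obtain ⟨P, h1, h2, h3⟩ := ih
    obtain ⟨Q, h4, h5, h6⟩ := exists_isConn_mem g
    exact ⟨Q ∪ P, h4.union h1, h5.union h2,
      Set.insert_subset (Or.inl h6) (h3.trans Set.subset_union_right)⟩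

/-- The base point of the Schreier graph of `K`. -/
abbrev base (K : Subgroup (FreeGroup α)) : FreeGroup α ⧸ K := ((1 : FreeGroup α) : FreeGroup α ⧸ K)

/-- The vertices of the Schreier graph of `K` visited by `P`. -/
abbrev Vert (P : Set (FreeGroup α)) (K : Subgroup (FreeGroup α)) : Set (FreeGroup α ⧸ K) :=
  QuotientGroup.mk '' P

/-- The edges of the Schreier graph of `K` visited by `P`. -/
def Edge (P : Set (FreeGroup α)) (K : Subgroup (FreeGroup α)) : Set (α × (FreeGroup α ⧸ K)) :=
  {e | ∃ p ∈ P, of e.1 * p ∈ P ∧ (p : FreeGroup α ⧸ K) = e.2}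

open Classical in
/-- Extend a labelling of the edges visited by `P` by `1`. -/
noncomputable def extendLabel {P : Set (FreeGroup α)} {K : Subgroup (FreeGroup α)}
    (f : Edge P K → G) (e : α × (FreeGroup α ⧸ K)) : G :=
  if h : e ∈ Edge P K then f ⟨e, h⟩ else 1

theorem extendLabel_mk {P : Set (FreeGroup α)} {K : Subgroup (FreeGroup α)}
    (f : Edge P K → G) (e : Edge P K) : extendLabel f e = f e := by
  simp [extendLabel]

theorem smul_coe_of_mem {K : Subgroup (FreeGroup α)} {k : FreeGroup α} (hk : k ∈ K) :
    k • (base K) = (base K) := by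
  change ((k * 1 : FreeGroup α) : FreeGroup α ⧸ K) = _
  rw [mul_one, eq_comm, QuotientGroup.eq]
  simpa

/-- The homomorphism `K →* G` obtained from a labelling of the Schreier graph of `K`. -/
def holonomyHom {K : Subgroup (FreeGroup α)} (f : α × (FreeGroup α ⧸ K) → G) : K →* G where
  toFun k := holonomy f k (base K)
  map_one' := holonomy_one _ _
  map_mul' k l := by
    rw [Subgroup.coe_mul, holonomy_mul, smul_coe_of_mem l.2]

/-- The subgroup of `K` generated by the closed paths in the part of the Schreier graph
visited by `P`. -/
def loops (P : Set (FreeGroup α)) (K : Subgroup (FreeGroup α)) : Subgroup (FreeGroup α) :=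
  Subgroup.closure {g | g ∈ K ∧ ∃ p ∈ P, ∃ q ∈ P, g = p⁻¹ * q}

theorem loops_le (P : Set (FreeGroup α)) (K : Subgroup (FreeGroup α)) : loops P K ≤ K :=
  (Subgroup.closure_le _).2 fun _ h => h.1

theorem exists_equiv_hom (P : Set (FreeGroup α)) (hP : IsConn P) (K : Subgroup (FreeGroup α))
    (hK : K ≤ loops P K) (G : Type) [Group G] :
    ∃ e : ((Edge P K → G) × G) ≃ ((K →* G) × (Vert P K → G)),
      ∀ f g k, (e (f, g)).1 k = g⁻¹ * holonomyHom (extendLabel f) k * g := by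
  classical
  have hr : ∃ r : FreeGroup α ⧸ K → FreeGroup α, r (base K) = 1 ∧
      ∀ v, (r v : FreeGroup α ⧸ K) = v :=
    ⟨fun v => if v = (base K) then 1 else v.out, by simp, fun v => by
      by_cases h : v = (base K) <;> simp [h]⟩
  obtain ⟨r, hr1, hr⟩ := hr
  have hmem : ∀ p : FreeGroup α, (r p)⁻¹ * p ∈ K := fun p => QuotientGroup.eq.1 (hr p)
  have hmem2 : ∀ (a : α) (v : FreeGroup α ⧸ K), (r (of a • v))⁻¹ * (of a * r v) ∈ K := fun a v => by
    rw [← QuotientGroup.eq, hr]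
    conv_lhs => rw [← hr v]
    rfl
  have hb : (base K) ∈ Vert P K := Set.mem_image_of_mem _ hP.1
  let b : Vert P K := ⟨_, hb⟩
  let src : Edge P K → Vert P K := fun e => ⟨e.1.2, by
    obtain ⟨p, hp, _, h⟩ := e.2; exact ⟨p, hp, h⟩⟩
  let tgt : Edge P K → Vert P K := fun e => ⟨of e.1.1 • e.1.2, by
    obtain ⟨p, _, hp, h⟩ := e.2; exact ⟨_, hp, by rw [← h]; rfl⟩⟩
  let back : ((K →* G) × (Vert P K → G)) → (Edge P K → G) := fun x e =>
    x.2 (tgt e) * x.1 ⟨_, hmem2 e.1.1 e.1.2⟩ * (x.2 (src e))⁻¹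
  have key : ∀ x : (K →* G) × (Vert P K → G), ∀ p (hp : p ∈ P),
      holonomy (extendLabel (back x)) p (base K) * x.2 b =
        x.2 ⟨_, Set.mem_image_of_mem _ hp⟩ * x.1 ⟨_, hmem p⟩ := by
    intro x p hp
    refine hP.induction (C := fun p => ∀ hp : p ∈ P, holonomy (extendLabel (back x)) p (base K) *
      x.2 b = x.2 ⟨_, Set.mem_image_of_mem _ hp⟩ * x.1 ⟨_, hmem p⟩) ?_ ?_ hp hp
    · intro hp
      have : (⟨_, hmem 1⟩ : K) = 1 := by ext1; simp [hr1]
      rw [holonomy_one, this]; simp [b]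
    · intro a p hp hp'
      have he : ((a, (p : FreeGroup α ⧸ K)) : α × (FreeGroup α ⧸ K)) ∈ Edge P K := ⟨p, hp, hp', rfl⟩
      have h1 : p • (base K) = (p : FreeGroup α ⧸ K) := by
        change ((p * 1 : FreeGroup α) : FreeGroup α ⧸ K) = _
        rw [mul_one]
      have h2 : (⟨_, hmem (of a * p)⟩ : K) =
          ⟨_, hmem2 a (p : FreeGroup α ⧸ K)⟩ * ⟨_, hmem p⟩ := by
        ext1
        change (r (of a • (p : FreeGroup α ⧸ K)))⁻¹ * _ = _
        simp [mul_assoc]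
      have h3 := extendLabel_mk (back x) ⟨_, he⟩
      simp only [hp, hp', forall_true_left, holonomy_mul, holonomy_of, h1, h2, map_mul, h3]
      simp only [back, src, tgt]
      constructor
      · intro h
        rw [mul_assoc, h]
        simp only [mul_assoc, inv_mul_cancel_left]
        rfl
      · intro h
        have h4 : (⟨of a • (p : FreeGroup α ⧸ K), (tgt ⟨_, he⟩).2⟩ : Vert P K) =
          ⟨((of a * p : FreeGroup α) : FreeGroup α ⧸ K), _, hp', rfl⟩ := rfl
        rw [h4] at h
        simp only [mul_assoc] at h
        have h5 := mul_left_cancel (mul_left_cancel h)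
        rw [inv_mul_eq_iff_eq_mul] at h5
        simpa only [mul_assoc] using h5
  let fwd : ((Edge P K → G) × G) → ((K →* G) × (Vert P K → G)) := fun x =>
    ((MulAut.conj x.2⁻¹).toMonoidHom.comp (holonomyHom (extendLabel x.1)),
      fun v => holonomy (extendLabel x.1) (r v) (base K) * x.2)
  have hrv : ∀ v : FreeGroup α ⧸ K, r v • (base K) = v := fun v => by
    change ((r v * 1 : FreeGroup α) : FreeGroup α ⧸ K) = _
    rw [mul_one, hr]
  refine ⟨⟨fwd, fun x => (back x, x.2 b), ?_, ?_⟩, ?_⟩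
  · rintro ⟨f, g⟩
    ext e
    · obtain ⟨⟨a, v⟩, he⟩ := e
      have h6 := extendLabel_mk f ⟨_, he⟩
      simp only [back, fwd, src, tgt, holonomyHom]
      simp only [MonoidHom.coe_comp, Function.comp_apply, MonoidHom.coe_mk, OneHom.coe_mk]
      simp only [holonomy_mul, holonomy_inv, hrv, holonomy_of, mul_smul, h6]
      have h7 : (r (of a • v))⁻¹ • (of a • v) = (base K) := by
        rw [inv_smul_eq_iff, hrv]
      simp [h7, mul_assoc]
    · simp [fwd, b, hr1, holonomy_one]
  · rintro ⟨φ, h⟩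
    have hφ : (fwd (back (φ, h), h b)).1 = φ := by
      have hle : K ≤ (MonoidHom.eqLocus (fwd (back (φ, h), h b)).1 φ).map K.subtype := by
        refine hK.trans ((Subgroup.closure_le _).2 ?_)
        rintro _ ⟨hg, p, hp, q, hq, rfl⟩
        refine ⟨⟨_, hg⟩, ?_, rfl⟩
        change _ = _
        have kp := key (φ, h) p hp
        have kq := key (φ, h) q hq
        have hpq : (p : FreeGroup α ⧸ K) = q := QuotientGroup.eq.2 hg
        have h8 : p⁻¹ • q • (base K) =
            (base K) := by
          rw [← mul_smul, smul_coe_of_mem hg]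
        have h9 : (⟨_, hg⟩ : K) = ⟨_, hmem p⟩⁻¹ * ⟨_, hmem q⟩ := by
          ext1; simp [hpq]
        simp only [fwd, holonomyHom, MonoidHom.coe_comp, Function.comp_apply, MonoidHom.coe_mk,
          OneHom.coe_mk]
        rw [holonomy_mul, holonomy_inv, h8, h9, map_mul, map_inv]
        rw [← eq_mul_inv_iff_mul_eq] at kp kq
        rw [kp, kq]
        simp [hpq, mul_assoc]
      ext k
      obtain ⟨k', hk', hk⟩ := hle k.2
      obtain rfl : k' = k := Subtype.ext hk
      exact hk'
    refine Prod.ext hφ ?_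
    funext ⟨v, hv⟩
    obtain ⟨p, hp, rfl⟩ := hv
    have kp := key (φ, h) p hp
    have h10 : p = r (p : FreeGroup α ⧸ K) * ((r (p : FreeGroup α ⧸ K))⁻¹ * p) := by group
    have h11 := DFunLike.congr_fun hφ ⟨_, hmem p⟩
    simp only [fwd, holonomyHom, MonoidHom.coe_comp, Function.comp_apply, MonoidHom.coe_mk,
          OneHom.coe_mk] at h11
    have h12 : holonomy (extendLabel (back (φ, h))) p (base K) =
        holonomy (extendLabel (back (φ, h))) (r (p : FreeGroup α ⧸ K)) (base K) *
        holonomy (extendLabel (back (φ, h))) ((r (p : FreeGroup α ⧸ K))⁻¹ * p) (base K) := by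
      conv_lhs => rw [h10]
      rw [holonomy_mul, smul_coe_of_mem (hmem p)]
    rw [h12] at kp
    simp only [MulEquiv.coe_toMonoidHom, MulAut.conj_apply, inv_inv] at h11
    have h13 := eq_mul_of_inv_mul_eq (by rw [← h11, mul_assoc] :
      (h b)⁻¹ * (holonomy (extendLabel (back (φ, h))) ((r (p : FreeGroup α ⧸ K))⁻¹ * p) (base K) *
        h b) = φ ⟨_, hmem p⟩)
    rw [mul_assoc, h13, ← mul_assoc] at kp
    exact mul_right_cancel kp
  · intro f g k
    simp [fwd]
end WordMeasure

namespace WordMeasure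

open FreeGroup (of)
open Finset

section Counting

open scoped Classical in
theorem prod_card_filter_lt {A : Type} (s : Finset A) (ord : A → ℕ)
    (hord : Function.Injective ord) (g : ℕ → ℝ) :
    ∏ a ∈ s, g (#{b ∈ s | ord b < ord a}) = ∏ i ∈ range #s, g i := by
  let _ : LinearOrder A := LinearOrder.lift' ord hord
  have hlt : ∀ a b : A, ord a < ord b ↔ a < b := fun a b => Iff.rfl
  induction s using Finset.induction_on_max with
  | empty => simp
  | insert a s ha ih =>
    have hn : a ∉ s := fun h => lt_irrefl _ (ha a h)
    rw [prod_insert hn, card_insert_of_notMem hn, prod_range_succ, ← ih, mul_comm]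
    congr 1
    · refine prod_congr rfl fun b hb => ?_
      rw [filter_insert, if_neg]
      exact fun h => lt_asymm (ha b hb) ((hlt _ _).1 h)
    · congr 2
      rw [filter_insert, if_neg (lt_irrefl _)]
      exact filter_true_of_mem fun b hb => (hlt _ _).2 (ha b hb)

theorem cast_descFactorial_eq_prod {N k : ℕ} (h : k ≤ N) :
    ((N.descFactorial k : ℕ) : ℝ) = ∏ i ∈ range k, ((N : ℝ) - i) := by
  rw [Nat.descFactorial_eq_prod_range, Nat.cast_prod]
  refine prod_congr rfl fun i hi => ?_
  rw [Nat.cast_sub ((mem_range.1 hi).le.trans h)]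

open scoped Classical in
theorem prod_descFactorial_fiber {A B : Type} [Fintype A] [Fintype B] (q : A → B) (ord : A → ℕ)
    (hord : Function.Injective ord) {N : ℕ} (hN : Fintype.card A ≤ N) :
    ∏ b, ((N.descFactorial (Fintype.card {a // q a = b}) : ℕ) : ℝ) =
      ∏ a, ((N : ℝ) - #{a' | ord a' < ord a ∧ q a' = q a}) := by
  rw [← Finset.prod_fiberwise univ q]
  refine prod_congr rfl fun b _ => ?_
  rw [cast_descFactorial_eq_prod ((Fintype.card_subtype_le _).trans hN), Fintype.card_subtype,
    ← prod_card_filter_lt _ ord hord fun i => (N : ℝ) - i]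
  refine prod_congr rfl fun a ha => ?_
  obtain rfl := (mem_filter.1 ha).2
  congr 3
  ext a'
  simp [and_comm]

open scoped Classical in
theorem card_injective_on_fibers {A B : Type} [Fintype A] (q : A → B) (ord : A → ℕ)
    (hord : Function.Injective ord) {N : ℕ} (hN : Fintype.card A ≤ N) :
    (Fintype.card {t : A → Fin N // ∀ a b, q a = q b → t a = t b → a = b} : ℝ) =
      ∏ a, ((N : ℝ) - #{a' | ord a' < ord a ∧ q a' = q a}) := by
  let q' : A → Set.range q := fun a => ⟨q a, a, rfl⟩
  have h := prod_descFactorial_fiber q' ord hord hN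
  refine Eq.trans ?_ (h.trans (prod_congr rfl fun a _ => ?_))
  swap
  · congr 3
    ext a'
    simp only [mem_filter, q', Subtype.ext_iff]
  rw [← Nat.cast_prod]
  congr 1
  let e : {t : A → Fin N // ∀ a b, q a = q b → t a = t b → a = b} ≃
      ((b : Set.range q) → ({a // (⟨q a, a, rfl⟩ : Set.range q) = b} ↪ Fin N)) :=
    { toFun := fun t b => ⟨fun a => t.1 a, fun a a' haa => Subtype.ext
        (t.2 _ _ (congrArg Subtype.val (a.2.trans a'.2.symm)) haa)⟩
      invFun := fun u => ⟨fun a => u ⟨q a, a, rfl⟩ ⟨a, rfl⟩, fun a b hab hu => by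
        have : ∀ (x y : Set.range q) (hx : (⟨q a, a, rfl⟩ : Set.range q) = x)
            (hy : (⟨q b, b, rfl⟩ : Set.range q) = y), x = y → u x ⟨a, hx⟩ = u y ⟨b, hy⟩ → a = b := by
          rintro x y hx hy rfl h
          exact congrArg Subtype.val ((u x).injective h)
        exact this _ _ rfl rfl (Subtype.ext hab) hu⟩
      left_inv := fun t => rfl
      right_inv := fun u => by
        ext b a
        obtain ⟨a, rfl⟩ := a
        rfl }
  rw [Fintype.card_congr e, Fintype.card_pi]
  refine prod_congr rfl fun b _ => ?_
  rw [Fintype.card_embedding_eq, Fintype.card_fin]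
  congr!

open scoped Classical in
theorem card_perm_extending {A : Type} [Fintype A] {N : ℕ} (s t : A → Fin N)
    (hs : Function.Injective s) (ht : Function.Injective t) :
    (Nat.card {g : Equiv.Perm (Fin N) // ∀ a, g (s a) = t a} : ℝ) / (N.factorial : ℝ) =
      ((N.descFactorial (Fintype.card A) : ℕ) : ℝ)⁻¹ := by
  rw [Nat.card_eq_fintype_card]
  have hcard : Fintype.card A ≤ N := by
    simpa using Fintype.card_le_of_injective s hs
  have h : ∀ t' : A ↪ Fin N, Fintype.card {g : Equiv.Perm (Fin N) // ∀ a, g (s a) = t' a} =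
      Fintype.card {g : Equiv.Perm (Fin N) // ∀ a, g (s a) = t a} := by
    intro t'
    obtain ⟨c, hc⟩ := Equiv.Perm.exists_extending_pair t' t t'.injective ht
    refine Fintype.card_congr ((Equiv.mulLeft c).subtypeEquiv fun g => ?_)
    refine forall_congr' fun a => ?_
    rw [Equiv.coe_mulLeft, Equiv.Perm.mul_apply, ← hc, c.apply_eq_iff_eq]
  have h2 : N.factorial = N.descFactorial (Fintype.card A) *
      Fintype.card {g : Equiv.Perm (Fin N) // ∀ a, g (s a) = t a} := by
    have h3 : Fintype.card (Equiv.Perm (Fin N)) = ∑ t' : A ↪ Fin N,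
        Fintype.card {g : Equiv.Perm (Fin N) // ∀ a, g (s a) = t' a} := by
      rw [← Fintype.card_sigma]
      refine Fintype.card_congr ⟨fun g => ⟨⟨fun a => g (s a), g.injective.comp hs⟩, g, fun a => rfl⟩,
        fun x => x.2.1, fun g => rfl, ?_⟩
      rintro ⟨t', g, hg⟩
      obtain rfl : (⟨fun a => g (s a), g.injective.comp hs⟩ : A ↪ Fin N) = t' :=
        DFunLike.ext _ _ hg
      rfl
    rw [Fintype.card_perm, Fintype.card_fin] at h3
    rw [h3, sum_congr rfl fun t' _ => h t', sum_const, card_univ, Fintype.card_embedding_eq,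
      Fintype.card_fin, smul_eq_mul]
  have h4 : ((N.descFactorial (Fintype.card A) : ℕ) : ℝ) ≠ 0 := by
    rw [Nat.cast_ne_zero, Ne, Nat.descFactorial_eq_zero_iff_lt]
    omega
  rw [div_eq_iff (by positivity), eq_comm, inv_mul_eq_iff_eq_mul₀ h4]
  exact_mod_cast h2

end Counting

/-- The average number of fixed points of `φ h`, where `φ` runs over all homomorphisms from the
group `H` to the symmetric group on `N` points. -/
noncomputable def avgFix {H : Type} [Group H] (h : H) (N : ℕ) : ℝ :=
  (∑ᶠ φ : H →* Equiv.Perm (Fin N), (numFixedPoints (φ h) : ℝ)) /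
    Nat.card (H →* Equiv.Perm (Fin N))

theorem avgFix_congr {H H' : Type} [Group H] [Group H'] (e : H ≃* H') (h : H) (N : ℕ) :
    avgFix (e h) N = avgFix h N := by
  unfold avgFix
  let E : (H' →* Equiv.Perm (Fin N)) ≃ (H →* Equiv.Perm (Fin N)) :=
    e.symm.monoidHomCongrLeftEquiv
  rw [Nat.card_congr E]
  congr 1
  exact finsum_eq_of_bijective E E.bijective fun φ => rfl

theorem numFixedPoints_conj {N : ℕ} (g x : Equiv.Perm (Fin N)) :
    numFixedPoints (g⁻¹ * x * g) = numFixedPoints x := by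
  unfold numFixedPoints
  refine card_bij (fun i _ => g i) ?_ (fun _ _ _ _ h => g.injective h) fun i hi =>
    ⟨g⁻¹ i, ?_, by simp⟩
  · intro i hi
    simp only [mem_filter, mem_univ, true_and, Equiv.Perm.mul_apply, Equiv.Perm.inv_eq_iff_eq] at hi ⊢
    exact hi
  · simp only [mem_filter, mem_univ, true_and, Equiv.Perm.mul_apply, Equiv.Perm.inv_eq_iff_eq] at hi ⊢
    simpa using hi

end WordMeasure

namespace WordMeasure

open Finset

noncomputable instance fintypeSetoid {V : Type} [Fintype V] : Fintype (Setoid V) := by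
  classical
  exact Fintype.ofInjective (fun σ p q => σ p q) fun σ σ' h =>
    Setoid.ext fun p q => iff_of_eq (congrFun (congrFun h p) q)

noncomputable instance fintypeQuotient {V : Type} [Fintype V] (σ : Setoid V) :
    Fintype (Quotient σ) :=
  Fintype.ofFinite _

theorem card_quotient_le' {V : Type} [Fintype V] (σ : Setoid V) :
    Fintype.card (Quotient σ) ≤ Fintype.card V :=
  Fintype.card_le_of_surjective _ Quotient.mk_surjective

/-- An injective numbering of a finite type. -/
noncomputable def number {A : Type} [Fintype A] (a : A) : ℕ := Fintype.equivFin A a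

theorem number_injective {A : Type} [Fintype A] : Function.Injective (number (A := A)) :=
  Fin.val_injective.comp (Fintype.equivFin A).injective

open scoped Classical in
/-- The number of classes of `σ` that come before the class `c` and lie in the same fibre of `κ`. -/
noncomputable def earlier {V B : Type} [Fintype V] (κ : V → B) (σ : Setoid V) (c : Quotient σ) : ℕ :=
  #{c' : Quotient σ | number c' < number c ∧ κ c'.out = κ c.out}

section Folding

variable {V S L B E : Type} (src tgt : S → V) (lab : S → L)

/-- A partition of the vertices of a labelled graph is folded if in the quotient graph no two
different edges with the same label share their source or their target. -/
def Folded (σ : Setoid V) : Prop :=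
  ∀ s s', lab s = lab s' → (σ (src s) (src s') ↔ σ (tgt s) (tgt s'))

/-- The partition of the edges induced by a partition of the vertices. -/
def edgeSetoid (σ : Setoid V) : Setoid S := Setoid.ker lab ⊓ σ.comap src

variable {src tgt lab}

theorem edgeSetoid_iff {σ : Setoid V} {s s' : S} :
    edgeSetoid src lab σ s s' ↔ lab s = lab s' ∧ σ (src s) (src s') := Iff.rfl

variable [Fintype E] {κ : V → B} {ε : S → E}

open scoped Classical in
theorem prod_card_perm_of_not_folded
    (hε : ∀ s s', ε s = ε s' ↔ lab s = lab s' ∧ κ (src s) = κ (src s'))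
    (hκ : ∀ s s', lab s = lab s' → (κ (src s) = κ (src s') ↔ κ (tgt s) = κ (tgt s')))
    {N : ℕ} (τ : V → Fin N) (hf : ¬ Folded src tgt lab (Setoid.ker τ ⊓ Setoid.ker κ)) :
    ∏ e : E, ((Nat.card {g : Equiv.Perm (Fin N) //
        ∀ s, ε s = e → g (τ (src s)) = τ (tgt s)} : ℝ) / (N.factorial : ℝ)) = 0 := by
  simp only [Folded, not_forall] at hf
  obtain ⟨s, s', hl, h⟩ := hf
  rw [show (Setoid.ker τ ⊓ Setoid.ker κ) (src s) (src s') ↔ τ (src s) = τ (src s') ∧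
    κ (src s) = κ (src s') from Iff.rfl, show (Setoid.ker τ ⊓ Setoid.ker κ) (tgt s) (tgt s') ↔
    τ (tgt s) = τ (tgt s') ∧ κ (tgt s) = κ (tgt s') from Iff.rfl, ← hκ s s' hl] at h
  have hk : κ (src s) = κ (src s') := by by_contra hk; simp [hk] at h
  refine prod_eq_zero (mem_univ (ε s)) ?_
  rw [div_eq_zero_iff]
  left
  rw [Nat.cast_eq_zero, Finite.card_eq_zero_iff]
  refine ⟨fun g => h ?_⟩
  have h1 := g.2 s rfl
  have h2 := g.2 s' ((hε _ _).2 ⟨hl, hk⟩).symm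
  rw [← h1, ← h2, g.1.apply_eq_iff_eq]

variable [Fintype S]

open scoped Classical in
theorem prod_card_perm_of_folded
    (hε : ∀ s s', ε s = ε s' ↔ lab s = lab s' ∧ κ (src s) = κ (src s'))
    (hκ : ∀ s s', lab s = lab s' → (κ (src s) = κ (src s') ↔ κ (tgt s) = κ (tgt s')))
    {N : ℕ} (hN : Fintype.card S ≤ N) (τ : V → Fin N)
    (hf : Folded src tgt lab (Setoid.ker τ ⊓ Setoid.ker κ)) :
    ∏ e : E, ((Nat.card {g : Equiv.Perm (Fin N) //
        ∀ s, ε s = e → g (τ (src s)) = τ (tgt s)} : ℝ) / (N.factorial : ℝ)) =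
      (∏ c : Quotient (edgeSetoid src lab (Setoid.ker τ ⊓ Setoid.ker κ)),
        ((N : ℝ) - earlier ε _ c))⁻¹ := by
  have hN' : Fintype.card (Quotient (edgeSetoid src lab (Setoid.ker τ ⊓ Setoid.ker κ))) ≤ N :=
    (card_quotient_le' _).trans hN
  unfold earlier
  rw [← prod_descFactorial_fiber (fun c => ε (Quotient.out c)) number number_injective hN',
    ← prod_inv_distrib]
  refine prod_congr rfl fun e _ => ?_
  have hσ : ∀ {p q}, (Setoid.ker τ ⊓ Setoid.ker κ) p q ↔ τ p = τ q ∧ κ p = κ q := Iff.rfl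
  rw [← card_perm_extending (fun c : {c : Quotient (edgeSetoid src lab
    (Setoid.ker τ ⊓ Setoid.ker κ)) // ε (Quotient.out c) = e} => τ (src c.1.out))
    (fun c => τ (tgt c.1.out))]
  · congr 2
    refine Nat.card_congr (Equiv.subtypeEquivRight fun g => ⟨fun h c => h _ c.2, ?_⟩)
    intro h s hs
    have h1 : edgeSetoid src lab (Setoid.ker τ ⊓ Setoid.ker κ) (Quotient.out (Quotient.mk _ s)) s :=
      Quotient.mk_out s
    obtain ⟨h2, h3⟩ := edgeSetoid_iff.1 h1
    have h4 := (hf _ _ h2).1 h3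
    have h5 := h ⟨Quotient.mk _ s, by rw [← hs, hε]; exact ⟨h2, (hσ.1 h3).2⟩⟩
    dsimp only at h5
    rwa [(hσ.1 h3).1, (hσ.1 h4).1] at h5
  · rintro ⟨c, hc⟩ ⟨c', hc'⟩ h
    obtain ⟨h1, h2⟩ := (hε _ _).1 (hc.trans hc'.symm)
    exact Subtype.ext (Quotient.out_equiv_out.1 ⟨h1, h, h2⟩)
  · rintro ⟨c, hc⟩ ⟨c', hc'⟩ h
    obtain ⟨h1, h2⟩ := (hε _ _).1 (hc.trans hc'.symm)
    exact Subtype.ext (Quotient.out_equiv_out.1 ⟨h1, (hf _ _ h1).2 ⟨h, (hκ _ _ h1).1 h2⟩⟩)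

variable [Fintype V] [DecidableEq V]

open scoped Classical in
theorem card_labelling {σ : Setoid V} (hσ : σ ≤ Setoid.ker κ) {N : ℕ} (hN : Fintype.card V ≤ N) :
    ((#{τ : V → Fin N | Setoid.ker τ ⊓ Setoid.ker κ = σ} : ℕ) : ℝ) =
      ∏ c : Quotient σ, ((N : ℝ) - earlier κ _ c) := by
  have hN' : Fintype.card (Quotient σ) ≤ N := (card_quotient_le' _).trans hN
  have hκ : ∀ p : V, κ (Quotient.mk σ p).out = κ p := fun p => hσ (Quotient.mk_out p)
  unfold earlier
  rw [← card_injective_on_fibers (fun c : Quotient σ => κ c.out) number number_injective hN',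
    Nat.cast_inj, Fintype.card_subtype, eq_comm]
  refine card_bij (fun t _ p => t (Quotient.mk σ p)) ?_ ?_ ?_
  · intro t ht
    rw [mem_filter] at ht ⊢
    refine ⟨mem_univ _, le_antisymm ?_ fun p q h => ⟨congrArg t (Quotient.sound h), hσ h⟩⟩
    intro p q h
    refine Quotient.exact (ht.2 (Quotient.mk σ p) (Quotient.mk σ q) ?_ h.1)
    rw [hκ, hκ]
    exact h.2
  · intro t _ t' _ h
    funext c
    induction c using Quotient.inductionOn
    exact congrFun h _
  · intro τ hτ
    have hτ := (mem_filter.1 hτ).2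
    have hl : ∀ a b, σ a b → τ a = τ b := fun a b h => by
      rw [← hτ] at h
      exact h.1
    refine ⟨Quotient.lift τ hl, ?_, rfl⟩
    rw [mem_filter]
    refine ⟨mem_univ _, fun a b => ?_⟩
    induction a using Quotient.inductionOn
    induction b using Quotient.inductionOn
    rename_i a b
    rw [hκ, hκ]
    intro h1 h2
    have h3 : (Setoid.ker τ ⊓ Setoid.ker κ) a b := ⟨h2, h1⟩
    rw [hτ] at h3
    exact Quotient.sound h3

open scoped Classical in
theorem sum_prod_card_perm
    (hε : ∀ s s', ε s = ε s' ↔ lab s = lab s' ∧ κ (src s) = κ (src s'))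
    (hκ : ∀ s s', lab s = lab s' → (κ (src s) = κ (src s') ↔ κ (tgt s) = κ (tgt s')))
    {N : ℕ} (hV : Fintype.card V ≤ N) (hS : Fintype.card S ≤ N) {x y : V} (hxy : κ x = κ y) :
    (∑ τ : V → Fin N with τ x = τ y, ∏ e : E, ((Nat.card {g : Equiv.Perm (Fin N) //
        ∀ s, ε s = e → g (τ (src s)) = τ (tgt s)} : ℝ) / (N.factorial : ℝ))) =
      ∑ σ : Setoid V with Folded src tgt lab σ ∧ σ x y, if σ ≤ Setoid.ker κ then
        (∏ c : Quotient σ, ((N : ℝ) - earlier κ _ c)) /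
          ∏ c : Quotient (edgeSetoid src lab σ),
            ((N : ℝ) - earlier ε _ c) else 0 := by
  rw [← sum_fiberwise _ (fun τ => Setoid.ker τ ⊓ Setoid.ker κ), sum_filter (s := univ) (p := fun σ =>
    Folded src tgt lab σ ∧ σ x y)]
  refine sum_congr rfl fun σ _ => ?_
  rw [filter_filter]
  by_cases hσ : σ ≤ Setoid.ker κ
  · rw [if_pos hσ, ← card_labelling hσ hV]
    split_ifs with h
    · rw [div_eq_mul_inv, ← nsmul_eq_mul, ← sum_const]
      refine sum_congr ?_ fun τ hτ => ?_
      · ext τ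
        simp only [mem_filter, mem_univ, true_and, and_iff_right_iff_imp]
        rintro rfl
        exact h.2.1
      · obtain rfl := (mem_filter.1 hτ).2
        exact prod_card_perm_of_folded hε hκ hS τ h.1
    · refine sum_eq_zero fun τ hτ => ?_
      obtain ⟨h1, rfl⟩ := (mem_filter.1 hτ).2
      exact prod_card_perm_of_not_folded hε hκ τ fun h2 => h ⟨h2, h1, hxy⟩
  · rw [if_neg hσ, ite_self]
    refine sum_eq_zero fun τ hτ => ?_
    obtain ⟨h1, rfl⟩ := (mem_filter.1 hτ).2
    exact absurd inf_le_right hσ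

end Folding
end WordMeasure

namespace WordMeasure

open FreeGroup (of)
open Finset

variable {α : Type}

/-- The edges of the Cayley graph with both ends in `P`. -/
abbrev Steps (P : Set (FreeGroup α)) : Set (α × FreeGroup α) := {s | s.2 ∈ P ∧ of s.1 * s.2 ∈ P}

variable {P : Set (FreeGroup α)}

/-- The source of an edge. -/
def stepSrc (s : Steps P) : P := ⟨s.1.2, s.2.1⟩

/-- The target of an edge. -/
def stepTgt (s : Steps P) : P := ⟨of s.1.1 * s.1.2, s.2.2⟩

/-- The label of an edge. -/
def stepLab (s : Steps P) : α := s.1.1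

noncomputable instance fintypeSteps [Fintype P] : Fintype (Steps P) := by
  classical
  refine Fintype.ofInjective (fun s => (stepSrc s, stepTgt s)) ?_
  rintro ⟨⟨a, p⟩, hs⟩ ⟨⟨b, q⟩, ht⟩ h
  have h1 : p = q := congrArg Subtype.val (congrArg Prod.fst h)
  have h2 : of a * p = of b * q := congrArg Subtype.val (congrArg Prod.snd h)
  subst h1
  have h3 := FreeGroup.of_injective (mul_right_cancel h2)
  subst h3
  rfl

/-- The vertex of the Schreier graph visited by an element of `P`. -/
def vertMap (P : Set (FreeGroup α)) (K : Subgroup (FreeGroup α)) (p : P) : FreeGroup α ⧸ K :=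
  (p : FreeGroup α)

theorem vertMap_eq_iff {K : Subgroup (FreeGroup α)} {p q : P} :
    vertMap P K p = vertMap P K q ↔ (p : FreeGroup α)⁻¹ * q ∈ K :=
  QuotientGroup.eq

/-- The edge of the Schreier graph visited by an edge of the Cayley graph. -/
def edgeMap (P : Set (FreeGroup α)) (K : Subgroup (FreeGroup α)) (s : Steps P) :
    α × (FreeGroup α ⧸ K) :=
  (stepLab s, vertMap P K (stepSrc s))

theorem vertMap_tgt_iff {K : Subgroup (FreeGroup α)} {s s' : Steps P}
    (h : stepLab s = stepLab s') :
    vertMap P K (stepSrc s) = vertMap P K (stepSrc s') ↔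
      vertMap P K (stepTgt s) = vertMap P K (stepTgt s') := by
  rw [vertMap_eq_iff, vertMap_eq_iff]
  obtain ⟨⟨a, p⟩, hs⟩ := s
  obtain ⟨⟨b, q⟩, ht⟩ := s'
  obtain rfl : a = b := h
  simp [stepSrc, stepTgt, mul_assoc]

theorem edgeMap_surjective (P : Set (FreeGroup α)) (K : Subgroup (FreeGroup α)) (e : Edge P K) :
    ∃ s : Steps P, edgeMap P K s = e := by
  obtain ⟨⟨a, v⟩, p, hp, hp', h⟩ := e
  exact ⟨⟨(a, p), hp, hp'⟩, Prod.ext rfl h⟩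

theorem edgeMap_mem (P : Set (FreeGroup α)) {P' : Set (FreeGroup α)} (h : P ⊆ P')
    (K : Subgroup (FreeGroup α)) (s : Steps P) : edgeMap P K s ∈ Edge P' K :=
  ⟨s.1.2, h s.2.1, h s.2.2, rfl⟩

noncomputable instance fintypeEdge [Fintype P] (K : Subgroup (FreeGroup α)) :
    Fintype (Edge P K) := by
  classical
  refine Fintype.ofSurjective (fun s : Steps P => ⟨_, edgeMap_mem P subset_rfl K s⟩) fun e => ?_
  obtain ⟨s, hs⟩ := edgeMap_surjective P K e
  exact ⟨s, Subtype.ext hs⟩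

theorem earlier_congr {V B B' : Type} [Fintype V] {κ : V → B} {κ' : V → B'}
    (h : ∀ p q, κ p = κ q ↔ κ' p = κ' q) (σ : Setoid V) (c : Quotient σ) :
    earlier κ σ c = earlier κ' σ c := by
  unfold earlier
  congr 1
  ext c'
  simp only [mem_filter, h]

open scoped Classical in
theorem avgFix_eq_sum_labels [Fintype P] (hP : IsConn P) (K : Subgroup (FreeGroup α))
    (hK : K ≤ loops P K) (k : K) (N : ℕ) :
    avgFix k N = (∑ f : Edge P K → Equiv.Perm (Fin N),
      (numFixedPoints (holonomyHom (extendLabel f) k) : ℝ)) /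
        Fintype.card (Edge P K → Equiv.Perm (Fin N)) := by
  obtain ⟨e, he⟩ := exists_equiv_hom P hP K hK (Equiv.Perm (Fin N))
  let _ : Fintype (Vert P K) := Fintype.ofFinite _
  have : Finite (K →* Equiv.Perm (Fin N)) := by
    refine Finite.of_surjective (fun x => (e x).1) fun φ => ?_
    obtain ⟨x, hx⟩ := e.surjective (φ, 1)
    exact ⟨x, congrArg Prod.fst hx⟩
  let _ : Fintype (K →* Equiv.Perm (Fin N)) := Fintype.ofFinite _
  have hcard := Fintype.card_congr e
  rw [Fintype.card_prod, Fintype.card_prod] at hcard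
  have hsum : ∑ x : (Edge P K → Equiv.Perm (Fin N)) × Equiv.Perm (Fin N),
      (numFixedPoints (holonomyHom (extendLabel x.1) k) : ℝ) =
      ∑ y : (K →* Equiv.Perm (Fin N)) × (Vert P K → Equiv.Perm (Fin N)),
        (numFixedPoints (y.1 k) : ℝ) := by
    rw [← e.sum_comp]
    refine sum_congr rfl fun x _ => ?_
    rw [he, numFixedPoints_conj]
  rw [Fintype.sum_prod_type, Fintype.sum_prod_type] at hsum
  simp only [sum_const, card_univ, nsmul_eq_mul, ← mul_sum] at hsum
  rw [avgFix, finsum_eq_sum_of_fintype, Nat.card_eq_fintype_card]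
  have hcard' := congrArg (Nat.cast : ℕ → ℝ) hcard
  rw [Nat.cast_mul, Nat.cast_mul] at hcard'
  have h0 : ∀ (T : Type) [Fintype T] [Nonempty T], (Fintype.card T : ℝ) ≠ 0 := fun T _ _ => by
    exact_mod_cast Fintype.card_ne_zero
  rw [div_eq_div_iff (h0 _) (h0 _)]
  refine mul_left_cancel₀ (h0 (Vert P K → Equiv.Perm (Fin N))) ?_
  rw [← mul_assoc, ← hsum]
  linear_combination (∑ f : Edge P K → Equiv.Perm (Fin N),
      (numFixedPoints (holonomyHom (extendLabel f) k) : ℝ)) * hcard'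

open scoped Classical in
theorem numFixedPoints_holonomy [Fintype P] (hP : IsConn P) {K : Subgroup (FreeGroup α)}
    {N : ℕ} (f : α × (FreeGroup α ⧸ K) → Equiv.Perm (Fin N)) (w : P) (hw : (w : FreeGroup α) ∈ K) :
    numFixedPoints (holonomyHom f ⟨w, hw⟩) =
      #{τ : P → Fin N | τ w = τ ⟨1, hP.one_mem⟩ ∧
        ∀ s : Steps P, f (edgeMap P K s) (τ (stepSrc s)) = τ (stepTgt s)} := by
  have hb : ∀ p : FreeGroup α, p • base K = (p : FreeGroup α ⧸ K) := fun p => by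
    change ((p * 1 : FreeGroup α) : FreeGroup α ⧸ K) = _
    rw [mul_one]
  have hstep : ∀ (s : Steps P), holonomy f (stepTgt s).1 (base K) =
      f (edgeMap P K s) * holonomy f (stepSrc s).1 (base K) := fun s => by
    simp only [stepTgt, holonomy_mul, holonomy_of, hb, stepSrc]
    rfl
  refine card_bij (fun i _ p => holonomy f p.1 (base K) i) ?_ ?_ ?_
  · intro i hi
    rw [mem_filter] at hi ⊢
    refine ⟨mem_univ _, ?_, fun s => ?_⟩
    · change holonomy f w.1 (base K) i = holonomy f 1 (base K) i
      rw [holonomy_one]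
      exact hi.2
    · dsimp only
      rw [hstep, Equiv.Perm.mul_apply]
  · intro i _ j _ h
    simpa [holonomy_one] using congrFun h ⟨1, hP.one_mem⟩
  · intro τ hτ
    obtain ⟨-, h1, h2⟩ := mem_filter.1 hτ
    have key : ∀ p (hp : p ∈ P), holonomy f p (base K) (τ ⟨1, hP.one_mem⟩) = τ ⟨p, hp⟩ := by
      intro p hp
      refine hP.induction (C := fun p => ∀ hp : p ∈ P,
        holonomy f p (base K) (τ ⟨1, hP.one_mem⟩) = τ ⟨p, hp⟩) ?_ ?_ hp hp
      · intro _
        rw [holonomy_one]; rfl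
      · intro a p hp hp'
        simp only [hp, hp', forall_true_left]
        have h3 := hstep ⟨(a, p), hp, hp'⟩
        have h4 := h2 ⟨(a, p), hp, hp'⟩
        simp only [stepTgt, stepSrc] at h3 h4
        rw [h3, ← h4, Equiv.Perm.mul_apply, Equiv.apply_eq_iff_eq]
    refine ⟨τ ⟨1, hP.one_mem⟩, ?_, funext fun p => key p.1 p.2⟩
    rw [mem_filter]
    refine ⟨mem_univ _, ?_⟩
    exact (key w.1 w.2).trans h1

theorem exists_isConn_le_loops (hP : P.Finite) (hc : IsConn P) {K : Subgroup (FreeGroup α)}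
    (hK : K.FG) : ∃ P' : Set (FreeGroup α), P'.Finite ∧ IsConn P' ∧ P ⊆ P' ∧ K ≤ loops P' K := by
  obtain ⟨S, rfl⟩ := hK
  obtain ⟨Q, hQ, hQc, hSQ⟩ := exists_isConn_superset S.finite_toSet
  refine ⟨P ∪ Q, hP.union hQ, hc.union hQc, Set.subset_union_left, ?_⟩
  rw [Subgroup.closure_le]
  intro g hg
  exact Subgroup.subset_closure ⟨Subgroup.subset_closure hg, 1, Or.inl hc.1, g, Or.inr (hSQ hg),
    by simp⟩

theorem card_forall_fiber {S E X : Type} [Fintype E] (ε : S → E) (r : S → X → Prop) :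
    Nat.card {f : E → X // ∀ s, r s (f (ε s))} =
      ∏ e, Nat.card {x // ∀ s, ε s = e → r s x} := by
  rw [← Nat.card_pi]
  refine Nat.card_congr ((Equiv.subtypeEquivRight fun f => ?_).trans
    (Equiv.subtypePiEquivPi (p := fun e x => ∀ s, ε s = e → r s x)))
  constructor
  · rintro h _ s rfl
    exact h s
  · exact fun h s => h _ s rfl

open scoped Classical in
theorem avgFix_eq_sum_prod_card [Fintype P] (hP : IsConn P) {P' : Set (FreeGroup α)} [Fintype P']
    (hc' : IsConn P') {K : Subgroup (FreeGroup α)} (hK : K ≤ loops P' K)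
    (w : P) (hw : (w : FreeGroup α) ∈ K) (N : ℕ) (ε : Steps P → Edge P' K)
    (hε : ∀ s, (ε s : α × (FreeGroup α ⧸ K)) = edgeMap P K s) :
    avgFix (⟨w, hw⟩ : K) N =
      ∑ τ : P → Fin N with τ w = τ ⟨1, hP.one_mem⟩, ∏ e : Edge P' K,
        ((Nat.card {g : Equiv.Perm (Fin N) //
          ∀ s, ε s = e → g (τ (stepSrc s)) = τ (stepTgt s)} : ℝ) / (N.factorial : ℝ)) := by
  have hfac : ((Fintype.card (Edge P' K → Equiv.Perm (Fin N)) : ℕ) : ℝ) =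
      ∏ e : Edge P' K, (N.factorial : ℝ) := by
    rw [Fintype.card_pi, Nat.cast_prod]
    simp [Fintype.card_perm]
  have hfix : ∀ f : Edge P' K → Equiv.Perm (Fin N),
      (numFixedPoints (holonomyHom (extendLabel f) (⟨w, hw⟩ : K)) : ℝ) =
        ∑ τ : P → Fin N with τ w = τ ⟨1, hP.one_mem⟩,
          if ∀ s, f (ε s) (τ (stepSrc s)) = τ (stepTgt s) then (1 : ℝ) else 0 := by
    intro f
    rw [numFixedPoints_holonomy hP, sum_boole, filter_filter]
    have : ∀ s, extendLabel f (edgeMap P K s) = f (ε s) := fun s => by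
      rw [← hε, extendLabel_mk]
    simp only [this]
  rw [avgFix_eq_sum_labels hc' K hK]
  simp only [hfix]
  rw [sum_comm, sum_div]
  refine sum_congr rfl fun τ _ => ?_
  rw [sum_boole, hfac, prod_div_distrib]
  congr 1
  rw [← Nat.cast_prod, Nat.cast_inj, ← Fintype.card_subtype, ← Nat.card_eq_fintype_card]
  exact card_forall_fiber ε fun s (g : Equiv.Perm (Fin N)) => g (τ (stepSrc s)) = τ (stepTgt s)

open scoped Classical in
theorem avgFix_eq_sum_partitions [Fintype P] (hP : IsConn P) {K : Subgroup (FreeGroup α)}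
    (hK : K.FG) (w : P) (hw : (w : FreeGroup α) ∈ K) {N : ℕ} (hV : Fintype.card P ≤ N)
    (hS : Fintype.card (Steps P) ≤ N) :
    avgFix (⟨w, hw⟩ : K) N =
      ∑ σ : Setoid P with Folded stepSrc stepTgt stepLab σ ∧ σ w ⟨1, hP.one_mem⟩,
        if σ ≤ Setoid.ker (vertMap P K) then
          (∏ c : Quotient σ, ((N : ℝ) - earlier (vertMap P K) σ c)) /
            ∏ c : Quotient (edgeSetoid stepSrc stepLab σ),
              ((N : ℝ) - earlier (edgeMap P K) _ c) else 0 := by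
  obtain ⟨P', hP', hc', hPP', hK'⟩ := exists_isConn_le_loops (Set.toFinite P) hP hK
  have := hP'.fintype
  obtain ⟨ε, hε⟩ : ∃ ε : Steps P → Edge P' K, ∀ s, (ε s : α × (FreeGroup α ⧸ K)) = edgeMap P K s :=
    ⟨fun s => ⟨_, edgeMap_mem P hPP' K s⟩, fun _ => rfl⟩
  have hεe : ∀ s s' : Steps P, ε s = ε s' ↔ edgeMap P K s = edgeMap P K s' := fun s s' => by
    rw [Subtype.ext_iff, hε, hε]
  have hxy : vertMap P K w = vertMap P K ⟨1, hP.one_mem⟩ := by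
    rw [vertMap_eq_iff]
    simpa using hw
  rw [avgFix_eq_sum_prod_card hP hc' hK' w hw N ε hε,
    sum_prod_card_perm (κ := vertMap P K) (lab := stepLab) (fun s s' => by
      rw [hεe, edgeMap, edgeMap, Prod.mk_inj]) (fun s s' h => vertMap_tgt_iff h) hV hS hxy]
  simp only [earlier_congr hεe]

end WordMeasure

namespace WordMeasure

open Finset Filter Asymptotics

section Expansion

theorem inv_pow_isBigO {m n : ℕ} (h : m ≤ n) :
    (fun N : ℕ => ((N : ℝ)⁻¹) ^ n) =O[atTop] fun N : ℕ => ((N : ℝ)⁻¹) ^ m := by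
  refine IsBigO.of_bound 1 ((eventually_ge_atTop 1).mono fun N hN => ?_)
  have hN' : (1 : ℝ) ≤ N := by exact_mod_cast hN
  rw [one_mul, Real.norm_of_nonneg (by positivity), Real.norm_of_nonneg (by positivity)]
  exact pow_le_pow_of_le_one (by positivity) (inv_le_one_of_one_le₀ hN') h

variable {F : Type} [Group F]

open scoped Classical in
/-- `g N K` is, for large `N`, a combination of the indicators of the events `s ⊆ K`, where `s` runs
over finitely many finite subsets of `D` and the coefficient of `s` has order at most `N ^ (-#s)`. -/
def HasExpansion (D : Set F) (g : ℕ → Subgroup F → ℝ) : Prop :=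
  ∃ (ι : Type) (_ : Fintype ι) (s : ι → Finset F) (a : ι → ℕ → ℝ),
    (∀ i, (s i : Set F) ⊆ D) ∧ (∀ i, a i =O[atTop] fun N : ℕ => ((N : ℝ)⁻¹) ^ #(s i)) ∧
      ∀ᶠ N in atTop, ∀ K : Subgroup F,
        g N K = ∑ i, if (s i : Set F) ⊆ K then a i N else 0

theorem HasExpansion.one (D : Set F) : HasExpansion D fun _ _ => 1 :=
  ⟨Unit, inferInstance, fun _ => ∅, fun _ _ => 1, by simp,
    by simpa using isBigO_refl (fun _ : ℕ => (1 : ℝ)) atTop, by simp⟩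

theorem HasExpansion.mul {D : Set F} {g g' : ℕ → Subgroup F → ℝ} (h : HasExpansion D g)
    (h' : HasExpansion D g') : HasExpansion D fun N K => g N K * g' N K := by
  classical
  obtain ⟨ι, _, s, a, h1, h2, h3⟩ := h
  obtain ⟨ι', _, s', a', h1', h2', h3'⟩ := h'
  refine ⟨ι × ι', inferInstance, fun i => s i.1 ∪ s' i.2, fun i N => a i.1 N * a' i.2 N,
    fun i => ?_, fun i => ?_, ?_⟩
  · rw [coe_union]
    exact Set.union_subset (h1 _) (h1' _)
  · refine ((h2 i.1).mul (h2' i.2)).trans ?_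
    simp only [← pow_add]
    exact inv_pow_isBigO (card_union_le _ _)
  · filter_upwards [h3, h3'] with N hN hN' K
    rw [hN, hN', sum_mul_sum, Fintype.sum_prod_type]
    refine sum_congr rfl fun i _ => sum_congr rfl fun j _ => ?_
    rw [coe_union, Set.union_subset_iff]
    split_ifs <;> simp_all

theorem HasExpansion.prod {D : Set F} {T : Type} (S : Finset T) {g : T → ℕ → Subgroup F → ℝ}
    (h : ∀ t ∈ S, HasExpansion D (g t)) : HasExpansion D fun N K => ∏ t ∈ S, g t N K := by
  classical
  induction S using Finset.induction_on with
  | empty => simpa using HasExpansion.one D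
  | insert t S ht ih =>
    simp only [prod_insert ht]
    exact (h t (mem_insert_self _ _)).mul (ih fun t' ht' => h t' (mem_insert_of_mem ht'))

open scoped Classical in
theorem hasExpansion_linear {D : Set F} (S : Finset F) (hS : (S : Set F) ⊆ D) :
    HasExpansion D fun N K => 1 - (N : ℝ)⁻¹ * #{x ∈ S | x ∈ K} := by
  refine ⟨Option S, inferInstance, fun o => o.elim ∅ fun x => {x.1},
    fun o N => o.elim 1 fun _ => -(N : ℝ)⁻¹, ?_, ?_, Eventually.of_forall fun N K => ?_⟩
  · rintro (_ | x)
    · simp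
    · simpa using hS x.2
  · rintro (_ | x)
    · simpa using isBigO_refl (fun _ : ℕ => (1 : ℝ)) atTop
    · simpa using isBigO_refl (fun N : ℕ => (N : ℝ)⁻¹) atTop
  · rw [Fintype.sum_option]
    simp only [Option.elim_none, Option.elim_some, coe_empty, Set.empty_subset, if_true,
      coe_singleton, Set.singleton_subset_iff, SetLike.mem_coe]
    rw [sum_coe_sort S fun x => if x ∈ K then -(N : ℝ)⁻¹ else 0, ← sum_filter, sum_const,
      nsmul_eq_mul]
    ring

/-- The coefficients of the Newton expansion of `1 / (1 - t * n)` in binomial coefficients. -/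
noncomputable def newtonCoeff (t : ℝ) (j : ℕ) : ℝ :=
  t ^ j * (j.factorial / ∏ i ∈ range j, (1 - (i + 1) * t))

theorem sum_choose_mul_newtonCoeff {t : ℝ} {n : ℕ} (h : ∀ i ≤ n, (1 - i * t) ≠ 0) :
    ∑ j ∈ range (n + 1), (n.choose j : ℝ) * newtonCoeff t j = (1 - t * n)⁻¹ := by
  have key : ∀ m ≤ n, (1 - t * n) * ∑ j ∈ range (m + 1), (n.choose j : ℝ) * newtonCoeff t j =
      1 - (m + 1) * t * (n.choose (m + 1)) * newtonCoeff t m := by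
    intro m hm
    induction m with
    | zero => simp [newtonCoeff]
    | succ m ih =>
      rw [sum_range_succ, mul_add, ih (by omega)]
      have h1 : newtonCoeff t (m + 1) * (1 - (m + 1) * t) = (m + 1) * t * newtonCoeff t m := by
        have h2 := h (m + 1) hm
        push_cast at h2
        unfold newtonCoeff
        rw [prod_range_succ, Nat.factorial_succ, ← div_div]
        push_cast
        generalize ∏ i ∈ range m, (1 - ((i : ℝ) + 1) * t) = D
        field_simp
        ring
      have h3 : ((n : ℝ) - (m + 1)) * n.choose (m + 1) = (m + 2) * n.choose (m + 2) := by
        have := Nat.choose_succ_right_eq n (m + 1)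
        have h4 := congrArg (Nat.cast : ℕ → ℝ) this
        push_cast [Nat.cast_sub hm] at h4
        linarith
      push_cast
      linear_combination (n.choose (m + 1) : ℝ) * h1 - t * newtonCoeff t (m + 1) * h3
  have h5 := key n le_rfl
  rw [Nat.choose_succ_self] at h5
  refine eq_inv_of_mul_eq_one_right ?_
  simpa using h5

theorem newtonCoeff_isBigO (j : ℕ) :
    (fun N : ℕ => newtonCoeff (N : ℝ)⁻¹ j) =O[atTop] fun N : ℕ => ((N : ℝ)⁻¹) ^ j := by
  have h : Tendsto (fun N : ℕ => (j.factorial : ℝ) / ∏ i ∈ range j, (1 - ((i : ℝ) + 1) * (N : ℝ)⁻¹))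
      atTop (nhds ((j.factorial : ℝ) / ∏ i ∈ range j, (1 - ((i : ℝ) + 1) * 0))) := by
    refine Tendsto.div tendsto_const_nhds (tendsto_finsetProd _ fun i _ => ?_) (by simp)
    exact tendsto_const_nhds.sub (tendsto_const_nhds.mul tendsto_inv_atTop_nhds_zero_nat)
  simpa [newtonCoeff] using (isBigO_refl (fun N : ℕ => ((N : ℝ)⁻¹) ^ j) atTop).mul (h.isBigO_one ℝ)

open scoped Classical in
theorem hasExpansion_inv {D : Set F} (S : Finset F) (hS : (S : Set F) ⊆ D) :
    HasExpansion D fun N K => (1 - (N : ℝ)⁻¹ * #{x ∈ S | x ∈ K})⁻¹ := by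
  refine ⟨S.powerset, inferInstance, fun s => s.1, fun s N => newtonCoeff (N : ℝ)⁻¹ #s.1,
    fun s => (coe_subset.2 (mem_powerset.1 s.2)).trans hS, fun s => newtonCoeff_isBigO _, ?_⟩
  filter_upwards [eventually_gt_atTop #S] with N hN K
  rw [sum_coe_sort S.powerset fun s => if (s : Set F) ⊆ K then newtonCoeff (N : ℝ)⁻¹ #s else 0,
    ← sum_filter]
  have h1 : (S.powerset.filter fun s : Finset F => (s : Set F) ⊆ K) =
      (S.filter fun x => x ∈ K).powerset := by
    ext s
    simp only [mem_filter, mem_powerset, subset_iff, Set.subset_def, SetLike.mem_coe]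
    exact ⟨fun h x hx => ⟨h.1 hx, h.2 x hx⟩, fun h => ⟨fun x hx => (h hx).1, fun x hx => (h hx).2⟩⟩
  rw [h1, sum_powerset_apply_card, ← sum_choose_mul_newtonCoeff]
  · simp only [nsmul_eq_mul]
  · intro i hi
    have hN0 : (0 : ℝ) < N := by exact_mod_cast (Nat.zero_le _).trans_lt hN
    have : (i : ℝ) < N := by exact_mod_cast (hi.trans (card_filter_le _ _)).trans_lt hN
    have h2 : (i : ℝ) * (N : ℝ)⁻¹ < 1 := by rwa [← div_eq_mul_inv, div_lt_one hN0]
    linarith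

end Expansion

end WordMeasure

namespace WordMeasure

open FreeGroup (of)

section Relations

variable {α : Type} {P : Set (FreeGroup α)}

/-- The subgroup generated by the identifications of a partition of `P`. -/
def relSubgroup (σ : Setoid P) : Subgroup (FreeGroup α) :=
  Subgroup.closure {g | ∃ p q : P, σ p q ∧ g = (p : FreeGroup α)⁻¹ * q}

theorem relSubgroup_le_iff {σ : Setoid P} {K : Subgroup (FreeGroup α)} :
    relSubgroup σ ≤ K ↔ σ ≤ Setoid.ker (vertMap P K) := by
  rw [relSubgroup, Subgroup.closure_le]
  constructor
  · intro h p q hpq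
    exact vertMap_eq_iff.2 (h ⟨p, q, hpq, rfl⟩)
  · rintro h _ ⟨p, q, hpq, rfl⟩
    exact vertMap_eq_iff.1 (h hpq)

theorem relSubgroup_fg [Finite P] (σ : Setoid P) : (relSubgroup σ).FG := by
  refine (Subgroup.fg_iff _).2 ⟨_, rfl, ?_⟩
  refine (Set.finite_range fun x : P × P => (x.1 : FreeGroup α)⁻¹ * x.2).subset ?_
  rintro _ ⟨p, q, -, rfl⟩
  exact ⟨(p, q), rfl⟩

theorem relSubgroup_ker_vertMap (K : Subgroup (FreeGroup α)) :
    relSubgroup (Setoid.ker (vertMap P K)) = loops P K := by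
  refine le_antisymm ?_ ?_
  · refine (Subgroup.closure_le _).2 ?_
    rintro _ ⟨p, q, h, rfl⟩
    exact Subgroup.subset_closure ⟨vertMap_eq_iff.1 h, p, p.2, q, q.2, rfl⟩
  · refine (Subgroup.closure_le _).2 ?_
    rintro _ ⟨h, p, hp, q, hq, rfl⟩
    exact Subgroup.subset_closure ⟨⟨p, hp⟩, ⟨q, hq⟩, vertMap_eq_iff.2 h, rfl⟩

theorem loops_fg [Finite P] (K : Subgroup (FreeGroup α)) : (loops P K).FG :=
  relSubgroup_ker_vertMap (P := P) K ▸ relSubgroup_fg _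

theorem exists_perm_extending [Finite P] (hP : IsConn P) {σ : Setoid P}
    (hσ : Folded stepSrc stepTgt stepLab σ) :
    ∃ φ : FreeGroup α →* Equiv.Perm (Quotient σ),
      ∀ p : P, φ p (Quotient.mk σ ⟨1, hP.one_mem⟩) = Quotient.mk σ p := by
  have h : ∀ a : α, ∃ τ : Equiv.Perm (Quotient σ), ∀ s : Steps P, stepLab s = a →
      τ (Quotient.mk σ (stepSrc s)) = Quotient.mk σ (stepTgt s) := by
    intro a
    let A := {c : Quotient σ // ∃ s : Steps P, stepLab s = a ∧ Quotient.mk σ (stepSrc s) = c}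
    have hA : ∀ c : A, ∃ s : Steps P, stepLab s = a ∧ Quotient.mk σ (stepSrc s) = c := fun c => c.2
    choose s hs1 hs2 using hA
    obtain ⟨τ, hτ⟩ := Equiv.Perm.exists_extending_pair (fun c : A => (c : Quotient σ))
      (fun c => Quotient.mk σ (stepTgt (s c))) Subtype.val_injective (fun c c' hc => by
        have h1 : σ (stepSrc (s c)) (stepSrc (s c')) :=
          (hσ _ _ ((hs1 c).trans (hs1 c').symm)).2 (Quotient.exact hc)
        exact Subtype.ext ((hs2 c).symm.trans ((Quotient.sound h1).trans (hs2 c'))))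
    refine ⟨τ, fun t ht => ?_⟩
    refine (hτ ⟨_, t, ht, rfl⟩).trans (Quotient.sound ?_)
    exact (hσ _ _ ((hs1 _).trans ht.symm)).1 (Quotient.exact (hs2 ⟨_, t, ht, rfl⟩))
  choose τ hτ using h
  refine ⟨FreeGroup.lift τ, fun ⟨p, hp⟩ => ?_⟩
  refine hP.induction (C := fun p => ∀ hp : p ∈ P, FreeGroup.lift τ p
    (Quotient.mk σ ⟨1, hP.one_mem⟩) = Quotient.mk σ ⟨p, hp⟩) ?_ ?_ hp hp
  · simp
  · intro a p hp hp'
    have h1 := hτ a ⟨(a, p), hp, hp'⟩ rfl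
    simp only [hp, hp', forall_true_left, map_mul, FreeGroup.lift_apply_of, Equiv.Perm.mul_apply]
    constructor
    · intro h
      rw [h]
      exact h1
    · intro h
      exact (τ a).injective (h.trans h1.symm)

theorem ker_vertMap_relSubgroup [Finite P] (hP : IsConn P) {σ : Setoid P}
    (hσ : Folded stepSrc stepTgt stepLab σ) : Setoid.ker (vertMap P (relSubgroup σ)) = σ := by
  refine le_antisymm (fun p q h => ?_) (relSubgroup_le_iff.1 le_rfl)
  obtain ⟨φ, hφ⟩ := exists_perm_extending hP hσ
  have h1 : relSubgroup σ ≤ (MulAction.stabilizer (Equiv.Perm (Quotient σ))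
      (Quotient.mk σ ⟨1, hP.one_mem⟩)).comap φ := by
    refine (Subgroup.closure_le _).2 ?_
    rintro _ ⟨p, q, hpq, rfl⟩
    rw [SetLike.mem_coe, Subgroup.mem_comap, MulAction.mem_stabilizer_iff, Equiv.Perm.smul_def,
      map_mul, Equiv.Perm.mul_apply, hφ, map_inv, Equiv.Perm.inv_eq_iff_eq, hφ]
    exact Quotient.sound (σ.symm hpq)
  have h2 := h1 (vertMap_eq_iff.1 h)
  rw [Subgroup.mem_comap, MulAction.mem_stabilizer_iff, Equiv.Perm.smul_def,
      map_mul, Equiv.Perm.mul_apply, hφ, map_inv, Equiv.Perm.inv_eq_iff_eq, hφ] at h2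
  exact σ.symm (Quotient.exact h2)

theorem relSubgroup_le_loops (σ : Setoid P) : relSubgroup σ ≤ loops P (relSubgroup σ) := by
  rw [← relSubgroup_ker_vertMap]
  refine (Subgroup.closure_le _).2 ?_
  rintro _ ⟨p, q, hpq, rfl⟩
  exact Subgroup.subset_closure ⟨p, q, relSubgroup_le_iff.1 le_rfl hpq, rfl⟩

theorem folded_ker_vertMap (K : Subgroup (FreeGroup α)) :
    Folded stepSrc stepTgt stepLab (Setoid.ker (vertMap P K)) :=
  fun _ _ h => vertMap_tgt_iff h

/-- Free groups are residually finite. -/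
theorem exists_hom_perm_ne_one {g : FreeGroup α} (hg : g ≠ 1) :
    ∃ (Q : Type) (_ : Finite Q) (φ : FreeGroup α →* Equiv.Perm Q), φ g ≠ 1 := by
  obtain ⟨P, hP, hc, hgP⟩ := exists_isConn_mem g
  have := hP.to_subtype
  have hσ : Folded stepSrc stepTgt stepLab (⊥ : Setoid P) := fun s s' h => by
    obtain ⟨⟨a, p⟩, hs⟩ := s
    obtain ⟨⟨b, q⟩, ht⟩ := s'
    obtain rfl : a = b := h
    simp [stepSrc, stepTgt]
  obtain ⟨φ, hφ⟩ := exists_perm_extending hc hσ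
  refine ⟨_, inferInstance, φ, fun h => hg ?_⟩
  have h1 := hφ ⟨g, hgP⟩
  rw [h, Equiv.Perm.one_apply] at h1
  exact (congrArg Subtype.val (Quotient.exact h1)).symm

theorem injective_of_surjective_of_card_eq {ι κ : Type} [Finite ι] [Finite κ]
    (h : Nat.card ι = Nat.card κ) (f : FreeGroup ι →* FreeGroup κ) (hf : Function.Surjective f) :
    Function.Injective f := by
  rw [injective_iff_map_eq_one]
  intro g hg
  by_contra hne
  obtain ⟨Q, _, φ, hφ⟩ := exists_hom_perm_ne_one hne
  have hfin : ∀ ι : Type, Finite ι → Finite (FreeGroup ι →* Equiv.Perm Q) := fun ι _ =>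
    Finite.of_equiv _ (FreeGroup.lift (α := ι) (β := Equiv.Perm Q))
  have h1 := hfin ι inferInstance
  have h2 := hfin κ inferInstance
  let c : (FreeGroup κ →* Equiv.Perm Q) → (FreeGroup ι →* Equiv.Perm Q) := fun ψ => ψ.comp f
  have hc : Function.Injective c := fun ψ ψ' hψ =>
    (MonoidHom.cancel_right hf).1 hψ
  have hcard : Nat.card (FreeGroup κ →* Equiv.Perm Q) = Nat.card (FreeGroup ι →* Equiv.Perm Q) := by
    rw [← Nat.card_congr (FreeGroup.lift (α := ι) (β := Equiv.Perm Q)),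
      ← Nat.card_congr (FreeGroup.lift (α := κ) (β := Equiv.Perm Q)), Nat.card_fun, Nat.card_fun, h]
  obtain ⟨ψ, hψ⟩ := ((Nat.bijective_iff_injective_and_card c).2 ⟨hc, hcard⟩).2 φ
  refine hφ ?_
  rw [← hψ]
  simp [c, hg]

end Relations

end WordMeasure

namespace WordMeasure

open FreeGroup (of)

section FreeFactors

theorem mem_of_forall_of_mem {ι H : Type} [Group H] (f : FreeGroup ι →* H) (x : FreeGroup ι)
    (M : Subgroup H) (h : ∀ i, f (of i) ∈ M) : f x ∈ M := by
  have h1 : (⊤ : Subgroup (FreeGroup ι)) ≤ M.comap f := by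
    rw [← FreeGroup.closure_range_of, Subgroup.closure_le]
    rintro _ ⟨i, rfl⟩
    exact h i
  exact h1 (Subgroup.mem_top x)

theorem isFreeFactor_of_bijective {ι κ H : Type} [Group H] (ψ : FreeGroup (ι ⊕ κ) →* H)
    (hψ : Function.Bijective ψ) : IsFreeFactor (ψ.comp (FreeGroup.map Sum.inl)).range := by
  let f := ψ.comp (FreeGroup.map (Sum.inl : ι → ι ⊕ κ))
  let g := ψ.comp (FreeGroup.map (Sum.inr : κ → ι ⊕ κ))
  change IsFreeFactor f.range
  refine ⟨g.range, ?_⟩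
  let e := MulEquiv.ofBijective ψ hψ
  let χ : FreeGroup (ι ⊕ κ) →* Monoid.Coprod f.range g.range :=
    FreeGroup.lift (Sum.elim (fun i => Monoid.Coprod.inl (f.rangeRestrict (of i)))
      fun i => Monoid.Coprod.inr (g.rangeRestrict (of i)))
  have h1 : (Monoid.Coprod.lift f.range.subtype g.range.subtype).comp χ = ψ := by
    refine FreeGroup.ext_hom _ _ ?_
    rintro (i | i) <;> simp [χ, f, g]
  have h2 : χ.comp ((e.symm : H →* FreeGroup (ι ⊕ κ)).comp
      (Monoid.Coprod.lift f.range.subtype g.range.subtype)) = MonoidHom.id _ := by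
    have h3 : ∀ x, e.symm (ψ x) = x := fun x => e.symm_apply_apply x
    refine Monoid.Coprod.hom_ext ?_ ?_
    · refine (MonoidHom.cancel_right f.rangeRestrict_surjective).1 (FreeGroup.ext_hom _ _ fun i => ?_)
      simp [f, χ, h3]
    · refine (MonoidHom.cancel_right g.rangeRestrict_surjective).1 (FreeGroup.ext_hom _ _ fun i => ?_)
      simp [g, χ, h3]
  constructor
  · intro x y hxy
    rw [← MonoidHom.id_apply _ x, ← MonoidHom.id_apply _ y, ← h2]
    simp [hxy]
  · intro y
    obtain ⟨x, rfl⟩ := hψ.2 y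
    exact ⟨χ x, DFunLike.congr_fun h1 x⟩

theorem _root_.IsFreeFactor.exists_extend_basis {H : Type} [Group H] [IsFreeGroup H] {M : Subgroup H}
    (hM : IsFreeFactor M) {ι : Type} (b : FreeGroup ι ≃* M) :
    ∃ (κ : Type) (e : FreeGroup (ι ⊕ κ) ≃* H), ∀ x, e (FreeGroup.map Sum.inl x) = b x := by
  obtain ⟨M', hM'⟩ := hM
  let E := MulEquiv.ofBijective _ hM'
  let κ := IsFreeGroup.Generators M'
  let b' : FreeGroup κ ≃* M' := IsFreeGroup.mulEquiv M'
  let ψ : FreeGroup (ι ⊕ κ) →* Monoid.Coprod M M' :=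
    FreeGroup.lift (Sum.elim (fun i => Monoid.Coprod.inl (b (of i)))
      fun i => Monoid.Coprod.inr (b' (of i)))
  let χ : Monoid.Coprod M M' →* FreeGroup (ι ⊕ κ) :=
    Monoid.Coprod.lift ((FreeGroup.map Sum.inl).comp (b.symm : M →* FreeGroup ι))
      ((FreeGroup.map Sum.inr).comp (b'.symm : M' →* FreeGroup κ))
  have h1 : χ.comp ψ = MonoidHom.id _ := by
    refine FreeGroup.ext_hom _ _ ?_
    rintro (i | i) <;> simp [χ, ψ]
  have h2 : ψ.comp χ = MonoidHom.id _ := by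
    refine Monoid.Coprod.hom_ext ?_ ?_
    · refine (MonoidHom.cancel_right b.surjective).1 (?_ : MonoidHom.comp _ b.toMonoidHom =
        MonoidHom.comp _ b.toMonoidHom)
      refine FreeGroup.ext_hom _ _ fun i => ?_
      simp [χ, ψ]
    · refine (MonoidHom.cancel_right b'.surjective).1 (?_ : MonoidHom.comp _ b'.toMonoidHom =
        MonoidHom.comp _ b'.toMonoidHom)
      refine FreeGroup.ext_hom _ _ fun i => ?_
      simp [χ, ψ]
  refine ⟨κ, (ψ.toMulEquiv χ h1 h2).trans E, fun x => ?_⟩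
  have h3 : (E.toMonoidHom.comp ψ).comp (FreeGroup.map Sum.inl) =
      M.subtype.comp b.toMonoidHom := by
    refine FreeGroup.ext_hom _ _ fun i => ?_
    simp [ψ, E]
  exact DFunLike.congr_fun h3 x

theorem _root_.IsFreeFactor.exists_basis {H : Type} [Group H] [IsFreeGroup H] {M : Subgroup H}
    (hM : IsFreeFactor M) :
    ∃ (ι κ : Type) (e : FreeGroup (ι ⊕ κ) ≃* H),
      M = (e.toMonoidHom.comp (FreeGroup.map Sum.inl)).range := by
  obtain ⟨κ, e, he⟩ := hM.exists_extend_basis (IsFreeGroup.mulEquiv M)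
  refine ⟨_, κ, e, ?_⟩
  ext x
  constructor
  · intro hx
    obtain ⟨y, hy⟩ := (IsFreeGroup.mulEquiv M).surjective ⟨x, hx⟩
    exact ⟨y, (he y).trans (congrArg Subtype.val hy)⟩
  · rintro ⟨y, rfl⟩
    exact (he y).symm ▸ (IsFreeGroup.mulEquiv M y).2

theorem _root_.IsFreeFactor.trans {H : Type} [Group H] [IsFreeGroup H] {M : Subgroup H}
    (hM : IsFreeFactor M) {M₁ : Subgroup M} (hM₁ : IsFreeFactor M₁) :
    IsFreeFactor (M₁.map M.subtype) := by
  obtain ⟨ι, κ, b, hb⟩ := hM₁.exists_basis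
  obtain ⟨κ', e, he⟩ := hM.exists_extend_basis b
  let ψ := (FreeGroup.freeGroupCongr (Equiv.sumAssoc ι κ κ').symm).trans e
  have h := isFreeFactor_of_bijective ψ.toMonoidHom ψ.bijective
  convert h using 1
  have h2 : ψ.toMonoidHom.comp (FreeGroup.map Sum.inl) =
      M.subtype.comp (b.toMonoidHom.comp (FreeGroup.map Sum.inl)) := by
    refine FreeGroup.ext_hom _ _ fun i => ?_
    have := he (of (Sum.inl i))
    simpa [ψ] using this
  rw [h2, hb, MonoidHom.map_range M.subtype]

theorem _root_.IsFreeFactor.fg {H : Type} [Group H] [IsFreeGroup H] [Group.FG H] {M : Subgroup H}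
    (hM : IsFreeFactor M) : M.FG := by
  obtain ⟨ι, κ, e, rfl⟩ := hM.exists_basis
  let ρ : FreeGroup (ι ⊕ κ) →* FreeGroup ι := FreeGroup.lift (Sum.elim of fun _ => 1)
  have hρ : ρ.comp (FreeGroup.map Sum.inl) = MonoidHom.id _ :=
    FreeGroup.ext_hom _ _ fun i => by simp [ρ]
  let f := (e.toMonoidHom.comp (FreeGroup.map Sum.inl)).rangeRestrict.comp
    (ρ.comp e.symm.toMonoidHom)
  have hf : Function.Surjective f := by
    rintro ⟨_, x, rfl⟩
    refine ⟨e (FreeGroup.map Sum.inl x), ?_⟩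
    have := DFunLike.congr_fun hρ x
    simp only [MonoidHom.comp_apply, MonoidHom.id_apply] at this
    refine Subtype.ext ?_
    change e (FreeGroup.map Sum.inl (ρ (e.symm (e (FreeGroup.map Sum.inl x))))) = _
    rw [e.symm_apply_apply, this]
    rfl
  exact (Group.fg_iff_subgroup_fg _).1 (Group.fg_of_surjective hf)

end FreeFactors

section Rank

/-- `H` is free on `b` generators. -/
def HasRank (H : Type) [Group H] (b : ℕ) : Prop := Nonempty (FreeGroup (Fin b) ≃* H)

/-- The number of homomorphisms to the group of order two. -/
noncomputable def homCount (H : Type) [Group H] : ℕ := Nat.card (H →* Multiplicative (ZMod 2))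

theorem homCount_congr {H H' : Type} [Group H] [Group H'] (e : H ≃* H') :
    homCount H = homCount H' :=
  Nat.card_congr (MulEquiv.monoidHomCongrLeftEquiv e)

theorem homCount_freeGroup (ι : Type) :
    homCount (FreeGroup ι) = Nat.card (ι → Multiplicative (ZMod 2)) :=
  Nat.card_congr FreeGroup.lift.symm

theorem card_two : Nat.card (Multiplicative (ZMod 2)) = 2 := by simp

theorem homCount_freeGroup' (ι : Type) [Finite ι] : homCount (FreeGroup ι) = 2 ^ Nat.card ι := by
  rw [homCount_freeGroup, Nat.card_fun, card_two]

theorem HasRank.homCount {H : Type} [Group H] {b : ℕ} (h : HasRank H b) : homCount H = 2 ^ b := by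
  obtain ⟨e⟩ := h
  rw [← homCount_congr e, homCount_freeGroup', Nat.card_fin]

theorem finite_hom {H : Type} [Group H] [Group.FG H] (G : Type) [Group G] [Finite G] :
    Finite (H →* G) := by
  obtain ⟨S, hS, hf⟩ := Group.fg_iff.1 (inferInstance : Group.FG H)
  have := hf.to_subtype
  refine Finite.of_injective (fun φ : H →* G => fun s : S => φ s) fun φ ψ h => ?_
  refine MonoidHom.eq_of_eqOn_dense hS fun s hs => congrFun h ⟨s, hs⟩

theorem finite_of_finite_fun {ι G : Type} [Nontrivial G] (h : Finite (ι → G)) : Finite ι := by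
  classical
  obtain ⟨x, y, hxy⟩ := exists_pair_ne G
  refine Finite.of_injective (fun i : ι => Function.update (fun _ => x) i y) fun i j hij => ?_
  by_contra hne
  have := congrFun hij i
  simp [hne, hxy.symm] at this

theorem finite_generators {ι H : Type} [Group H] [Group.FG H] (e : FreeGroup ι ≃* H) : Finite ι := by
  have h := finite_hom (H := H) (Multiplicative (ZMod 2))
  have h2 : Finite (FreeGroup ι →* Multiplicative (ZMod 2)) :=
    Finite.of_equiv _ (MulEquiv.monoidHomCongrLeftEquiv e.symm)
  exact finite_of_finite_fun (Finite.of_equiv _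
    (FreeGroup.lift (α := ι) (β := Multiplicative (ZMod 2))).symm)

theorem exists_hasRank {H : Type} [Group H] [IsFreeGroup H] [Group.FG H] : ∃ b, HasRank H b := by
  let e := IsFreeGroup.mulEquiv H
  have := finite_generators e
  exact ⟨_, ⟨(FreeGroup.freeGroupCongr (Finite.equivFin _).symm).trans e⟩⟩

/-- Adjoining `n` elements to a free group of rank `b` inside a free group of rank `a` requires
`a ≤ b + n`, with equality only when the subgroup is a free factor. -/
theorem rank_le_of_sup {F : Type} [Group F] {J K : Subgroup F} {s : Finset F}
    (hJK : K = J ⊔ Subgroup.closure (s : Set F)) {a b : ℕ} (hJ : HasRank J b) (hK : HasRank K a) :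
    a ≤ b + s.card ∧ (a = b + s.card → IsFreeFactor (J.subgroupOf K)) := by
  obtain ⟨eJ⟩ := hJ
  obtain ⟨eK⟩ := id hK
  have hJK' : J ≤ K := hJK ▸ le_sup_left
  have hsK : ∀ x : s, (x : F) ∈ K := fun x =>
    hJK ▸ (le_sup_right : _ ≤ J ⊔ Subgroup.closure (s : Set F)) (Subgroup.subset_closure x.2)
  let ψ : FreeGroup (Fin b ⊕ s) →* K :=
    FreeGroup.lift (Sum.elim (fun i => Subgroup.inclusion hJK' (eJ (of i))) fun x => ⟨x, hsK x⟩)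
  have hψ1 : ψ.comp (FreeGroup.map Sum.inl) = (Subgroup.inclusion hJK').comp eJ.toMonoidHom :=
    FreeGroup.ext_hom _ _ fun i => by simp [ψ]
  have hψ : Function.Surjective ψ := by
    have h1 : K ≤ ψ.range.map K.subtype := by
      conv_lhs => rw [hJK]
      refine sup_le (fun x hx => ?_) ((Subgroup.closure_le _).2 fun x hx => ?_)
      · obtain ⟨y, hy⟩ := eJ.surjective ⟨x, hx⟩
        refine ⟨ψ (FreeGroup.map Sum.inl y), ⟨_, rfl⟩, ?_⟩
        have := DFunLike.congr_fun hψ1 y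
        simp only [MonoidHom.comp_apply] at this
        rw [this]
        simpa using congrArg Subtype.val hy
      · exact ⟨ψ (of (Sum.inr ⟨x, hx⟩)), ⟨_, rfl⟩, by simp [ψ]⟩
    intro y
    obtain ⟨_, ⟨z, rfl⟩, hz⟩ := h1 y.2
    exact ⟨z, Subtype.ext hz⟩
  have hcard : Nat.card (Fin b ⊕ s) = b + s.card := by simp
  constructor
  · have h1 : homCount K ≤ homCount (FreeGroup (Fin b ⊕ s)) := by
      have : Finite (FreeGroup (Fin b ⊕ s) →* Multiplicative (ZMod 2)) := finite_hom _
      exact Nat.card_le_card_of_injective (fun φ => φ.comp ψ) fun φ φ' h =>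
        (MonoidHom.cancel_right hψ).1 h
    rw [hK.homCount, homCount_freeGroup', hcard] at h1
    exact (Nat.pow_le_pow_iff_right (by norm_num)).1 h1
  · intro hab
    have h1 : Function.Injective (eK.symm.toMonoidHom.comp ψ) :=
      injective_of_surjective_of_card_eq (by rw [hcard, Nat.card_fin, hab]) _
        (eK.symm.surjective.comp hψ)
    have h2 := isFreeFactor_of_bijective ψ ⟨Function.Injective.of_comp h1, hψ⟩
    convert h2 using 1
    rw [hψ1]
    ext x
    constructor
    · intro hx
      obtain ⟨y, hy⟩ := eJ.surjective ⟨x, hx⟩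
      exact ⟨y, Subtype.ext (show ((eJ y : J) : F) = x by rw [hy])⟩
    · rintro ⟨y, rfl⟩
      exact (eJ y).2

theorem _root_.IsFreeFactor.homCount_lt {H : Type} [Group H] [IsFreeGroup H] [Group.FG H] {M : Subgroup H}
    (hM : IsFreeFactor M) (hne : M ≠ ⊤) : homCount M < homCount H := by
  obtain ⟨ι, κ, e, rfl⟩ := hM.exists_basis
  have := finite_generators e
  have : Finite ι := Finite.of_injective (Sum.inl : ι → ι ⊕ κ) Sum.inl_injective
  have : Finite κ := Finite.of_injective (Sum.inr : κ → ι ⊕ κ) Sum.inr_injective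
  have hinj : Function.Injective (e.toMonoidHom.comp (FreeGroup.map (Sum.inl : ι → ι ⊕ κ))) :=
    e.injective.comp (FreeGroup.map_injective Sum.inl_injective)
  rw [← homCount_congr (MonoidHom.ofInjective hinj), ← homCount_congr e, homCount_freeGroup',
    homCount_freeGroup', Nat.card_sum]
  refine Nat.pow_lt_pow_right (by norm_num) (Nat.lt_add_of_pos_right ?_)
  rw [Nat.pos_iff_ne_zero, Ne, Nat.card_eq_zero]
  rintro (h | h)
  · refine hne (MonoidHom.range_eq_top.2 (e.surjective.comp fun x => ?_))
    have h1 : x ∈ (FreeGroup.map (Sum.inl : ι → ι ⊕ κ)).range := by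
      refine mem_of_forall_of_mem (MonoidHom.id _) x _ ?_
      rintro (i | i)
      · exact ⟨of i, by simp⟩
      · exact h.elim i
    exact h1
  · exact h.not_finite inferInstance

end Rank

end WordMeasure

namespace WordMeasure

open FreeGroup (of)
open Finset Filter Asymptotics

section Terms

open scoped Classical in
theorem exists_card_eq_earlier {V L F : Type} [Fintype V] [Group F] (σ : Setoid V) (c : Quotient σ)
    (l : V → L) (g : V → F) (hlg : ∀ p q, l p = l q → g p = g q → p = q) {D : Set F}
    (hD : ∀ p q, (g p)⁻¹ * g q ∈ D) :
    ∃ S : Finset F, (S : Set F) ⊆ D ∧ ∀ (K : Subgroup F) {B : Type} (κ : V → B),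
      (∀ p q, κ p = κ q ↔ l p = l q ∧ (g p)⁻¹ * g q ∈ K) → earlier κ σ c = #{x ∈ S | x ∈ K} := by
  let A : Finset (Quotient σ) := {c' | number c' < number c ∧ l c'.out = l c.out}
  refine ⟨A.image fun c' => (g c'.out)⁻¹ * g c.out, ?_, fun K B κ h => ?_⟩
  · intro x hx
    obtain ⟨c', -, rfl⟩ := mem_image.1 (mem_coe.1 hx)
    exact hD _ _
  · rw [filter_image, card_image_of_injOn, earlier]
    · congr 1
      ext c'
      simp only [A, mem_filter, h, mem_univ, true_and, and_assoc]
    · intro c' hc' c'' hc'' heq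
      simp only [A, coe_filter, mem_filter, mem_univ, true_and, Set.mem_ofPred_eq] at hc' hc''
      have h1 := hlg c'.out c''.out (hc'.1.2.trans hc''.1.2.symm)
        (inv_injective (mul_right_cancel heq))
      rw [← c'.out_eq, h1, c''.out_eq]

theorem earlier_eq_zero {V B : Type} [Fintype V] {κ : V → B} {σ : Setoid V}
    (h : ∀ p q, κ p = κ q → σ p q) (c : Quotient σ) : earlier κ σ c = 0 := by
  classical
  rw [earlier, card_eq_zero, filter_eq_empty_iff]
  rintro c' - ⟨h1, h2⟩
  have h3 : c' = c := by
    rw [← c'.out_eq, ← c.out_eq]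
    exact Quotient.sound (h _ _ h2)
  exact h1.ne (congrArg number h3)

variable {α : Type} {P : Set (FreeGroup α)}

/-- The differences of elements of `P`. -/
def diffs (P : Set (FreeGroup α)) : Set (FreeGroup α) := {g | ∃ p ∈ P, ∃ q ∈ P, g = p⁻¹ * q}

theorem edgeMap_eq_iff {K : Subgroup (FreeGroup α)} {s s' : Steps P} :
    edgeMap P K s = edgeMap P K s' ↔
      stepLab s = stepLab s' ∧ ((stepSrc s : FreeGroup α))⁻¹ * stepSrc s' ∈ K := by
  rw [edgeMap, edgeMap, Prod.mk_inj, vertMap_eq_iff]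

variable [Fintype P]

/-- The normalized contribution of a partition of `P`. -/
noncomputable def normTerm (σ : Setoid P) (N : ℕ) (K : Subgroup (FreeGroup α)) : ℝ :=
  (∏ c : Quotient σ, (1 - (N : ℝ)⁻¹ * earlier (vertMap P K) σ c)) *
    ∏ c : Quotient (edgeSetoid stepSrc stepLab σ), (1 - (N : ℝ)⁻¹ * earlier (edgeMap P K) _ c)⁻¹

theorem hasExpansion_normTerm (σ : Setoid P) : HasExpansion (diffs P) (normTerm σ) := by
  refine HasExpansion.mul (HasExpansion.prod _ fun c _ => ?_) (HasExpansion.prod _ fun c _ => ?_)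
  · obtain ⟨S, hS, h⟩ := exists_card_eq_earlier σ c (fun _ => ())
      (fun p : P => (p : FreeGroup α)) (fun p q _ h => Subtype.ext h) (D := diffs P)
      (fun p q => ⟨p, p.2, q, q.2, rfl⟩)
    convert hasExpansion_linear S hS using 6 with N K
    exact h K (vertMap P K) fun p q => by simp [vertMap_eq_iff]
  · obtain ⟨S, hS, h⟩ := exists_card_eq_earlier _ c stepLab
      (fun s : Steps P => (stepSrc s : FreeGroup α))
      (fun p q h h' => Subtype.ext (Prod.ext h h')) (D := diffs P)
      (fun p q => ⟨_, (stepSrc p).2, _, (stepSrc q).2, rfl⟩)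
    convert hasExpansion_inv S hS using 7 with N K
    exact h K (edgeMap P K) fun p q => edgeMap_eq_iff

theorem normTerm_ker (L : Subgroup (FreeGroup α)) (N : ℕ) :
    normTerm (Setoid.ker (vertMap P L)) N L = 1 := by
  rw [normTerm, prod_eq_one, prod_eq_one, mul_one]
  · intro c _
    rw [earlier_eq_zero]
    · simp
    · intro s s' h
      exact edgeSetoid_iff.2 (Prod.mk.inj h)
  · intro c _
    rw [earlier_eq_zero]
    · simp
    · exact fun p q h => h

theorem rank_relSubgroup (hP : IsConn P) {σ : Setoid P}
    (hσ : Folded stepSrc stepTgt stepLab σ) {b : ℕ} (hb : HasRank (relSubgroup σ) b) :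
    b + Fintype.card (Quotient σ) = Fintype.card (Quotient (edgeSetoid stepSrc stepLab σ)) + 1 := by
  set J := relSubgroup σ with hJ
  have hker := ker_vertMap_relSubgroup hP hσ
  rw [← hJ] at hker
  obtain ⟨e, -⟩ := exists_equiv_hom P hP J (relSubgroup_le_loops σ) (Multiplicative (ZMod 2))
  have h1 := Nat.card_congr e
  have hV : Nat.card (Vert P J) = Fintype.card (Quotient σ) := by
    rw [← Nat.card_eq_fintype_card]
    have h2 : Vert P J = Set.range (vertMap P J) := by
      ext x
      simp [vertMap]
    have h3 := Nat.card_congr (Setoid.quotientKerEquivRange (vertMap P J))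
    rw [h2, ← h3, hker]
  have hE : Nat.card (Edge P J) = Fintype.card (Quotient (edgeSetoid stepSrc stepLab σ)) := by
    rw [← Nat.card_eq_fintype_card]
    have h2 : Edge P J = Set.range (edgeMap P J) := by
      refine Set.Subset.antisymm (fun x hx => edgeMap_surjective P J ⟨x, hx⟩) ?_
      rintro _ ⟨s, rfl⟩
      exact edgeMap_mem P subset_rfl J s
    have h3 := Nat.card_congr (Setoid.quotientKerEquivRange (edgeMap P J))
    have h4 : Setoid.ker (edgeMap P J) = edgeSetoid stepSrc stepLab σ := by
      ext s s'
      rw [Setoid.ker_def, edgeMap_eq_iff, ← vertMap_eq_iff, ← Setoid.ker_def (f := vertMap P J), hker,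
        edgeSetoid_iff]
    rw [h2, ← h3, h4]
  rw [Nat.card_prod, Nat.card_prod, Nat.card_fun, Nat.card_fun, card_two, hV, hE] at h1
  have h2 := hb.homCount
  rw [homCount] at h2
  rw [h2, ← pow_succ, ← pow_add] at h1
  exact (Nat.pow_right_injective le_rfl h1).symm

theorem term_eq_normTerm (hP : IsConn P) {σ : Setoid P}
    (hσ : Folded stepSrc stepTgt stepLab σ) {b : ℕ} (hb : HasRank (relSubgroup σ) b)
    (K : Subgroup (FreeGroup α)) {N : ℕ} (hN : N ≠ 0) :
    (∏ c : Quotient σ, ((N : ℝ) - earlier (vertMap P K) σ c)) /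
      ∏ c : Quotient (edgeSetoid stepSrc stepLab σ), ((N : ℝ) - earlier (edgeMap P K) _ c) =
      N * ((N : ℝ)⁻¹ ^ b * normTerm σ N K) := by
  have hN' : (N : ℝ) ≠ 0 := by exact_mod_cast hN
  have h : ∀ x : ℝ, (N : ℝ) - x = N * (1 - (N : ℝ)⁻¹ * x) := fun x => by field_simp
  simp only [h, prod_mul_distrib, prod_const, normTerm, card_univ, prod_inv_distrib]
  have hr := rank_relSubgroup hP hσ hb
  have h2 : (N : ℝ) ^ Fintype.card (Quotient σ) * (N : ℝ) ^ b =
      N ^ Fintype.card (Quotient (edgeSetoid stepSrc stepLab σ)) * N := by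
    rw [← pow_add, ← pow_succ, ← hr, add_comm]
  have h3 : (N : ℝ) ^ Fintype.card (Quotient σ) /
      N ^ Fintype.card (Quotient (edgeSetoid stepSrc stepLab σ)) = N * (N : ℝ)⁻¹ ^ b := by
    rw [inv_pow, div_eq_iff (by positivity), ← mul_right_inj' (pow_ne_zero b hN')]
    field_simp
    linear_combination h2
  rw [mul_div_mul_comm, h3]
  ring

end Terms

end WordMeasure

namespace WordMeasure

open FreeGroup (of)
open Finset Filter Asymptotics

section ExpansionTheorem

variable {α : Type} {P : Set (FreeGroup α)}

theorem avgFix_eq_of_diffs (hPf : P.Finite) (hP : IsConn P) {K₁ K₂ : Subgroup (FreeGroup α)}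
    (hK₁ : K₁.FG) (hK₂ : K₂.FG) {w : FreeGroup α} (hw : w ∈ P) (hw₁ : w ∈ K₁) (hw₂ : w ∈ K₂)
    (h : ∀ p ∈ P, ∀ q ∈ P, (p⁻¹ * q ∈ K₁ ↔ p⁻¹ * q ∈ K₂)) :
    ∀ᶠ N in atTop, avgFix (⟨w, hw₁⟩ : K₁) N = avgFix (⟨w, hw₂⟩ : K₂) N := by
  classical
  have := hPf.fintype
  have hv : ∀ p q : P, vertMap P K₁ p = vertMap P K₁ q ↔ vertMap P K₂ p = vertMap P K₂ q :=
    fun p q => by rw [vertMap_eq_iff, vertMap_eq_iff, h p p.2 q q.2]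
  have he : ∀ s s' : Steps P, edgeMap P K₁ s = edgeMap P K₁ s' ↔ edgeMap P K₂ s = edgeMap P K₂ s' :=
    fun s s' => by
      rw [edgeMap_eq_iff, edgeMap_eq_iff, h _ (stepSrc s).2 _ (stepSrc s').2]
  have hker : Setoid.ker (vertMap P K₁) = Setoid.ker (vertMap P K₂) := Setoid.ext hv
  filter_upwards [eventually_ge_atTop (Fintype.card P), eventually_ge_atTop (Fintype.card (Steps P))]
    with N hN1 hN2
  rw [avgFix_eq_sum_partitions hP hK₁ ⟨w, hw⟩ hw₁ hN1 hN2,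
    avgFix_eq_sum_partitions hP hK₂ ⟨w, hw⟩ hw₂ hN1 hN2, hker]
  simp only [earlier_congr hv, earlier_congr he]

theorem eventually_pos_pow_add_sum {ι : Type} (s : Finset ι) (r : ℕ) (e : ι → ℕ → ℝ)
    (h : ∀ i ∈ s, e i =O[atTop] fun N : ℕ => ((N : ℝ)⁻¹) ^ (r + 1)) :
    ∀ᶠ N : ℕ in atTop, 0 < ((N : ℝ)⁻¹) ^ r + ∑ i ∈ s, e i N := by
  have h1 : (fun N : ℕ => ((N : ℝ)⁻¹) ^ (r + 1)) =o[atTop] fun N : ℕ => ((N : ℝ)⁻¹) ^ r := by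
    have h2 : (fun N : ℕ => (N : ℝ)⁻¹) =o[atTop] fun _ : ℕ => (1 : ℝ) :=
      (isLittleO_one_iff ℝ).2 tendsto_inv_atTop_nhds_zero_nat
    simpa [pow_succ] using (isBigO_refl (fun N : ℕ => ((N : ℝ)⁻¹) ^ r) atTop).mul_isLittleO h2
  have h3 := ((IsBigO.sum h).trans_isLittleO h1).def (c := 1 / 2) (by norm_num)
  filter_upwards [h3, eventually_gt_atTop 0] with N hN hN0
  have hpos : 0 < ((N : ℝ)⁻¹) ^ r := by
    have : (0 : ℝ) < N := by exact_mod_cast hN0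
    positivity
  rw [Finset.sum_apply, Real.norm_eq_abs, Real.norm_of_nonneg hpos.le] at hN
  have := neg_abs_le (∑ i ∈ s, e i N)
  linarith

theorem diffs_le_loops {S : Set (FreeGroup α)} (h : S ⊆ diffs P) {J : Subgroup (FreeGroup α)}
    (hS : S ⊆ J) : Subgroup.closure S ≤ loops P J :=
  Subgroup.closure_mono fun _ hx => ⟨hS hx, h hx⟩

theorem loops_mono {J J' : Subgroup (FreeGroup α)} (h : J ≤ J') : loops P J ≤ loops P J' :=
  Subgroup.closure_mono fun _ hx => ⟨h hx.1, hx.2⟩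

theorem sup_closure_le_loops (σ : Setoid P) {S : Set (FreeGroup α)} (h : S ⊆ diffs P) :
    relSubgroup σ ⊔ Subgroup.closure S ≤ loops P (relSubgroup σ ⊔ Subgroup.closure S) :=
  sup_le ((relSubgroup_le_loops σ).trans (loops_mono le_sup_left))
    (diffs_le_loops h (Subgroup.subset_closure.trans (le_sup_right (a := relSubgroup σ))))

open scoped Classical in
/-- The expansion of the expected number of fixed points over finitely many subgroups. -/
theorem exists_expansion (hPf : P.Finite) (hP : IsConn P) {w : FreeGroup α} (hw : w ∈ P) :
    ∃ (I : Type) (_ : Fintype I) (J : I → Subgroup (FreeGroup α)) (c : I → ℕ → ℝ),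
      (∀ i, (J i).FG ∧ w ∈ J i ∧ J i ≤ loops P (J i)) ∧
      (∀ (K : Subgroup (FreeGroup α)) (hK : w ∈ K), K.FG → ∀ᶠ N : ℕ in atTop,
        avgFix (⟨w, hK⟩ : K) N = N * ∑ i, if J i ≤ K then c i N else 0) ∧
      ∀ (L : Subgroup (FreeGroup α)) (hL : w ∈ L), L.FG → L ≤ loops P L →
        (∀ M : Subgroup L, IsFreeFactor M → (⟨w, hL⟩ : L) ∈ M → M = ⊤) →
        ∀ᶠ N : ℕ in atTop, 0 < ∑ i, if J i = L then c i N else 0 := by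
  have := hPf.fintype
  let w' : P := ⟨w, hw⟩
  let T := {σ : Setoid P // Folded stepSrc stepTgt stepLab σ ∧ σ w' ⟨1, hP.one_mem⟩}
  have hfg : ∀ σ : Setoid P, Group.FG (relSubgroup σ) := fun σ =>
    (Group.fg_iff_subgroup_fg _).2 (relSubgroup_fg σ)
  have hrank : ∀ σ : Setoid P, ∃ b, HasRank (relSubgroup σ) b := fun σ => exists_hasRank
  choose b hb using hrank
  choose ι hι s a h1 h2 h3 using fun σ : Setoid P => hasExpansion_normTerm σ
  let J : (Σ σ : T, ι σ.1) → Subgroup (FreeGroup α) := fun i =>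
    relSubgroup i.1.1 ⊔ Subgroup.closure (s i.1.1 i.2 : Set (FreeGroup α))
  have hwσ : ∀ σ : T, w ∈ relSubgroup σ.1 := fun σ =>
    Subgroup.subset_closure ⟨⟨1, hP.one_mem⟩, w', σ.1.symm σ.2.2, by simp [w']⟩
  refine ⟨Σ σ : T, ι σ.1, inferInstance, J, fun i N => (N : ℝ)⁻¹ ^ b i.1.1 * a i.1.1 i.2 N,
    fun i => ⟨?_, ?_, sup_closure_le_loops _ (h1 _ _)⟩, fun K hK hKfg => ?_,
    fun L hL hLfg hLl halg => ?_⟩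
  · exact (relSubgroup_fg _).sup ⟨_, rfl⟩
  · exact (le_sup_left : _ ≤ J i) (hwσ _)
  · have h4 : ∀ᶠ N in atTop, ∀ σ : Setoid P, ∀ K : Subgroup (FreeGroup α),
        normTerm σ N K = ∑ i, if (s σ i : Set (FreeGroup α)) ⊆ K then a σ i N else 0 :=
      eventually_all.2 h3
    filter_upwards [h4, eventually_ge_atTop (Fintype.card P),
      eventually_ge_atTop (Fintype.card (Steps P)), eventually_ne_atTop 0] with N hN hN1 hN2 hN0
    rw [avgFix_eq_sum_partitions hP hKfg w' hK hN1 hN2, Fintype.sum_sigma, mul_sum,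
      sum_subtype (p := fun σ : Setoid P => Folded stepSrc stepTgt stepLab σ ∧
        σ w' ⟨1, hP.one_mem⟩) _ (fun x => by simp)]
    refine sum_congr rfl fun σ _ => ?_
    rw [term_eq_normTerm hP σ.2.1 (hb _) K hN0, hN]
    have h5 : ∀ i, J ⟨σ, i⟩ ≤ K ↔ relSubgroup σ.1 ≤ K ∧ (s σ.1 i : Set (FreeGroup α)) ⊆ K :=
      fun i => by rw [sup_le_iff, Subgroup.closure_le]
    simp only [h5, ← relSubgroup_le_iff]
    by_cases h6 : relSubgroup σ.1 ≤ K
    · simp only [h6, true_and, if_true, mul_sum]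
      refine sum_congr rfl fun i _ => ?_
      split_ifs <;> simp
    · simp [h6]
  · have hLFG : Group.FG L := (Group.fg_iff_subgroup_fg _).2 hLfg
    obtain ⟨r, hr⟩ := exists_hasRank (H := L)
    let π : T := ⟨Setoid.ker (vertMap P L), folded_ker_vertMap L, by
      rw [Setoid.ker_def, vertMap_eq_iff]
      simpa [w'] using hL⟩
    have hπ : relSubgroup π.1 = L :=
      (relSubgroup_ker_vertMap L).trans (le_antisymm (loops_le P L) hLl)
    have hbr : b π.1 = r := by
      have h5 := (hb π.1).homCount
      rw [hπ, hr.homCount] at h5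
      exact (Nat.pow_right_injective le_rfl h5).symm
    have h4 := eventually_pos_pow_add_sum (univ.filter fun i : Σ σ : T, ι σ.1 => i.1 ≠ π) r
      (fun i N => if J i = L then (N : ℝ)⁻¹ ^ b i.1.1 * a i.1.1 i.2 N else 0) (by
        intro i hi
        by_cases hJ : J i = L
        · simp only [hJ, if_true]
          have hr' : HasRank (J i) r := hJ ▸ hr
          obtain ⟨h5, h6⟩ := rank_le_of_sup (s := s i.1.1 i.2) (K := L) hJ.symm (hb i.1.1) hr
          have h7 : r ≠ b i.1.1 + #(s i.1.1 i.2) := by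
            intro h
            have h8 := halg _ (h6 h) (hwσ i.1)
            rw [Subgroup.subgroupOf_eq_top] at h8
            have h9 : relSubgroup i.1.1 = L := le_antisymm (hJ ▸ le_sup_left) h8
            refine (mem_filter.1 hi).2 (Subtype.ext ?_)
            rw [← ker_vertMap_relSubgroup hP i.1.2.1, h9]
          refine (((isBigO_refl _ _).mul (h2 _ _)).trans ?_)
          simp only [← pow_add]
          exact inv_pow_isBigO (by omega)
        · simp only [hJ, if_false]
          exact isBigO_zero _ _)
    filter_upwards [h4, h3 π.1] with N hN hN3
    rw [← sum_filter_add_sum_filter_not univ (fun i : Σ σ : T, ι σ.1 => i.1 ≠ π), add_comm]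
    convert hN using 2
    have h5 : (univ.filter fun i : Σ σ : T, ι σ.1 => ¬ i.1 ≠ π) =
        (univ : Finset (ι π.1)).map ⟨fun i => (⟨π, i⟩ : Σ σ : T, ι σ.1),
          sigma_mk_injective (β := fun σ : T => ι σ.1)⟩ := by
      ext ⟨σ, i⟩
      simp only [mem_filter, mem_univ, true_and, not_not, Finset.mem_map, Function.Embedding.coeFn_mk]
      constructor
      · rintro rfl
        exact ⟨i, rfl⟩
      · rintro ⟨j, hj⟩
        exact (congrArg Sigma.fst hj).symm
    have h6 : ∀ i, J ⟨π, i⟩ = L ↔ (s π.1 i : Set (FreeGroup α)) ⊆ L := fun i => by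
      change relSubgroup π.1 ⊔ _ = L ↔ _
      rw [hπ, sup_eq_left, Subgroup.closure_le]
    rw [h5, sum_map]
    simp only [Function.Embedding.coeFn_mk, h6, hbr]
    have h7 := hN3 L
    rw [normTerm_ker] at h7
    simp only [← mul_ite_zero, ← mul_sum, ← h7, mul_one]

end ExpansionTheorem

end WordMeasure

namespace WordMeasure

open FreeGroup (of)
open Finset Filter

section Vanishing

variable {α : Type}

theorem IsConn.map_inl {ι κ : Type} {P : Set (FreeGroup ι)} (hP : IsConn P) :
    IsConn (FreeGroup.map (Sum.inl : ι → ι ⊕ κ) '' P) := by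
  have h : ∀ p, Reach P p → Reach (FreeGroup.map (Sum.inl : ι → ι ⊕ κ) '' P)
      (FreeGroup.map Sum.inl p) := by
    intro p hp
    induction hp with
    | one h =>
      rw [_root_.map_one]
      exact .one ⟨1, h, _root_.map_one _⟩
    | mul a p _ h ih =>
      rw [_root_.map_mul, FreeGroup.map.of]
      exact .mul _ _ ih ⟨_, h, by simp⟩
    | inv a p _ h ih =>
      rw [_root_.map_mul, map_inv, FreeGroup.map.of]
      exact .inv _ _ ih ⟨_, h, by simp⟩
  refine ⟨⟨1, hP.one_mem, _root_.map_one _⟩, ?_⟩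
  rintro _ ⟨p, hp, rfl⟩
  exact h p (hP.2 p hp)

theorem loops_mono_left {P P' : Set (FreeGroup α)} (h : P ⊆ P') (K : Subgroup (FreeGroup α)) :
    loops P K ≤ loops P' K := by
  refine Subgroup.closure_mono ?_
  rintro _ ⟨hK, p, hp, q, hq, rfl⟩
  exact ⟨hK, p, h hp, q, h hq, rfl⟩

theorem avgFix_map {F F' : Type} [Group F] [Group F'] {θ : F →* F'} (hθ : Function.Injective θ)
    (H : Subgroup F) {g : F} (hg : g ∈ H) (hg' : θ g ∈ H.map θ) (N : ℕ) :
    avgFix (⟨θ g, hg'⟩ : H.map θ) N = avgFix (⟨g, hg⟩ : H) N :=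
  avgFix_congr (H.equivMapOfInjective θ hθ) ⟨g, hg⟩ N

/-- The expected number of fixed points of an element of a free factor that lies in `L` only
depends on finitely generated subgroups of the intersection of `L` with the free factor. -/
theorem exists_core {ι κ : Type} {L : Subgroup (FreeGroup (ι ⊕ κ))} (hL : L.FG) {w : FreeGroup ι}
    (hw : FreeGroup.map Sum.inl w ∈ L) {S : Set (FreeGroup ι)} (hS : S.Finite)
    (hSL : ∀ x ∈ S, FreeGroup.map Sum.inl x ∈ L) :
    ∃ (M : Subgroup (FreeGroup (ι ⊕ κ))) (hwM : FreeGroup.map Sum.inl w ∈ M),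
      M.FG ∧ M ≤ L ∧ M ≤ (FreeGroup.map Sum.inl).range ∧ (∀ x ∈ S, FreeGroup.map Sum.inl x ∈ M) ∧
      ∀ᶠ N in atTop, avgFix (⟨_, hw⟩ : L) N = avgFix (⟨_, hwM⟩ : M) N := by
  obtain ⟨P, hP, hc, hwS⟩ := exists_isConn_superset (hS.insert w)
  let i : FreeGroup ι →* FreeGroup (ι ⊕ κ) := FreeGroup.map Sum.inl
  have hfin : (i '' P).Finite := hP.image _
  have := hfin.to_subtype
  have hmem : ∀ x ∈ P, i x ∈ L → i x ∈ loops (i '' P) L := fun x hx hxL =>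
    Subgroup.subset_closure ⟨hxL, 1, ⟨1, hc.one_mem, _root_.map_one _⟩, i x, ⟨x, hx, rfl⟩, by simp⟩
  have hwM := hmem w (hwS (Set.mem_insert _ _)) hw
  refine ⟨loops (i '' P) L, hwM, loops_fg L, loops_le _ _, ?_,
    fun x hx => hmem x (hwS (Set.mem_insert_of_mem _ hx)) (hSL x hx), ?_⟩
  · refine (Subgroup.closure_le _).2 ?_
    rintro _ ⟨-, _, ⟨p, -, rfl⟩, _, ⟨q, -, rfl⟩, rfl⟩
    exact ⟨p⁻¹ * q, by simp [i]⟩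
  · exact avgFix_eq_of_diffs hfin hc.map_inl hL (loops_fg L)
      ⟨w, hwS (Set.mem_insert _ _), rfl⟩ hw hwM fun p hp q hq =>
        ⟨fun h => Subgroup.subset_closure ⟨h, p, hp, q, hq, rfl⟩, fun h => loops_le _ _ h⟩

/-- An expansion of the expected number of fixed points of `w` over a finite set of subgroups. -/
structure IsExpansion (w : FreeGroup α) (𝓛 : Finset (Subgroup (FreeGroup α)))
    (R : Subgroup (FreeGroup α) → ℕ → ℝ) : Prop where
  fg : ∀ L ∈ 𝓛, L.FG
  mem : ∀ L ∈ 𝓛, w ∈ L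
  eq : ∀ (K : Subgroup (FreeGroup α)) (hK : w ∈ K), K.FG →
    ∀ᶠ N : ℕ in atTop, avgFix (⟨w, hK⟩ : K) N = N * ∑ L ∈ 𝓛, open scoped Classical in
      if L ≤ K then R L N else 0

open scoped Classical in
theorem IsExpansion.vanish {w : FreeGroup α} {𝓛 : Finset (Subgroup (FreeGroup α))}
    {R : Subgroup (FreeGroup α) → ℕ → ℝ} (h : IsExpansion w 𝓛 R) {K : Subgroup (FreeGroup α)}
    {B : Subgroup K} (hB : IsFreeFactor B) (hw : w ∈ B.map K.subtype) (L : 𝓛) (hLK : L.1 ≤ K)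
    (hLB : ¬ L.1 ≤ B.map K.subtype) : ∀ᶠ N in atTop, R L N = 0 := by
  obtain ⟨ι, κ, e, he⟩ := hB.exists_basis
  let θ : FreeGroup (ι ⊕ κ) →* FreeGroup α := K.subtype.comp e.toMonoidHom
  have hθ : Function.Injective θ := K.subtype_injective.comp e.injective
  have hrange : K = θ.range := by
    rw [MonoidHom.range_comp, MonoidHom.range_eq_top.2 e.surjective, ← MonoidHom.range_eq_map,
      Subgroup.range_subtype]
  have hB' : B.map K.subtype = (FreeGroup.map Sum.inl).range.map θ := by
    rw [he, MonoidHom.range_comp, Subgroup.map_map]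
  generalize B.map K.subtype = B' at *
  have hinj : Function.Injective (θ.comp (FreeGroup.map (Sum.inl : ι → ι ⊕ κ))) :=
    hθ.comp (FreeGroup.map_injective Sum.inl_injective)
  have hBr : B' = (θ.comp (FreeGroup.map (Sum.inl : ι → ι ⊕ κ))).range := by
    rw [hB', MonoidHom.map_range]
  obtain ⟨w₀, hw₀⟩ : w ∈ (θ.comp (FreeGroup.map (Sum.inl : ι → ι ⊕ κ))).range := hBr ▸ hw
  induction L using WellFoundedLT.induction with
  | ind L ih =>
  have hcomap : (L.1.comap θ).map θ = L.1 := Subgroup.map_comap_eq_self (hrange ▸ hLK)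
  obtain ⟨L', hL'⟩ : ∃ L', Subgroup.map θ L' = L.1 := ⟨_, hcomap⟩
  have hmemL : ∀ x, θ x ∈ L.1 → x ∈ L' := fun x hx => by
    rw [← hL'] at hx
    obtain ⟨y, hy, hxy⟩ := hx
    exact hθ hxy ▸ hy
  have hL'fg : L'.FG := by
    have h1 := (Group.fg_iff_subgroup_fg _).2 (h.fg L L.2)
    rw [← hL'] at h1
    exact (Group.fg_iff_subgroup_fg _).1
      (Group.fg_of_surjective (f := (L'.equivMapOfInjective θ hθ).symm.toMonoidHom)
        (L'.equivMapOfInjective θ hθ).symm.surjective)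
  choose! g hg hgfin using fun L hL => (Subgroup.fg_iff _).1 (h.fg L hL)
  let S : Set (FreeGroup ι) := (θ.comp (FreeGroup.map (Sum.inl : ι → ι ⊕ κ))) ⁻¹'
    ⋃ M ∈ 𝓛.filter (· ≤ L.1), g M
  have hS : S.Finite := by
    refine Set.Finite.preimage hinj.injOn ?_
    exact (𝓛.filter (· ≤ L.1)).finite_toSet.biUnion fun M hM => hgfin M (mem_filter.1 hM).1
  have hwL : FreeGroup.map Sum.inl w₀ ∈ L' := hmemL _ (by
    have h1 := h.mem L L.2
    rwa [← hw₀] at h1)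
  obtain ⟨M, hwM, hMfg, hML, hMr, hSM, hN⟩ := exists_core hL'fg hwL hS (by
    intro x hx
    obtain ⟨M, hM, hxM⟩ := Set.mem_iUnion₂.1 hx
    obtain ⟨hM, hML⟩ := mem_filter.1 hM
    refine hmemL _ (hML ?_)
    rw [← hg M hM]
    exact Subgroup.subset_closure hxM)
  have hwM' : w ∈ M.map θ := ⟨_, hwM, hw₀⟩
  have hMfg' : (M.map θ).FG := by
    have h1 := (Group.fg_iff_subgroup_fg _).2 hMfg
    exact (Group.fg_iff_subgroup_fg _).1
      (Group.fg_of_surjective (f := (M.equivMapOfInjective θ hθ).toMonoidHom)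
        (M.equivMapOfInjective θ hθ).surjective)
  have hle : ∀ M' ∈ 𝓛, (M' ≤ M.map θ ↔ M' ≤ L.1 ∧ M' ≤ B') := by
    intro M' hM'
    constructor
    · intro h1
      exact ⟨h1.trans (hL' ▸ Subgroup.map_mono hML), h1.trans (hB' ▸ Subgroup.map_mono hMr)⟩
    · rintro ⟨h1, h2⟩
      rw [← hg M' hM', Subgroup.closure_le]
      intro x hx
      have hxM' : x ∈ M' := by
        rw [← hg M' hM']
        exact Subgroup.subset_closure hx
      have h3 := h2 hxM'
      rw [hBr] at h3
      obtain ⟨y, rfl⟩ := h3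
      exact ⟨_, hSM y (Set.mem_iUnion₂.2 ⟨M', mem_filter.2 ⟨hM', h1⟩, hx⟩), rfl⟩
  have hrest : ∀ᶠ N in atTop, ∀ M' ∈ 𝓛, M' < L.1 → ¬ M' ≤ B' → R M' N = 0 := by
    refine (eventually_all_finset _).2 fun M' hM' => ?_
    by_cases h1 : M' < L.1 ∧ ¬ M' ≤ B'
    · filter_upwards [ih ⟨M', hM'⟩ h1.1 (h1.1.le.trans hLK) h1.2] with N hN _ _ using hN
    · exact Eventually.of_forall fun N h2 h3 => (h1 ⟨h2, h3⟩).elim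
  filter_upwards [hN, h.eq L (h.mem L L.2) (h.fg L L.2), h.eq _ hwM' hMfg', hrest,
    eventually_ne_atTop 0] with N hN h1 h2 h3 hN0
  have h4 : avgFix (⟨w, h.mem L L.2⟩ : L.1) N = avgFix (⟨w, hwM'⟩ : M.map θ) N := by
    subst hw₀
    have h5 := avgFix_map hθ M hwM hwM' N
    have h6 := avgFix_map hθ L' hwL ⟨_, hwL, rfl⟩ N
    have h7 : ∀ (L₁ : Subgroup (FreeGroup α)) (h1 : L'.map θ = L₁) (h2 : _ ∈ L₁),
        avgFix (⟨θ (FreeGroup.map Sum.inl w₀), h2⟩ : L₁) N = avgFix (⟨_, hwL⟩ : L') N := by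
      rintro _ rfl _
      exact h6
    exact (h7 _ hL' _).trans (hN.trans h5.symm)
  rw [h1, h2, mul_right_inj' (by exact_mod_cast hN0), ← sub_eq_zero, ← sum_sub_distrib,
    sum_eq_single_of_mem L.1 L.2] at h4
  · rw [if_pos le_rfl, if_neg, sub_zero] at h4
    · exact h4
    · rw [hle L L.2]
      exact fun h5 => hLB h5.2
  · intro M' hM' hne
    by_cases h5 : M' ≤ L.1
    · by_cases h6 : M' ≤ B'
      · rw [if_pos h5, if_pos ((hle M' hM').2 ⟨h5, h6⟩), sub_self]
      · rw [h3 M' hM' (lt_of_le_of_ne h5 hne) h6]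
        simp
    · rw [if_neg h5, if_neg fun h6 => h5 ((hle M' hM').1 h6).1, sub_self]

end Vanishing

end WordMeasure

namespace WordMeasure

open FreeGroup (of)
open Finset Filter

section MainTheorem

variable {α : Type}

open scoped Classical in
theorem exists_isExpansion {P : Set (FreeGroup α)} (hPf : P.Finite) (hP : IsConn P)
    {w : FreeGroup α} (hw : w ∈ P) :
    ∃ (𝓛 : Finset (Subgroup (FreeGroup α))) (R : Subgroup (FreeGroup α) → ℕ → ℝ),
      IsExpansion w 𝓛 R ∧ (∀ L ∈ 𝓛, L ≤ loops P L) ∧ (∀ L, L ∉ 𝓛 → ∀ N, R L N = 0) ∧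
      ∀ (L : Subgroup (FreeGroup α)) (hL : w ∈ L), L.FG → L ≤ loops P L →
        (∀ M : Subgroup L, IsFreeFactor M → (⟨w, hL⟩ : L) ∈ M → M = ⊤) →
        ∀ᶠ N in atTop, 0 < R L N := by
  obtain ⟨I, _, J, c, h1, h2, h3⟩ := exists_expansion hPf hP hw
  refine ⟨univ.image J, fun L N => ∑ i, if J i = L then c i N else 0, ⟨?_, ?_, ?_⟩, ?_, ?_, h3⟩
  · simpa using fun i => (h1 i).1
  · simpa using fun i => (h1 i).2.1
  · intro K hK hKfg
    filter_upwards [h2 K hK hKfg] with N hN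
    rw [hN, ← sum_fiberwise_of_maps_to (fun i _ => mem_image_of_mem J (mem_univ i))]
    congr 1
    refine sum_congr rfl fun L _ => ?_
    rw [sum_filter]
    split_ifs with h
    · refine sum_congr rfl fun i _ => ?_
      by_cases hi : J i = L
      · simp [hi, h]
      · simp [hi]
    · refine sum_eq_zero fun i _ => ?_
      by_cases hi : J i = L
      · simp [hi, h]
      · simp [hi]
  · simpa using fun i => (h1 i).2.2
  · intro L hL N
    refine sum_eq_zero fun i _ => if_neg fun h => hL ?_
    exact h ▸ mem_image_of_mem J (mem_univ i)

theorem _root_.IsFreeFactor.top {H : Type} [Group H] [IsFreeGroup H] :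
    IsFreeFactor (⊤ : Subgroup H) := by
  let e : FreeGroup (IsFreeGroup.Generators H ⊕ Empty) ≃* H :=
    (FreeGroup.freeGroupCongr (Equiv.sumEmpty _ _)).trans (IsFreeGroup.mulEquiv H)
  convert isFreeFactor_of_bijective e.toMonoidHom e.bijective using 1
  have h : e.toMonoidHom.comp (FreeGroup.map Sum.inl) = (IsFreeGroup.mulEquiv H).toMonoidHom :=
    FreeGroup.ext_hom _ _ fun i => by simp [e]
  rw [h, eq_comm, MonoidHom.range_eq_top]
  exact (IsFreeGroup.mulEquiv H).surjective

open scoped Classical in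
/-- Let `w` lie in a finitely generated subgroup `J` of a free group, but in no proper free factor
of `J`. If `J` is not a free factor, then the average number of fixed points of `w` is
eventually smaller over `J` than over the whole group. -/
theorem avgFix_lt [Finite α] {J : Subgroup (FreeGroup α)} (hJ : J.FG) {w : FreeGroup α}
    (hwJ : w ∈ J) (hw : ∀ M : Subgroup J, IsFreeFactor M → (⟨w, hwJ⟩ : J) ∈ M → M = ⊤)
    (hnff : ¬ IsFreeFactor J) :
    ∀ᶠ N in atTop, avgFix (⟨w, hwJ⟩ : J) N < avgFix w N := by
  obtain ⟨K, ⟨hK, hJK⟩, hmin⟩ := (measure fun K : Subgroup (FreeGroup α) => homCount K).wf.has_min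
    {K | IsFreeFactor K ∧ J ≤ K} ⟨⊤, .top, le_top⟩
  have hKfg : K.FG := hK.fg
  have hKfg' : Group.FG K := (Group.fg_iff_subgroup_fg _).2 hKfg
  obtain ⟨P₀, hP₀, hc₀, hwP₀⟩ := exists_isConn_mem w
  obtain ⟨P₁, hP₁, hc₁, hP₀₁, hJP₁⟩ := exists_isConn_le_loops hP₀ hc₀ hJ
  obtain ⟨P, hP, hc, hP₁₂, hKP⟩ := exists_isConn_le_loops hP₁ hc₁ hKfg
  obtain ⟨𝓛, R, hexp, hloops, hzero, hpos⟩ := exists_isExpansion hP hc (hP₁₂ (hP₀₁ hwP₀))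
  have hmem : ∀ L, (∀ᶠ N in atTop, 0 < R L N) → L ∈ 𝓛 := fun L hL => by
    by_contra h
    obtain ⟨N, hN⟩ := hL.exists
    exact hN.ne' (hzero L h N)
  have hJpos := hpos J hwJ hJ (hJP₁.trans (loops_mono_left hP₁₂ J)) hw
  have hKpos : ∀ᶠ N in atTop, 0 < R K N := by
    refine hpos K (hJK hwJ) hKfg hKP fun M hM hwM => ?_
    by_contra hne
    have hlt : homCount (M.map K.subtype) < homCount K := by
      rw [← homCount_congr (M.equivMapOfInjective K.subtype K.subtype_injective)]
      exact hM.homCount_lt hne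
    have hJM : ¬ J ≤ M.map K.subtype := fun h => hmin _ ⟨hK.trans hM, h⟩ hlt
    obtain ⟨N, h1, h2⟩ := (hJpos.and
      (hexp.vanish hM ⟨_, hwM, rfl⟩ ⟨J, hmem J hJpos⟩ hJK hJM)).exists
    exact h1.ne' h2
  have hnonneg : ∀ᶠ N in atTop, ∀ L ∈ 𝓛, 0 ≤ R L N := by
    refine (eventually_all_finset _).2 fun L hL => ?_
    by_cases h : ∀ M : Subgroup L, IsFreeFactor M → (⟨w, hexp.mem L hL⟩ : L) ∈ M → M = ⊤
    · exact (hpos L (hexp.mem L hL) (hexp.fg L hL) (hloops L hL) h).mono fun N => le_of_lt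
    · push Not at h
      obtain ⟨M, hM, hwM, hne⟩ := h
      refine (hexp.vanish hM ⟨_, hwM, rfl⟩ ⟨L, hL⟩ le_rfl fun hLM => hne ?_).mono fun N h => h.ge
      refine (Subgroup.eq_top_iff' _).2 fun x => ?_
      obtain ⟨y, hy, hyx⟩ := hLM x.2
      exact Subtype.ext hyx ▸ hy
  have hKJ : ¬ K ≤ J := fun h => hnff (le_antisymm hJK h ▸ hK)
  filter_upwards [hexp.eq J hwJ hJ, hexp.eq ⊤ (Subgroup.mem_top w)
    ((Group.fg_def).1 inferInstance), hKpos, hnonneg, eventually_gt_atTop 0] with N h1 h2 h3 h4 hN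
  rw [h1, ← avgFix_congr Subgroup.topEquiv.symm w N]
  refine lt_of_lt_of_eq ?_ h2.symm
  refine mul_lt_mul_of_pos_left ?_ (by exact_mod_cast hN)
  refine sum_lt_sum (fun L hL => ?_) ⟨K, hmem K hKpos, ?_⟩
  · have := h4 L hL
    split_ifs <;> simp_all
  · rw [if_neg hKJ, if_pos le_top]
    exact h3

theorem avgFix_freeGroup [Fintype α] [DecidableEq α] (g : FreeGroup α) (N : ℕ) :
    avgFix g N = (∑ f : α → Equiv.Perm (Fin N), (numFixedPoints (FreeGroup.lift f g) : ℝ)) /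
      Fintype.card (α → Equiv.Perm (Fin N)) := by
  rw [avgFix, ← Nat.card_congr FreeGroup.lift, Nat.card_eq_fintype_card,
    ← finsum_eq_sum_of_fintype]
  congr 1
  exact (finsum_eq_of_bijective FreeGroup.lift FreeGroup.lift.bijective fun _ => rfl).symm

theorem cast_trw (r N : ℕ) (g : FreeGroup (Fin r)) : (trw r N g : ℝ) = avgFix g N := by
  rw [avgFix_freeGroup, trw]
  push_cast
  rfl

theorem _root_.IsFreeFactor.comap {H H' : Type} [Group H] [Group H'] [IsFreeGroup H'] (e : H ≃* H')
    {M : Subgroup H'} (hM : IsFreeFactor M) : IsFreeFactor (M.comap e.toMonoidHom) := by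
  obtain ⟨ι, κ, b, rfl⟩ := hM.exists_basis
  let ψ := b.trans e.symm
  convert isFreeFactor_of_bijective ψ.toMonoidHom ψ.bijective using 1
  ext x
  constructor
  · rintro ⟨y, hy⟩
    exact ⟨y, e.symm_apply_eq.2 hy⟩
  · rintro ⟨y, rfl⟩
    exact ⟨y, (e.apply_symm_apply _).symm⟩

end MainTheorem

end WordMeasure

/-- If `w ∈ F_k` is not contained in a proper free factor of `F_k`, and
`u_1, …, u_k ∈ F_r` are free (satisfy no non-trivial relation) but do not generate a
free factor of `F_r`, then for every large enough `N` one has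
`Tr_w(N) < Tr_{w(u_1,…,u_k)}(N)`. -/
theorem trw_lt_trw_of_free_not_free_factor
    (k r : ℕ) (w : FreeGroup (Fin k))
    (hw : ∀ M : Subgroup (FreeGroup (Fin k)), IsFreeFactor M → w ∈ M → M = ⊤)
    (u : Fin k → FreeGroup (Fin r))
    (hfree : Function.Injective (FreeGroup.lift u))
    (hnff : ¬ IsFreeFactor (Subgroup.closure (Set.range u))) :
    ∃ N₀ : ℕ, ∀ N : ℕ, N₀ ≤ N → trw k N w < trw r N ((FreeGroup.lift u) w) := by
  rw [← FreeGroup.range_lift_eq_closure] at hnff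
  let e := MonoidHom.ofInjective hfree
  have hfg : (FreeGroup.lift u).range.FG := (Group.fg_iff_subgroup_fg _).1 inferInstance
  refine Filter.eventually_atTop.1
    ((WordMeasure.avgFix_lt hfg (e w).2 (fun M hM hwM => ?_) hnff).mono fun N hN => ?_)
  · have h := hw _ (hM.comap e) hwM
    refine (Subgroup.eq_top_iff' _).2 fun x => ?_
    obtain ⟨y, rfl⟩ := e.surjective x
    exact (Subgroup.eq_top_iff' _).1 h y
  · rw [← Rat.cast_lt (K := ℝ), WordMeasure.cast_trw, WordMeasure.cast_trw,
      ← WordMeasure.avgFix_congr e w N]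
    exact hN
end
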